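/- arXiv:math/0403145 — 2 statements merged into one kernel-verified Lean document; each statement's English description precedes it below -/
import Mathlib

section
/- Let n ≥ 4 and let x ∈ B_n be a root of a central element, i.e., x^k ∈ Z(B_n) for some nonzero integer k. Then x is conjugate in B_n to a power of δ or to a power of γ, where δ = σ_1σ_2⋯σ_{n−1} and γ = σ_1δ = σ_1^2σ_2⋯σ_{n−1}. -/
/-- Relators for the braid group with generators `σ_0, …, σ_{m-1}`:
the braid relations `σ_i σ_j σ_i = σ_j σ_i σ_j` for `j = i+1`, and the
commutation relations `σ_i σ_j = σ_j σ_i` for `j ≥ i+2`. -/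
def braidRels (m : ℕ) : Set (FreeGroup (Fin m)) :=
  { r | ∃ i j : Fin m,
      ((i : ℕ) + 1 = (j : ℕ) ∧
        r = FreeGroup.of i * FreeGroup.of j * FreeGroup.of i *
            (FreeGroup.of j * FreeGroup.of i * FreeGroup.of j)⁻¹) ∨
      ((i : ℕ) + 2 ≤ (j : ℕ) ∧
        r = FreeGroup.of i * FreeGroup.of j * (FreeGroup.of j * FreeGroup.of i)⁻¹) }

/-- The braid group on `n` strands: the presented group with generators
`σ_1, …, σ_{n-1}` (indexed by `Fin (n-1)`) and the braid relators. -/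
abbrev BraidGroup (n : ℕ) : Type := PresentedGroup (braidRels (n - 1))

/-- The standard generator `σ_{i+1}` of the braid group (0-indexed). -/
def braidσ (n : ℕ) (i : Fin (n - 1)) : BraidGroup n := PresentedGroup.of i

/-- The element `δ = σ_1 σ_2 ⋯ σ_{n-1}` of the braid group. -/
def braidδ (n : ℕ) : BraidGroup n := (List.ofFn (braidσ n)).prod

/-- The full twist `z = (σ_1 σ_2 ⋯ σ_{n-1})^n`. -/
def fullTwist (n : ℕ) : BraidGroup n := braidδ n ^ n

/-- A group with a conjugation-invariant length function and an element `c` such that the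
interval below `c` in the associated prefix order has meets. -/
structure DualGarside (W : Type*) [Group W] where
  /-- The length function. -/
  L : W → ℕ
  /-- The Coxeter-like element. -/
  c : W
  isOfFinOrder_c : IsOfFinOrder c
  L_one : L 1 = 0
  eq_one_of_L : ∀ w, L w = 0 → w = 1
  L_mul_le : ∀ u v, L (u * v) ≤ L u + L v
  L_conj : ∀ u v, L (u * v * u⁻¹) = L v
  exists_meet : ∀ u v, L u + L (u⁻¹ * c) = L c → L v + L (v⁻¹ * c) = L c →
    ∃ w, L w + L (w⁻¹ * u) = L u ∧ L w + L (w⁻¹ * v) = L v ∧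
      ∀ t, L t + L (t⁻¹ * u) = L u → L t + L (t⁻¹ * v) = L v → L t + L (t⁻¹ * w) = L w

namespace DualGarside

variable {W : Type*} [Group W] (D : DualGarside W)

/-- The prefix order. -/
def Pre (u v : W) : Prop := D.L u + D.L (u⁻¹ * v) = D.L v

variable {D}

lemma L_conj' (u v : W) : D.L (u⁻¹ * v * u) = D.L v := by
  simpa using D.L_conj u⁻¹ v

lemma pre_refl (u : W) : D.Pre u u := by simp [Pre, D.L_one]

lemma one_pre (u : W) : D.Pre 1 u := by simp [Pre, D.L_one]

lemma Pre.trans {u v w : W} (h₁ : D.Pre u v) (h₂ : D.Pre v w) : D.Pre u w := by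
  unfold Pre at *
  have a := D.L_mul_le u (u⁻¹ * w)
  have b := D.L_mul_le (u⁻¹ * v) (v⁻¹ * w)
  simp only [mul_assoc, mul_inv_cancel_left] at a b
  omega

lemma Pre.antisymm {u v : W} (h₁ : D.Pre u v) (h₂ : D.Pre v u) : u = v := by
  unfold Pre at *
  have := D.eq_one_of_L (u⁻¹ * v) (by omega)
  exact (inv_mul_eq_one.1 this)

lemma Pre.inv_mul {a x y : W} (h₁ : D.Pre a x) (h₂ : D.Pre x y) :
    D.Pre (a⁻¹ * x) (a⁻¹ * y) := by
  have h₃ := h₁.trans h₂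
  unfold Pre at *
  simp only [mul_inv_rev, inv_inv, mul_assoc, mul_inv_cancel_left]
  omega

lemma Pre.mul_left {a b y : W} (h₁ : D.Pre a y) (h₂ : D.Pre b (a⁻¹ * y)) :
    D.Pre a (a * b) ∧ D.Pre (a * b) y := by
  unfold Pre at *
  have e1 := D.L_mul_le a b
  have e2 := D.L_mul_le (a * b) ((a * b)⁻¹ * y)
  simp only [mul_inv_rev, mul_assoc, mul_inv_cancel_left, inv_mul_cancel_left] at *
  omega

lemma eq_one_of_pre_one {u : W} (h : D.Pre u 1) : u = 1 := h.antisymm (one_pre u)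

variable (D) in
/-- The simple elements. -/
abbrev Simple : Type _ := {w : W // D.Pre w D.c}

namespace Simple

/-- The identity as a simple element. -/
def one : D.Simple := ⟨1, one_pre _⟩

/-- The Coxeter-like element as a simple element. -/
def cox : D.Simple := ⟨D.c, pre_refl _⟩

/-- The right complement `s⁻¹ c`. -/
def compl (s : D.Simple) : D.Simple := ⟨s.1⁻¹ * D.c, by
  have := s.2
  unfold Pre at *
  have e := L_conj' (D := D) D.c s.1
  simp only [mul_inv_rev, inv_inv, mul_assoc] at *
  omega⟩

/-- The quotient `a⁻¹ x` of simple elements. -/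
def ldiv (a x : D.Simple) (h : D.Pre a.1 x.1) : D.Simple := ⟨a.1⁻¹ * x.1, by
  have h1 := x.2
  have h0 := a.2
  unfold Pre at *
  have e1 := D.L_mul_le (a.1⁻¹ * x.1) (x.1⁻¹ * D.c * a.1)
  have e2 := L_conj' (D := D) a.1 (a.1 * x.1⁻¹ * D.c)
  have e3 := L_conj' (D := D) (a.1⁻¹) (x.1⁻¹ * D.c * a.1)
  have e4 := L_conj' (D := D) (a.1) (D.c)
  have e5 := D.L_mul_le (a.1⁻¹ * x.1) ((a.1⁻¹ * x.1)⁻¹ * D.c)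
  have e6 := D.L_mul_le (x.1⁻¹ * D.c) (D.c⁻¹ * a.1 * D.c)
  have e7 := L_conj' (D := D) D.c a.1
  simp only [mul_inv_rev, inv_inv, mul_assoc, mul_inv_cancel_left, mul_inv_cancel, inv_mul_cancel_left] at *
  omega⟩

end Simple

end DualGarside

namespace DualGarside

variable {W : Type*} [Group W] {D : DualGarside W}

namespace Simple

lemma exists_meet (u v : D.Simple) : ∃ w : D.Simple, D.Pre w.1 u.1 ∧ D.Pre w.1 v.1 ∧
    ∀ t, D.Pre t u.1 → D.Pre t v.1 → D.Pre t w.1 := by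
  obtain ⟨w, h1, h2, h3⟩ := D.exists_meet u.1 v.1 u.2 v.2
  exact ⟨⟨w, Pre.trans h1 u.2⟩, h1, h2, h3⟩

/-- The meet of two simple elements. -/
noncomputable def meet (u v : D.Simple) : D.Simple := (exists_meet u v).choose

lemma meet_left (u v : D.Simple) : D.Pre (meet u v).1 u.1 := (exists_meet u v).choose_spec.1

lemma meet_right (u v : D.Simple) : D.Pre (meet u v).1 v.1 := (exists_meet u v).choose_spec.2.1

lemma pre_meet {u v : D.Simple} {t : W} (h₁ : D.Pre t u.1) (h₂ : D.Pre t v.1) :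
    D.Pre t (meet u v).1 := (exists_meet u v).choose_spec.2.2 t h₁ h₂

/-- The product of a simple element with a prefix of its complement. -/
def mulOf (s u : D.Simple) (h : D.Pre u.1 s.compl.1) : D.Simple :=
  ⟨s.1 * u.1, (Pre.mul_left s.2 h).2⟩

end Simple

/-- The relations of the dual monoid. -/
inductive Rel : FreeMonoid D.Simple → FreeMonoid D.Simple → Prop
  | one : Rel (FreeMonoid.of Simple.one) 1
  | mul (s t r : D.Simple) (h : D.Pre s.1 r.1) (e : s.1 * t.1 = r.1) :
      Rel (FreeMonoid.of s * FreeMonoid.of t) (FreeMonoid.of r)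

variable (D) in
/-- The monoid presented by the simple elements. -/
abbrev Mon : Type _ := PresentedMonoid (Rel (D := D))

/-- The generator of the dual monoid given by a simple element. -/
def gen (s : D.Simple) : D.Mon := PresentedMonoid.of _ s

lemma gen_one : gen (Simple.one : D.Simple) = 1 :=
  PresentedMonoid.mk_eq_mk_of_rel Rel.one

lemma gen_eq_one {s : D.Simple} (h : s.1 = 1) : gen s = 1 := by
  rw [← gen_one]; congr 1; exact Subtype.ext h

lemma gen_mul_gen {s t r : D.Simple} (h : D.Pre s.1 r.1) (e : s.1 * t.1 = r.1) :
    gen s * gen t = gen r :=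
  PresentedMonoid.mk_eq_mk_of_rel (Rel.mul s t r h e)

lemma gen_mul_ldiv {s r : D.Simple} (h : D.Pre s.1 r.1) : gen s * gen (s.ldiv r h) = gen r :=
  gen_mul_gen h (by simp [Simple.ldiv])

/-- A function on simple elements respecting the relations extends to the dual monoid. -/
def monLift {B : Type*} [Monoid B] (f : D.Simple → B) (h1 : f Simple.one = 1)
    (hm : ∀ s t r : D.Simple, D.Pre s.1 r.1 → s.1 * t.1 = r.1 → f s * f t = f r) : D.Mon →* B :=
  PresentedMonoid.lift f (by
    intro a b h
    cases h with
    | one => simpa using h1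
    | mul s t r h e => simpa using hm s t r h e)

@[elab_as_elim]
lemma mon_induction {p : D.Mon → Prop} (m : D.Mon) (h1 : p 1)
    (h : ∀ s m, p m → p (gen s * m)) : p m := by
  have : m ∈ Submonoid.closure (Set.range (PresentedMonoid.of (Rel (D := D)))) := by
    rw [PresentedMonoid.closure_range_of]; trivial
  induction this using Submonoid.closure_induction_left with
  | one => exact h1
  | mul_left x hx y hy ih => obtain ⟨s, rfl⟩ := hx; exact h s y ih

open Simple in
/-- The action of a simple element on pairs (head, tail). -/
noncomputable def step (s : D.Simple) (x : D.Simple × D.Mon) : D.Simple × D.Mon :=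
  (s.mulOf (meet s.compl x.1) (meet_left _ _),
    gen ((meet s.compl x.1).ldiv x.1 (meet_right _ _)) * x.2)

lemma step_one (x : D.Simple × D.Mon) : step Simple.one x = x := by
  obtain ⟨h, m⟩ := x
  have e : (Simple.meet (Simple.compl Simple.one) h) = h := by
    apply Subtype.ext
    refine Pre.antisymm (Simple.meet_right _ _) (Simple.pre_meet ?_ (pre_refl _))
    simpa [Simple.compl, Simple.one] using h.2
  ext1
  · apply Subtype.ext
    simp only [step, Simple.mulOf, e]
    simp [Simple.one]
  · simp only [step]
    rw [gen_eq_one, one_mul]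
    simp [Simple.ldiv, e]

open Simple in
lemma step_mul (s t r : D.Simple) (hs : D.Pre s.1 r.1) (e : s.1 * t.1 = r.1)
    (x : D.Simple × D.Mon) : step s (step t x) = step r x := by
  obtain ⟨h, m⟩ := x
  set w := meet r.compl h with hw
  set u := meet t.compl h with hu
  have hts : D.Pre t.1 s.compl.1 := by
    have := hs.inv_mul r.2
    rwa [← e, inv_mul_cancel_left] at this
  have er : t.1⁻¹ * s.compl.1 = r.compl.1 := by
    simp [Simple.compl, ← e, mul_assoc]
  have hrt : D.Pre r.compl.1 t.compl.1 := by
    rw [← er]; exact hts.inv_mul s.compl.2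
  have hwu : D.Pre w.1 u.1 :=
    pre_meet ((meet_left _ _).trans hrt) (meet_right _ _)
  set tu := t.mulOf u (meet_left _ _) with htu
  have htu' : D.Pre t.1 tu.1 := (Pre.mul_left t.2 (meet_left t.compl h)).1
  set v := meet s.compl tu with hv
  have hvw : v.1 = t.1 * w.1 := by
    apply Pre.antisymm
    · have htv : D.Pre t.1 v.1 := pre_meet hts htu'
      have h1 : D.Pre (t.1⁻¹ * v.1) r.compl.1 := by
        rw [← er]; exact htv.inv_mul (meet_left _ _)
      have h2 : D.Pre (t.1⁻¹ * v.1) u.1 := by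
        have := htv.inv_mul (meet_right s.compl tu)
        simpa [htu, mulOf] using this
      have h3 : D.Pre (t.1⁻¹ * v.1) w.1 := pre_meet h1 (h2.trans (meet_right _ _))
      have h4 : D.Pre (t.1⁻¹ * v.1) (t.1⁻¹ * (t.1 * w.1)) := by simpa using h3
      have h5 : D.Pre t.1 (t.1 * w.1) := (Pre.mul_left hts (by rw [er]; exact meet_left _ _)).1
      have := (Pre.mul_left h5 h4).2
      simpa using this
    · apply pre_meet
      · exact (Pre.mul_left hts (by rw [er]; exact meet_left _ _)).2
      · refine (Pre.mul_left htu' ?_).2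
        simpa [htu, mulOf] using hwu
  have key : step s (step t (h, m)) = (s.mulOf v (meet_left _ _),
      gen (v.ldiv tu (meet_right _ _)) * (gen (u.ldiv h (meet_right _ _)) * m)) := rfl
  have key2 : step r (h, m) = (r.mulOf w (meet_left _ _), gen (w.ldiv h (meet_right _ _)) * m) := rfl
  rw [key, key2]
  ext1
  · apply Subtype.ext
    simp [mulOf, hvw, ← e, mul_assoc]
  · simp only
    rw [← mul_assoc]
    congr 1
    apply gen_mul_gen
    · have : (v.ldiv tu (meet_right _ _)).1 = w.1⁻¹ * u.1 := by
        simp [ldiv, hvw, htu, mulOf, mul_assoc]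
      rw [this]
      exact hwu.inv_mul (meet_right _ _)
    · simp [ldiv, hvw, htu, mulOf, mul_assoc]

/-- The action of the dual monoid on pairs (head, tail). -/
noncomputable def act : D.Mon →* Function.End (D.Simple × D.Mon) :=
  monLift step (funext step_one) (fun s t r h e => funext (step_mul s t r h e))

lemma act_gen_mul (s : D.Simple) (m : D.Mon) (x) : act (gen s * m) x = step s (act m x) := by
  rw [map_mul]; rfl

/-- The maximal simple left divisor. -/
noncomputable def head (m : D.Mon) : D.Simple := (act m (Simple.one, 1)).1

/-- The cofactor of the head. -/
noncomputable def tail (m : D.Mon) : D.Mon := (act m (Simple.one, 1)).2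

lemma gen_head_mul_tail (m : D.Mon) : gen (head m) * tail m = m := by
  induction m using mon_induction with
  | h1 =>
    unfold head tail
    rw [map_one]
    exact (mul_one _).trans gen_one
  | h s m ih =>
    unfold head tail at *
    rw [act_gen_mul]
    set x := act m (Simple.one, 1)
    simp only [step]
    rw [← mul_assoc, ← gen_mul_gen (s := s) (t := Simple.meet s.compl x.1), mul_assoc (gen s),
      gen_mul_ldiv, mul_assoc, ih]
    · exact (Pre.mul_left s.2 (Simple.meet_left _ _)).1
    · rfl

lemma pre_head_gen_mul (s : D.Simple) (m : D.Mon) : D.Pre s.1 (head (gen s * m)).1 := by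
  unfold head
  rw [act_gen_mul]
  exact (Pre.mul_left s.2 (Simple.meet_left _ _)).1

lemma gen_ldiv_head_mul_tail (s : D.Simple) (m : D.Mon) :
    gen (s.ldiv _ (pre_head_gen_mul s m)) * tail (gen s * m) = m := by
  conv_rhs => rw [← gen_head_mul_tail m]
  have h1 : (s.ldiv _ (pre_head_gen_mul s m)).1 = (Simple.meet s.compl (head m)).1 := by
    simp only [Simple.ldiv, head, act_gen_mul]
    simp [step, Simple.mulOf]
  have h2 : tail (gen s * m) =
      gen ((Simple.meet s.compl (head m)).ldiv (head m) (Simple.meet_right _ _)) * tail m := by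
    simp only [tail, head, act_gen_mul]; rfl
  rw [h2, ← mul_assoc, Subtype.ext h1, gen_mul_ldiv]

lemma gen_mul_left_cancel (s : D.Simple) {m m' : D.Mon} (h : gen s * m = gen s * m') : m = m' := by
  rw [← gen_ldiv_head_mul_tail s m, ← gen_ldiv_head_mul_tail s m']
  simp only [h]

lemma mon_left_cancel {a m m' : D.Mon} (h : a * m = a * m') : m = m' := by
  induction a using mon_induction with
  | h1 => simpa using h
  | h s a ih => exact ih (gen_mul_left_cancel s (by simpa [mul_assoc] using h))

lemma pre_head_iff {s : D.Simple} {m : D.Mon} : D.Pre s.1 (head m).1 ↔ gen s ∣ m := by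
  constructor
  · intro h
    rw [← gen_head_mul_tail m, ← gen_mul_ldiv h, mul_assoc]
    exact dvd_mul_right _ _
  · rintro ⟨m', rfl⟩
    exact pre_head_gen_mul s m'

/-- The length homomorphism. -/
def lenHom : D.Mon →* Multiplicative ℕ :=
  monLift (fun s => Multiplicative.ofAdd (D.L s.1)) (by simp [Simple.one, D.L_one]) (by
    intro s t r h e
    rw [← ofAdd_add]
    congr 1
    unfold Pre at h
    rw [← e, inv_mul_cancel_left] at h
    rw [h, e])

/-- The length function of the dual monoid. -/
def len (m : D.Mon) : ℕ := Multiplicative.toAdd (lenHom m)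

@[simp] lemma len_mul (a b : D.Mon) : len (a * b) = len a + len b := by simp [len]
@[simp] lemma len_one : len (1 : D.Mon) = 0 := by simp [len]
@[simp] lemma len_gen (s : D.Simple) : len (gen s) = D.L s.1 := rfl

lemma eq_one_of_len {m : D.Mon} (h : len m = 0) : m = 1 := by
  induction m using mon_induction with
  | h1 => rfl
  | h s m ih =>
    simp only [len_mul, len_gen, Nat.add_eq_zero_iff] at h
    rw [ih h.2, gen_eq_one (D.eq_one_of_L _ h.1), one_mul]

lemma eq_one_of_head {m : D.Mon} (h : (head m).1 = 1) : m = 1 := by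
  induction m using mon_induction with
  | h1 => rfl
  | h s m ih =>
    have h1 := pre_head_gen_mul s m
    rw [h] at h1
    rw [gen_eq_one (eq_one_of_pre_one h1), one_mul] at h ⊢
    exact ih h

lemma exists_gcd (m m' : D.Mon) : ∃ g, g ∣ m ∧ g ∣ m' ∧ ∀ u, u ∣ m → u ∣ m' → u ∣ g := by
  induction hk : len m using Nat.strong_induction_on generalizing m m' with
  | _ k ih =>
  subst hk
  set h := Simple.meet (head m) (head m') with hh
  by_cases h1 : h.1 = 1
  · refine ⟨1, one_dvd _, one_dvd _, fun u hu hu' => ?_⟩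
    have hd : gen (head u) ∣ u := pre_head_iff.1 (pre_refl _)
    have := Simple.pre_meet (pre_head_iff.2 (hd.trans hu)) (pre_head_iff.2 (hd.trans hu'))
    rw [← hh, h1] at this
    rw [eq_one_of_head (eq_one_of_pre_one this)]
  · obtain ⟨m1, e1⟩ : gen h ∣ m := pre_head_iff.1 (Simple.meet_left _ _)
    obtain ⟨m2, e2⟩ : gen h ∣ m' := pre_head_iff.1 (Simple.meet_right _ _)
    have hL : 0 < D.L h.1 := Nat.pos_of_ne_zero (fun hz => h1 (D.eq_one_of_L _ hz))
    obtain ⟨g, hg1, hg2, hg⟩ := ih (len m1) (by rw [e1]; simp; omega) m1 m2 rfl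
    refine ⟨gen h * g, by rw [e1]; exact mul_dvd_mul_left _ hg1,
      by rw [e2]; exact mul_dvd_mul_left _ hg2, fun u hu hu' => ?_⟩
    by_cases hu1 : (head u).1 = 1
    · rw [eq_one_of_head hu1]; exact one_dvd _
    have hd : gen (head u) ∣ u := pre_head_iff.1 (pre_refl _)
    have hp : D.Pre (head u).1 h.1 :=
      Simple.pre_meet (pre_head_iff.2 (hd.trans hu)) (pre_head_iff.2 (hd.trans hu'))
    set s := head u with hs
    set h2 := s.ldiv h hp with hh2
    have e3 : gen s * gen h2 = gen h := gen_mul_ldiv hp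
    have hLs : 0 < D.L s.1 := Nat.pos_of_ne_zero (fun hz => hu1 (D.eq_one_of_L _ hz))
    have hlen : D.L s.1 + D.L h2.1 = D.L h.1 := hp
    have cancel : ∀ {y}, u ∣ gen h * y → tail u ∣ gen h2 * y := by
      rintro y ⟨z, hz⟩
      refine ⟨z, gen_mul_left_cancel s ?_⟩
      rw [← mul_assoc, e3, hz, ← mul_assoc, gen_head_mul_tail]
    obtain ⟨g3, a1, a2, a3⟩ := ih (len (gen h2 * m1)) (by rw [e1]; simp; omega)
      (gen h2 * m1) (gen h2 * m2) rfl
    obtain ⟨g4, rfl⟩ := a3 (gen h2) (dvd_mul_right _ _) (dvd_mul_right _ _)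
    have canc2 : ∀ {y}, gen h2 * g4 ∣ gen h2 * y → g4 ∣ y := by
      rintro y ⟨z, hz⟩
      exact ⟨z, gen_mul_left_cancel h2 (by rw [hz, mul_assoc])⟩
    have hg4 := hg g4 (canc2 a1) (canc2 a2)
    have := a3 (tail u) (cancel (by rwa [e1] at hu)) (cancel (by rwa [e2] at hu'))
    rw [← gen_head_mul_tail u, ← e3, mul_assoc]
    exact mul_dvd_mul_left _ (this.trans (mul_dvd_mul_left _ hg4))

end DualGarside

/-- A finite-order argument: in a group with a lattice order whose positive cone is normalized by
`D`, a `k`-th root of a power of `D` is conjugate to a power of `D`. -/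
theorem exists_conj_of_pow_eq {G : Type*} [Group G] (P : Submonoid G)
    (hP : ∀ g ∈ P, g⁻¹ ∈ P → g = 1)
    (hglb : ∀ g : G, ∃ w : G, w⁻¹ ∈ P ∧ w⁻¹ * g ∈ P ∧ ∀ t, t⁻¹ ∈ P → t⁻¹ * g ∈ P → t⁻¹ * w ∈ P)
    (D : G) (hD : ∀ p ∈ P, D * p * D⁻¹ ∈ P) (hD' : ∀ p ∈ P, D⁻¹ * p * D ∈ P)
    (x : G) (m : ℤ) (k : ℕ) (hk : 0 < k) (hx : x ^ k = (D ^ m) ^ k) : ∃ g, x * g = g * D ^ m := by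
  have hDn : ∀ j : ℕ, ∀ p ∈ P, D ^ j * p * (D ^ j)⁻¹ ∈ P := by
    intro j
    induction j with
    | zero => simp
    | succ j ih =>
      intro p hp
      have := hD _ (ih p hp)
      rw [pow_succ']
      simpa [mul_assoc] using this
  have hDn' : ∀ j : ℕ, ∀ p ∈ P, (D ^ j)⁻¹ * p * D ^ j ∈ P := by
    intro j
    induction j with
    | zero => simp
    | succ j ih =>
      intro p hp
      have := hD' _ (ih p hp)
      rw [pow_succ]
      simpa [mul_assoc] using this
  have hDz : ∀ j : ℤ, ∀ p ∈ P, D ^ j * p * (D ^ j)⁻¹ ∈ P := by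
    intro j p hp
    obtain ⟨i, rfl | rfl⟩ := j.eq_nat_or_neg
    · simpa using hDn i p hp
    · simpa using hDn' i p hp
  generalize hE : D ^ m = E at *
  have hE1 : ∀ p ∈ P, E * p * E⁻¹ ∈ P := by rw [← hE]; exact hDz m
  have hE2 : ∀ p ∈ P, E⁻¹ * p * E ∈ P := by
    rw [← hE, ← zpow_neg]
    intro p hp
    simpa using hDz (-m) p hp
  have glb2 : ∀ a b : G, ∃ w, w⁻¹ * a ∈ P ∧ w⁻¹ * b ∈ P ∧
      ∀ t, t⁻¹ * a ∈ P → t⁻¹ * b ∈ P → t⁻¹ * w ∈ P := by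
    intro a b
    obtain ⟨w, h1, h2, h3⟩ := hglb (a⁻¹ * b)
    refine ⟨a * w, by simpa, by simpa [mul_assoc] using h2, fun t ha hb => ?_⟩
    have := h3 (a⁻¹ * t) (by simpa using ha) (by simpa [mul_assoc] using hb)
    simpa [mul_assoc] using this
  have glbn : ∀ (f : ℕ → G) (n : ℕ), ∃ w, (∀ i ≤ n, w⁻¹ * f i ∈ P) ∧
      ∀ t, (∀ i ≤ n, t⁻¹ * f i ∈ P) → t⁻¹ * w ∈ P := by
    intro f n
    induction n with
    | zero => exact ⟨f 0, by simp [P.one_mem], fun t ht => ht 0 le_rfl⟩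
    | succ n ih =>
      obtain ⟨w, h1, h2⟩ := ih
      obtain ⟨v, a1, a2, a3⟩ := glb2 w (f (n + 1))
      refine ⟨v, fun i hi => ?_, fun t ht => a3 t (h2 t fun i hi => ht i (by omega)) (ht _ le_rfl)⟩
      rcases Nat.lt_or_ge n i with h | h
      · obtain rfl : i = n + 1 := by omega
        exact a2
      · have := P.mul_mem a1 (h1 i h)
        simpa [mul_assoc] using this
  let f : ℕ → G := fun i => x ^ i * (E ^ i)⁻¹
  have fper : ∀ i, f (i + k) = f i := by
    intro i
    simp [f, pow_add, hx, mul_assoc]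
  have fsucc : ∀ i, f (i + 1) = x * f i * E⁻¹ := by
    intro i
    simp only [f]
    rw [pow_succ', pow_succ']
    simp [mul_assoc]
  obtain ⟨g, hg1, hg2⟩ := glbn f (k - 1)
  have hall : ∀ i, g⁻¹ * f i ∈ P := by
    intro i
    induction i using Nat.strong_induction_on with
    | _ i ih =>
      rcases Nat.lt_or_ge i k with h | h
      · exact hg1 i (by omega)
      · have := ih (i - k) (by omega)
        rwa [← fper, Nat.sub_add_cancel h] at this
  have tr : ∀ a b, a⁻¹ * b ∈ P → (x * a * E⁻¹)⁻¹ * (x * b * E⁻¹) ∈ P := by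
    intro a b h
    have := hE1 _ h
    simpa [mul_assoc] using this
  have tr' : ∀ a b, (x * a * E⁻¹)⁻¹ * (x * b * E⁻¹) ∈ P → a⁻¹ * b ∈ P := by
    intro a b h
    have := hE2 _ h
    simpa [mul_assoc] using this
  have h1 : (x * g * E⁻¹)⁻¹ * g ∈ P := by
    apply hg2
    intro i _
    have h := tr _ _ (hall (i + k - 1))
    rw [← fsucc, show i + k - 1 + 1 = i + k by omega, fper] at h
    exact h
  have h2 : g⁻¹ * (x * g * E⁻¹) ∈ P := by
    have : (x⁻¹ * g * E)⁻¹ * g ∈ P := by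
      apply hg2
      intro i _
      apply tr'
      rw [← fsucc]
      simpa [mul_assoc] using hall (i + 1)
    have := tr _ _ this
    simpa [mul_assoc] using this
  have := hP _ h2 (by simpa [mul_assoc] using h1)
  refine ⟨g, ?_⟩
  rw [inv_mul_eq_one] at this
  rw [eq_mul_inv_iff_mul_eq] at this
  exact this.symm

namespace DualGarside

variable {W : Type*} [Group W] {D : DualGarside W}

namespace Simple

/-- Conjugation by the Coxeter-like element. -/
def conjCox (s : D.Simple) : D.Simple := ⟨D.c⁻¹ * s.1 * D.c, by
  have := s.2
  unfold Pre at *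
  have h1 := L_conj' (D := D) D.c s.1
  have h2 := L_conj' (D := D) D.c (s.1⁻¹ * D.c)
  simp only [mul_inv_rev, inv_inv, mul_assoc] at *
  omega⟩

/-- Inverse conjugation by the Coxeter-like element. -/
def conjCoxInv (s : D.Simple) : D.Simple := ⟨D.c * s.1 * D.c⁻¹, by
  have := s.2
  unfold Pre at *
  have h1 := D.L_conj D.c s.1
  have h2 := D.L_conj D.c (s.1⁻¹ * D.c)
  simp only [mul_inv_rev, inv_inv, mul_assoc, inv_mul_cancel, mul_inv_cancel, mul_one] at *
  omega⟩

end Simple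

variable (D) in
/-- The Garside element. -/
def dl : D.Mon := gen Simple.cox

lemma gen_mul_compl (s : D.Simple) : gen s * gen s.compl = dl D :=
  gen_mul_gen s.2 (by simp [Simple.compl, Simple.cox])

lemma compl_mul_gen (s : D.Simple) : gen s.compl * gen s.conjCox = dl D :=
  gen_mul_gen s.compl.2 (by simp [Simple.compl, Simple.cox, Simple.conjCox, mul_assoc])

lemma gen_mul_dl (s : D.Simple) : gen s * dl D = dl D * gen s.conjCox := by
  rw [← compl_mul_gen s, ← mul_assoc, gen_mul_compl, compl_mul_gen]

lemma dl_mul_gen (s : D.Simple) : dl D * gen s = gen s.conjCoxInv * dl D := by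
  rw [gen_mul_dl]; congr 2; apply Subtype.ext
  simp [Simple.conjCox, Simple.conjCoxInv, mul_assoc]

lemma exists_mul_dl (m : D.Mon) : ∃ m', m * dl D = dl D * m' := by
  induction m using mon_induction with
  | h1 => exact ⟨1, by simp⟩
  | h s m ih =>
    obtain ⟨m', h⟩ := ih
    exact ⟨gen s.conjCox * m', by rw [mul_assoc, h, ← mul_assoc, gen_mul_dl, mul_assoc]⟩

lemma exists_dl_mul (m : D.Mon) : ∃ m', dl D * m = m' * dl D := by
  induction m using mon_induction with
  | h1 => exact ⟨1, by simp⟩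
  | h s m ih =>
    obtain ⟨m', h⟩ := ih
    exact ⟨gen s.conjCoxInv * m', by rw [← mul_assoc, dl_mul_gen, mul_assoc, h, mul_assoc]⟩

lemma gen_mul_dl_pow (s : D.Simple) (j : ℕ) :
    ∃ t : D.Simple, t.1 = (D.c ^ j)⁻¹ * s.1 * D.c ^ j ∧ gen s * dl D ^ j = dl D ^ j * gen t := by
  induction j with
  | zero => exact ⟨s, by simp⟩
  | succ j ih =>
    obtain ⟨t, h1, h2⟩ := ih
    refine ⟨t.conjCox, by simp [Simple.conjCox, h1, pow_succ, mul_assoc], ?_⟩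
    rw [pow_succ, ← mul_assoc, h2, mul_assoc, gen_mul_dl, mul_assoc]

variable (D) in
/-- The central power of the Garside element. -/
noncomputable def zt : D.Mon := dl D ^ orderOf D.c

lemma mul_zt (m : D.Mon) : m * zt D = zt D * m := by
  induction m using mon_induction with
  | h1 => simp
  | h s m ih =>
    obtain ⟨t, h1, h2⟩ := gen_mul_dl_pow s (orderOf D.c)
    have : t = s := Subtype.ext (by simpa [pow_orderOf_eq_one] using h1)
    rw [this] at h2
    rw [mul_assoc, ih, ← mul_assoc, zt, h2, mul_assoc]

lemma mul_zt_pow (m : D.Mon) (k : ℕ) : m * zt D ^ k = zt D ^ k * m :=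
  ((show Commute m (zt D) from mul_zt m).pow_right k)

noncomputable instance : OreLocalization.OreSet (Submonoid.powers (zt D)) where
  ore_right_cancel r₁ r₂ s h := by
    obtain ⟨s, k, rfl⟩ := s
    refine ⟨1, ?_⟩
    simp only [mul_zt_pow] at h
    rw [mon_left_cancel h]
  oreNum r _ := r
  oreDenom _ s := s
  ore_eq r s := by
    obtain ⟨s, k, rfl⟩ := s
    exact (mul_zt_pow r k).symm

variable (D) in
/-- The localization of the dual monoid at the central element. -/
abbrev Gam : Type _ := OreLocalization (Submonoid.powers (zt D)) D.Mon

variable (D) in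
/-- The canonical map to the localization. -/
noncomputable def numHom : D.Mon →* D.Gam := OreLocalization.numeratorHom

lemma isUnit_zt : IsUnit (numHom D (zt D)) :=
  OreLocalization.numerator_isUnit (⟨zt D, 1, by simp⟩ : Submonoid.powers (zt D))

lemma isUnit_of_left_right {M : Type*} [Monoid M] {a b c : M} (h1 : IsUnit (a * b))
    (h2 : IsUnit (c * a)) : IsUnit a := by
  obtain ⟨u, hu⟩ := h1
  obtain ⟨v, hv⟩ := h2
  have e1 : a * (b * ↑u⁻¹) = 1 := by rw [← mul_assoc, ← hu]; simp
  have e2 : (↑v⁻¹ * c) * a = 1 := by rw [mul_assoc, ← hv]; simp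
  refine ⟨⟨a, b * ↑u⁻¹, e1, ?_⟩, rfl⟩
  rw [← left_inv_eq_right_inv e2 e1]; exact e2

lemma isUnit_dl : IsUnit (numHom D (dl D)) := by
  have h := isUnit_zt (D := D)
  have e : numHom D (zt D) = numHom D (dl D) ^ orderOf D.c := map_pow (numHom D) (dl D) _
  rw [e] at h
  exact (isUnit_pow_iff D.isOfFinOrder_c.orderOf_pos.ne').1 h

lemma isUnit_numHom (m : D.Mon) : IsUnit (numHom D m) := by
  induction m using mon_induction with
  | h1 => simp
  | h s m ih =>
    rw [map_mul]
    refine IsUnit.mul (isUnit_of_left_right (b := numHom D (gen s.compl))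
      (c := numHom D (gen (s.conjCoxInv).compl)) ?_ ?_) ih
    · rw [← map_mul, gen_mul_compl]; exact isUnit_dl
    · have e : s.conjCoxInv.conjCox = s := Subtype.ext (by
        simp [Simple.conjCox, Simple.conjCoxInv, mul_assoc])
      have h := compl_mul_gen s.conjCoxInv
      rw [e] at h
      rw [← map_mul, h]; exact isUnit_dl

variable (D) in
/-- The canonical map to the group of fractions. -/
noncomputable def iota : D.Mon →* (D.Gam)ˣ := IsUnit.liftRight (numHom D) isUnit_numHom

lemma coe_iota (m : D.Mon) : ((iota D m : (D.Gam)ˣ) : D.Gam) = numHom D m := rfl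

lemma iota_injective : Function.Injective (iota D) := by
  intro a b h
  have h : numHom D a = numHom D b := congrArg Units.val h
  have h : (OreLocalization.oreDiv a (1 : Submonoid.powers (zt D))) = OreLocalization.oreDiv b 1 := h
  rw [OreLocalization.oreDiv_eq_iff] at h
  obtain ⟨u, v, h1, h2⟩ := h
  simp only [OneMemClass.coe_one, mul_one] at h2
  rw [← h2] at h1
  exact (mon_left_cancel h1).symm

lemma exists_iota_mul (g : (D.Gam)ˣ) : ∃ k m, iota D (zt D ^ k) * g = iota D m := by
  obtain ⟨g, g', h1, h2⟩ := g
  induction g using OreLocalization.ind with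
  | _ r s =>
    obtain ⟨s, k, hk⟩ := s
    refine ⟨k, r, ?_⟩
    ext
    rw [Units.val_mul, coe_iota, coe_iota]
    simp only at hk
    subst hk
    exact OreLocalization.mul_cancel (S := Submonoid.powers (zt D)) (r := r) (s := ⟨zt D ^ k, k, rfl⟩)

lemma iota_zt_comm (k : ℕ) (g : (D.Gam)ˣ) : iota D (zt D ^ k) * g = g * iota D (zt D ^ k) := by
  obtain ⟨j, m, h⟩ := exists_iota_mul g
  have hg : g = (iota D (zt D ^ j))⁻¹ * iota D m := by rw [← h]; simp
  have c1 : Commute (iota D (zt D ^ k)) (iota D (zt D ^ j)) := by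
    rw [map_pow, map_pow]; exact (Commute.refl _).pow_pow _ _
  have c2 : Commute (iota D (zt D ^ k)) (iota D m) := by
    show _ * _ = _ * _
    rw [← map_mul, ← map_mul, mul_zt_pow]
  rw [hg]
  exact c1.inv_right.mul_right c2

lemma iota_dvd {a b : D.Mon} : (iota D a)⁻¹ * iota D b ∈ MonoidHom.mrange (iota D) ↔ a ∣ b := by
  constructor
  · rintro ⟨p, hp⟩
    refine ⟨p, iota_injective ?_⟩
    rw [map_mul, hp]; simp
  · rintro ⟨p, rfl⟩
    exact ⟨p, by simp⟩

lemma exists_glb (g : (D.Gam)ˣ) : ∃ w : (D.Gam)ˣ, w⁻¹ ∈ MonoidHom.mrange (iota D) ∧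
    w⁻¹ * g ∈ MonoidHom.mrange (iota D) ∧
    ∀ t : (D.Gam)ˣ, t⁻¹ ∈ MonoidHom.mrange (iota D) → t⁻¹ * g ∈ MonoidHom.mrange (iota D) →
      t⁻¹ * w ∈ MonoidHom.mrange (iota D) := by
  obtain ⟨k, m, h⟩ := exists_iota_mul g
  obtain ⟨d, d1, d2, d3⟩ := exists_gcd (zt D ^ k) m
  have hg : g = (iota D (zt D ^ k))⁻¹ * iota D m := by rw [← h]; simp
  refine ⟨(iota D (zt D ^ k))⁻¹ * iota D d, ?_, ?_, fun t h1 h2 => ?_⟩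
  · simpa using iota_dvd.2 d1
  · rw [hg]; simpa using iota_dvd.2 d2
  · obtain ⟨j, a, ha⟩ := exists_iota_mul t
    have ht : t⁻¹ = (iota D a)⁻¹ * iota D (zt D ^ j) := by rw [← ha]; simp
    have hgen : ∀ b, t⁻¹ * ((iota D (zt D ^ k))⁻¹ * iota D b) =
        (iota D (zt D ^ k * a))⁻¹ * iota D (zt D ^ j * b) := by
      intro b
      rw [ht, map_mul, map_mul, mul_inv_rev]
      have := iota_zt_comm k (iota D (zt D ^ j))
      have c : Commute (iota D (zt D ^ k)) (iota D (zt D ^ j)) := this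
      have := c.inv_left.eq
      rw [mul_assoc, mul_assoc, ← mul_assoc _ _ (iota D b), ← this, mul_assoc]
    have e1 : t⁻¹ = t⁻¹ * ((iota D (zt D ^ k))⁻¹ * iota D (zt D ^ k)) := by simp
    rw [e1, hgen, iota_dvd] at h1
    rw [hg, hgen, iota_dvd] at h2
    rw [hgen, iota_dvd]
    obtain ⟨q, q1, q2, q3⟩ := exists_gcd (zt D ^ j * zt D ^ k) (zt D ^ j * m)
    obtain ⟨r, rfl⟩ := q3 (zt D ^ j) (dvd_mul_right _ _) (dvd_mul_right _ _)
    have hr : r ∣ d := by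
      apply d3
      · obtain ⟨y, hy⟩ := q1
        exact ⟨y, mon_left_cancel (by rw [hy, mul_assoc])⟩
      · obtain ⟨y, hy⟩ := q2
        exact ⟨y, mon_left_cancel (by rw [hy, mul_assoc])⟩
    exact (q3 _ h1 h2).trans (mul_dvd_mul_left _ hr)

/-- Roots of powers of the Garside element are conjugate to powers of the Garside element. -/
theorem root_conj (x : (D.Gam)ˣ) (m : ℤ) (d : ℕ) (hd : 0 < d)
    (hx : x ^ d = (iota D (dl D) ^ m) ^ d) : ∃ g, x * g = g * iota D (dl D) ^ m := by
  refine exists_conj_of_pow_eq (MonoidHom.mrange (iota D)) ?_ exists_glb (iota D (dl D)) ?_ ?_ x m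
    d hd hx
  · rintro g ⟨a, rfl⟩ ⟨b, hb⟩
    have : b * a = 1 := iota_injective (by rw [map_mul, hb]; simp)
    have : len b + len a = 0 := by rw [← len_mul, this, len_one]
    rw [eq_one_of_len (m := a) (by omega), map_one]
  · rintro p ⟨a, rfl⟩
    obtain ⟨b, hb⟩ := exists_dl_mul a
    exact ⟨b, by rw [← map_mul, hb]; simp⟩
  · rintro p ⟨a, rfl⟩
    obtain ⟨b, hb⟩ := exists_mul_dl a
    exact ⟨b, by rw [mul_assoc, ← map_mul, hb]; simp⟩

/-- A homomorphism from the dual monoid to a group extends to the group of fractions. -/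
noncomputable def gamLift {B : Type*} [Group B] (f : D.Mon →* B) : (D.Gam)ˣ →* B :=
  (OreLocalization.universalMulHom f
    ((toUnits (G := B)).toMonoidHom.comp (f.comp (Submonoid.powers (zt D)).subtype))
    (fun _ => rfl)).comp (Units.coeHom _)

lemma gamLift_iota {B : Type*} [Group B] (f : D.Mon →* B) (m : D.Mon) :
    gamLift f (iota D m) = f m :=
  OreLocalization.universalMulHom_commutes f
    ((toUnits (G := B)).toMonoidHom.comp (f.comp (Submonoid.powers (zt D)).subtype)) (fun _ => rfl)

end DualGarside

set_option linter.unusedSectionVars false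

namespace PermLength

open Equiv Equiv.Perm

variable {α : Type*} [Fintype α] [DecidableEq α]

lemma SameCycle.of_equivalence {f : Perm α} {r : α → α → Prop} (hr : Equivalence r)
    (h : ∀ x, r x (f x)) {i j : α} (hij : f.SameCycle i j) : r i j := by
  obtain ⟨k, rfl⟩ := hij.exists_nat_pow_eq
  induction k with
  | zero => exact hr.refl _
  | succ k ih => 
    rw [pow_succ']
    exact hr.trans (ih ⟨k, by simp⟩) (h _)

lemma swap_mul_pow_apply (w : Perm α) (a b : α) (k : ℕ)
    (h : ∀ i, 0 < i → i < k → (w ^ i) a ≠ a ∧ (w ^ i) a ≠ b) :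
    ∀ i, i < k → ((swap a b * w) ^ i) a = (w ^ i) a := by
  intro i hi
  induction i with
  | zero => rfl
  | succ i ih =>
    rw [pow_succ', Perm.mul_apply, ih (by omega), Perm.mul_apply, ← Perm.mul_apply w, ← pow_succ']
    exact swap_apply_of_ne_of_ne (h _ (by omega) hi).1 (h _ (by omega) hi).2

lemma exists_return (w : Perm α) (a b : α) : ∃ k, 0 < k ∧ ((w ^ k) a = a ∨ (w ^ k) a = b) ∧
    (∀ i, 0 < i → i < k → (w ^ i) a ≠ a ∧ (w ^ i) a ≠ b) := by
  have h : ∃ k, 0 < k ∧ ((w ^ k) a = a ∨ (w ^ k) a = b) :=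
    ⟨orderOf w, orderOf_pos w, Or.inl (by simp [pow_orderOf_eq_one])⟩
  refine ⟨Nat.find h, (Nat.find_spec h).1, (Nat.find_spec h).2, fun i hi hik => ?_⟩
  have := Nat.find_min h hik
  tauto

lemma pow_apply_mod {w : Perm α} {a : α} {k : ℕ} (h : (w ^ k) a = a) (j : ℕ) :
    (w ^ j) a = (w ^ (j % k)) a := by
  conv_lhs => rw [← Nat.mod_add_div j k]
  rw [pow_add, pow_mul, Perm.mul_apply]
  congr 1
  generalize j / k = m
  induction m with
  | zero => rfl
  | succ m ih => rw [pow_succ, Perm.mul_apply, h, ih]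

lemma sameCycle_swap_mul_self {w : Perm α} {a b : α} (h : ¬ w.SameCycle a b) :
    (swap a b * w).SameCycle a b := by
  obtain ⟨k, hk, h1, h2⟩ := exists_return w a b
  have h1 : (w ^ k) a = a := h1.resolve_right fun e => h ⟨k, by simpa using e⟩
  refine ⟨k, ?_⟩
  obtain ⟨k, rfl⟩ : ∃ l, k = l + 1 := ⟨k - 1, by omega⟩
  rw [zpow_natCast, pow_succ', Perm.mul_apply, swap_mul_pow_apply w a b _ h2 k (by omega),
    Perm.mul_apply, ← Perm.mul_apply w, ← pow_succ', h1, swap_apply_left]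

lemma not_sameCycle_swap_mul {w : Perm α} {a b : α} (hab : a ≠ b) (h : w.SameCycle a b) :
    ¬ (swap a b * w).SameCycle a b := by
  obtain ⟨k, hk, h1, h2⟩ := exists_return w a b
  have h3 : (w ^ k) a = b := by
    refine h1.resolve_left fun e => ?_
    obtain ⟨j, hj⟩ := h.exists_nat_pow_eq
    rw [pow_apply_mod e] at hj
    have hlt := Nat.mod_lt j hk
    rcases Nat.eq_zero_or_pos (j % k) with h0 | h0
    · rw [h0] at hj; exact hab hj
    · exact (h2 _ h0 hlt).2 hj
  have h4 := swap_mul_pow_apply w a b _ h2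
  have h5 : ((swap a b * w) ^ k) a = a := by
    obtain ⟨k, rfl⟩ : ∃ l, k = l + 1 := ⟨k - 1, by omega⟩
    rw [pow_succ', Perm.mul_apply, h4 k (by omega),
      Perm.mul_apply, ← Perm.mul_apply w, ← pow_succ', h3, swap_apply_right]
  intro h6
  obtain ⟨j, hj⟩ := h6.exists_nat_pow_eq
  have hlt := Nat.mod_lt j hk
  rw [pow_apply_mod h5, h4 _ hlt] at hj
  rcases Nat.eq_zero_or_pos (j % k) with h0 | h0
  · rw [h0] at hj; exact hab hj
  · exact (h2 _ h0 hlt).2 hj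

/-- Multiplying by a transposition of points in distinct cycles merges these cycles. -/
lemma sameCycle_swap_mul_iff {w : Perm α} {a b : α} (h : ¬ w.SameCycle a b) (i j : α) :
    (swap a b * w).SameCycle i j ↔ w.SameCycle i j ∨ (w.SameCycle i a ∧ w.SameCycle b j) ∨
      (w.SameCycle i b ∧ w.SameCycle a j) := by
  have hab := sameCycle_swap_mul_self h
  have hle : ∀ i j, w.SameCycle i j → (swap a b * w).SameCycle i j := by
    intro i j
    apply SameCycle.of_equivalence
      ⟨fun x => SameCycle.refl _ x, fun h => h.symm, fun h h' => h.trans h'⟩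
    intro x
    have h0 : (swap a b * w).SameCycle x (swap a b (w x)) := ⟨1, by simp⟩
    by_cases ha : w x = a
    · rw [ha, swap_apply_left] at h0
      rw [ha]; exact h0.trans hab.symm
    by_cases hb : w x = b
    · rw [hb, swap_apply_right] at h0
      rw [hb]; exact h0.trans hab
    rwa [swap_apply_of_ne_of_ne ha hb] at h0
  constructor
  · have hs : ∀ {x y}, w.SameCycle x y → w.SameCycle y x := fun h => h.symm
    have ht : ∀ {x y z}, w.SameCycle x y → w.SameCycle y z → w.SameCycle x z :=
      fun h h' => h.trans h'
    apply SameCycle.of_equivalence (r := fun i j => w.SameCycle i j ∨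
      (w.SameCycle i a ∧ w.SameCycle b j) ∨ (w.SameCycle i b ∧ w.SameCycle a j))
    · refine ⟨fun x => Or.inl (SameCycle.refl _ x), fun {x y} h => ?_, fun {x y z} h1 h2 => ?_⟩
      · rcases h with h | ⟨h, h'⟩ | ⟨h, h'⟩
        · exact Or.inl (hs h)
        · exact Or.inr (Or.inr ⟨hs h', hs h⟩)
        · exact Or.inr (Or.inl ⟨hs h', hs h⟩)
      · rcases h1 with h1 | ⟨h1, h1'⟩ | ⟨h1, h1'⟩ <;> rcases h2 with h2 | ⟨h2, h2'⟩ | ⟨h2, h2'⟩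
        · exact Or.inl (ht h1 h2)
        · exact Or.inr (Or.inl ⟨ht h1 h2, h2'⟩)
        · exact Or.inr (Or.inr ⟨ht h1 h2, h2'⟩)
        · exact Or.inr (Or.inl ⟨h1, ht h1' h2⟩)
        · exact absurd (hs (ht h1' h2)) h
        · exact Or.inl (ht h1 h2')
        · exact Or.inr (Or.inr ⟨h1, ht h1' h2⟩)
        · exact Or.inl (ht h1 h2')
        · exact absurd (ht h1' h2) h
    · intro x
      have h0 : w.SameCycle x (w x) := ⟨1, by simp⟩
      by_cases ha : w x = a
      · rw [Perm.mul_apply, ha, swap_apply_left]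
        exact Or.inr (Or.inl ⟨ha ▸ h0, SameCycle.refl _ _⟩)
      by_cases hb : w x = b
      · rw [Perm.mul_apply, hb, swap_apply_right]
        exact Or.inr (Or.inr ⟨hb ▸ h0, SameCycle.refl _ _⟩)
      rw [Perm.mul_apply, swap_apply_of_ne_of_ne ha hb]
      exact Or.inl h0
  · rintro (h | ⟨h1, h2⟩ | ⟨h1, h2⟩)
    · exact hle _ _ h
    · exact (hle _ _ h1).trans (hab.trans (hle _ _ h2))
    · exact (hle _ _ h1).trans (hab.symm.trans (hle _ _ h2))

lemma sameCycle_iff_of_sameCycle {w : Perm α} {a b : α} (hab : a ≠ b) (h : w.SameCycle a b)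
    (i j : α) :
    w.SameCycle i j ↔ (swap a b * w).SameCycle i j ∨
      ((swap a b * w).SameCycle i a ∧ (swap a b * w).SameCycle b j) ∨
      ((swap a b * w).SameCycle i b ∧ (swap a b * w).SameCycle a j) := by
  have := sameCycle_swap_mul_iff (not_sameCycle_swap_mul hab h) i j
  rwa [swap_mul_self_mul] at this

/-- The number of cycles of a permutation, including fixed points. -/
noncomputable def numCycles (w : Perm α) : ℕ := Nat.card (Quotient (SameCycle.setoid w))

lemma numCycles_le (w : Perm α) : numCycles w ≤ Nat.card α :=
  Nat.card_le_card_of_surjective (Quotient.mk _) Quotient.mk_surjective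

lemma numCycles_swap_mul {w : Perm α} {a b : α} (h : ¬ w.SameCycle a b) :
    numCycles (swap a b * w) + 1 = numCycles w := by
  classical
  have hm := sameCycle_swap_mul_iff h
  let S := SameCycle.setoid w
  let S' := SameCycle.setoid (swap a b * w)
  let f : Quotient S → Quotient S' := Quotient.map id (fun i j hij => (hm i j).2 (Or.inl hij))
  have hf : Function.Bijective (fun q : {q : Quotient S // q ≠ Quotient.mk S b} => f q.1) := by
    constructor
    · rintro ⟨q, hq⟩ ⟨q', hq'⟩ e
      induction q using Quotient.inductionOn with | _ i => ?_
      induction q' using Quotient.inductionOn with | _ j => ?_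
      have e : (swap a b * w).SameCycle i j := Quotient.exact e
      apply Subtype.ext
      apply Quotient.sound
      rcases (hm i j).1 e with h1 | ⟨h1, h2⟩ | ⟨h1, h2⟩
      · exact h1
      · exact absurd (Quotient.sound (s := S) h2.symm) hq'
      · exact absurd (Quotient.sound (s := S) h1) hq
    · intro q
      induction q using Quotient.inductionOn with | _ i => ?_
      by_cases hi : w.SameCycle i b
      · refine ⟨⟨Quotient.mk S a, fun e => h (Quotient.exact e)⟩, Quotient.sound (s := S') ?_⟩
        exact (hm _ _).2 (Or.inr (Or.inl ⟨SameCycle.refl _ _, hi.symm⟩))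
      · exact ⟨⟨Quotient.mk S i, fun e => hi (Quotient.exact e)⟩, rfl⟩
  have hc := Nat.card_congr (Equiv.ofBijective _ hf)
  have : Fintype.card {q : Quotient S // q ≠ Quotient.mk S b} = _ := Fintype.card_subtype_compl _
  rw [Fintype.card_subtype_eq, Fintype.card_eq_nat_card, Fintype.card_eq_nat_card] at this
  have hpos : 0 < Nat.card (Quotient S) := Nat.card_pos_iff.2 ⟨⟨Quotient.mk S b⟩, inferInstance⟩
  unfold numCycles
  change Nat.card (Quotient S') + 1 = Nat.card (Quotient S)
  omega

/-- The absolute length of a permutation. -/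
noncomputable def len (w : Perm α) : ℕ := Nat.card α - numCycles w

lemma len_swap_mul {w : Perm α} {a b : α} (h : ¬ w.SameCycle a b) :
    len (swap a b * w) = len w + 1 := by
  have := numCycles_swap_mul h
  have := numCycles_le w
  unfold len; omega

lemma len_swap_mul_of_sameCycle {w : Perm α} {a b : α} (hab : a ≠ b) (h : w.SameCycle a b) :
    len (swap a b * w) + 1 = len w := by
  have := len_swap_mul (not_sameCycle_swap_mul hab h)
  rw [swap_mul_self_mul] at this
  exact this.symm

@[simp] lemma len_one : len (1 : Perm α) = 0 := by
  have : Nat.card α ≤ numCycles (1 : Perm α) := by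
    refine Nat.card_le_card_of_injective (Quotient.mk (SameCycle.setoid 1)) fun i j h => ?_
    simpa using (show (1 : Perm α).SameCycle i j from Quotient.exact h)
  unfold len; omega

lemma exists_sameCycle {w : Perm α} (h : w ≠ 1) : ∃ a b, a ≠ b ∧ w.SameCycle a b := by
  obtain ⟨a, ha⟩ : ∃ a, w a ≠ a := by
    by_contra! hc; exact h (Equiv.ext hc)
  exact ⟨a, w a, ha.symm, 1, by simp⟩

lemma eq_one_of_len {w : Perm α} (h : len w = 0) : w = 1 := by
  by_contra hw
  obtain ⟨a, b, hab, h1⟩ := exists_sameCycle hw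
  have := len_swap_mul_of_sameCycle hab h1
  omega

@[elab_as_elim]
lemma len_induction {p : Perm α → Prop} (h1 : p 1)
    (h : ∀ w a b, a ≠ b → w.SameCycle a b → p (swap a b * w) → p w) (w : Perm α) : p w := by
  induction hk : len w generalizing w with
  | zero => rw [eq_one_of_len hk]; exact h1
  | succ k ih =>
    have hw : w ≠ 1 := by rintro rfl; simp at hk
    obtain ⟨a, b, hab, hs⟩ := exists_sameCycle hw
    have := len_swap_mul_of_sameCycle hab hs
    exact h w a b hab hs (ih _ (by omega))

lemma len_swap_mul_le (a b : α) (w : Perm α) : len (swap a b * w) ≤ len w + 1 := by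
  by_cases h : w.SameCycle a b
  · by_cases hab : a = b
    · rw [hab, swap_self, ← Perm.one_def, one_mul]
      exact Nat.le_succ _
    · have := len_swap_mul_of_sameCycle hab h; omega
  · exact (len_swap_mul h).le

lemma len_mul_le (u v : Perm α) : len (u * v) ≤ len u + len v := by
  induction u using len_induction with
  | h1 => simp
  | h u a b hab hs ih =>
    have h1 := len_swap_mul_of_sameCycle hab hs
    have h2 := len_swap_mul_le a b (swap a b * u * v)
    rw [mul_assoc, swap_mul_self_mul] at h2
    rw [mul_assoc] at ih
    omega

lemma len_conj (u v : Perm α) : len (u * v * u⁻¹) = len v := by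
  unfold len numCycles
  congr 1
  refine (Nat.card_congr (Quotient.congr u fun i j => ?_)).symm
  change v.SameCycle i j ↔ (u * v * u⁻¹).SameCycle (u i) (u j)
  simp [sameCycle_conj]

lemma len_swap {a b : α} (hab : a ≠ b) : len (swap a b) = 1 := by
  have := len_swap_mul (w := (1 : Perm α)) (a := a) (b := b) (by simpa using hab)
  simpa using this

/-- The prefix order on permutations. -/
def Pre (u v : Perm α) : Prop := len u + len (u⁻¹ * v) = len v

lemma pre_swap_iff {a b : α} (hab : a ≠ b) {w : Perm α} : Pre (swap a b) w ↔ w.SameCycle a b := by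
  unfold Pre
  rw [len_swap hab, swap_inv]
  constructor
  · intro h
    by_contra hn
    have := len_swap_mul hn
    omega
  · intro h
    have := len_swap_mul_of_sameCycle hab h
    omega

lemma Pre.trans {u v w : Perm α} (h₁ : Pre u v) (h₂ : Pre v w) : Pre u w := by
  unfold Pre at *
  have a := len_mul_le u (u⁻¹ * w)
  have b := len_mul_le (u⁻¹ * v) (v⁻¹ * w)
  simp only [mul_assoc, mul_inv_cancel_left] at a b
  omega

lemma Pre.inv_mul {a x y : Perm α} (h₁ : Pre a x) (h₂ : Pre x y) : Pre (a⁻¹ * x) (a⁻¹ * y) := by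
  have h₃ := h₁.trans h₂
  unfold Pre at *
  simp only [mul_inv_rev, inv_inv, mul_assoc, mul_inv_cancel_left]
  omega

lemma Pre.swap_mul {a b : α} (hab : a ≠ b) {x y : Perm α} (h₁ : x.SameCycle a b) (h₂ : Pre x y) :
    Pre (swap a b * x) (swap a b * y) := by
  simpa using Pre.inv_mul ((pre_swap_iff hab).2 h₁) h₂

lemma Pre.of_swap_mul {a b : α} (hab : a ≠ b) {x y : Perm α} (h₁ : x.SameCycle a b)
    (h₂ : y.SameCycle a b) (h : Pre (swap a b * x) (swap a b * y)) : Pre x y := by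
  have e1 := len_swap_mul_of_sameCycle hab h₁
  have e2 := len_swap_mul_of_sameCycle hab h₂
  unfold Pre at *
  simp only [mul_inv_rev, swap_inv, mul_assoc, swap_mul_self_mul] at h
  omega

lemma Pre.sameCycle {u v : Perm α} (h : Pre u v) {i j : α} (hij : u.SameCycle i j) :
    v.SameCycle i j := by
  by_cases e : i = j
  · rw [e]
  · exact (pre_swap_iff e).1 (((pre_swap_iff e).2 hij).trans h)

/-- Splitting a cycle of a prefix of `c` is compatible with splitting the cycle of `c`. -/
lemma sameCycle_swap_mul_of_pre {v c : Perm α} {a b : α} (hab : a ≠ b) (hv : v.SameCycle a b)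
    (hvc : Pre v c) {i j : α} (h1 : v.SameCycle i j) (h2 : (swap a b * c).SameCycle i j) :
    (swap a b * v).SameCycle i j := by
  have hp := hvc.swap_mul hab hv
  have hn := not_sameCycle_swap_mul hab (hvc.sameCycle hv)
  rcases (sameCycle_iff_of_sameCycle hab hv i j).1 h1 with h | ⟨h, h'⟩ | ⟨h, h'⟩
  · exact h
  · exact absurd (((hp.sameCycle h).symm.trans h2).trans (hp.sameCycle h').symm) hn
  · exact absurd (((hp.sameCycle h).symm.trans h2).trans (hp.sameCycle h').symm).symm hn

lemma pre_of_sameCycle {u v c : Perm α} (hu : Pre u c) (hv : Pre v c)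
    (h : ∀ i j, u.SameCycle i j → v.SameCycle i j) : Pre u v := by
  induction u using len_induction generalizing v c with
  | h1 => simp [Pre]
  | h u a b hab hs ih =>
    have hvs := h a b hs
    refine Pre.of_swap_mul hab hs hvs (ih (hu.swap_mul hab hs) (hv.swap_mul hab hvs) ?_)
    intro i j hij
    exact sameCycle_swap_mul_of_pre hab hvs hv
      (h _ _ ((sameCycle_iff_of_sameCycle hab hs i j).2 (Or.inl hij)))
      ((hu.swap_mul hab hs).sameCycle hij)

lemma exists_meet {u v c : Perm α} (hu : Pre u c) (hv : Pre v c) :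
    ∃ w, Pre w u ∧ Pre w v ∧ ∀ t, Pre t u → Pre t v → Pre t w := by
  induction hk : len c generalizing u v c with
  | zero =>
    have h0 : ∀ w, Pre w c → w = 1 := fun w hw => eq_one_of_len (by unfold Pre at hw; omega)
    rw [h0 u hu, h0 v hv]
    exact ⟨1, by simp [Pre], by simp [Pre], fun t ht _ => ht⟩
  | succ k ih =>
    by_cases hex : ∃ a b, a ≠ b ∧ u.SameCycle a b ∧ v.SameCycle a b
    · obtain ⟨a, b, hab, hua, hva⟩ := hex
      have hca := hu.sameCycle hua
      have huc := hu.swap_mul hab hua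
      have hvc := hv.swap_mul hab hva
      have hn := not_sameCycle_swap_mul hab hca
      obtain ⟨w, h1, h2, h3⟩ := ih huc hvc (by
        have := len_swap_mul_of_sameCycle hab hca; omega)
      have hw : ∀ i j, (swap a b * u).SameCycle i j → (swap a b * v).SameCycle i j →
          w.SameCycle i j := by
        intro i j hi hj
        by_cases e : i = j
        · rw [e]
        · exact (pre_swap_iff e).1 (h3 _ ((pre_swap_iff e).2 hi) ((pre_swap_iff e).2 hj))
      have hwn : ¬ w.SameCycle a b := fun h => hn ((h1.trans huc).sameCycle h)
      have hsw := sameCycle_swap_mul_self hwn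
      have p1 : Pre (swap a b * w) u :=
        Pre.of_swap_mul hab hsw hua (by rwa [swap_mul_self_mul])
      have p2 : Pre (swap a b * w) v :=
        Pre.of_swap_mul hab hsw hva (by rwa [swap_mul_self_mul])
      refine ⟨swap a b * w, p1, p2, fun t ht ht' => ?_⟩
      refine pre_of_sameCycle (ht.trans hu) (p1.trans hu) fun i j hij => ?_
      rw [sameCycle_swap_mul_iff hwn]
      have iu := (sameCycle_iff_of_sameCycle hab hua i j).1 (ht.sameCycle hij)
      have iv := (sameCycle_iff_of_sameCycle hab hva i j).1 (ht'.sameCycle hij)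
      by_cases hcij : (swap a b * c).SameCycle i j
      · left
        exact hw _ _ (sameCycle_swap_mul_of_pre hab hua hu (ht.sameCycle hij) hcij)
          (sameCycle_swap_mul_of_pre hab hva hv (ht'.sameCycle hij) hcij)
      · right
        have iu := iu.resolve_left fun h => hcij (huc.sameCycle h)
        have iv := iv.resolve_left fun h => hcij (hvc.sameCycle h)
        rcases iu with ⟨x, y⟩ | ⟨x, y⟩ <;> rcases iv with ⟨z, t⟩ | ⟨z, t⟩
        · exact Or.inl ⟨hw _ _ x z, hw _ _ y t⟩
        · exact absurd ((huc.sameCycle x).symm.trans (hvc.sameCycle z)) hn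
        · exact absurd ((hvc.sameCycle z).symm.trans (huc.sameCycle x)) hn
        · exact Or.inr ⟨hw _ _ x z, hw _ _ y t⟩
    · refine ⟨1, by simp [Pre], by simp [Pre], fun t ht ht' => ?_⟩
      by_cases h : t = 1
      · subst h; simp [Pre]
      · obtain ⟨a, b, hab, hs⟩ := exists_sameCycle h
        exact absurd ⟨a, b, hab, ht.sameCycle hs, ht'.sameCycle hs⟩ hex

/-- The dual Garside structure of a permutation. -/
noncomputable def dual (c : Perm α) : DualGarside (Perm α) where
  L := len
  c := c
  isOfFinOrder_c := isOfFinOrder_of_finite c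
  L_one := len_one
  eq_one_of_L _ := eq_one_of_len
  L_mul_le := len_mul_le
  L_conj := len_conj
  exists_meet _ _ hu hv := exists_meet hu hv

end PermLength

/-- The Artin relations for a sequence of elements indexed by `0, …, N - 1`. -/
structure IsBraid {G : Type*} [Group G] (N : ℕ) (s : ℕ → G) : Prop where
  braid : ∀ i, i + 1 < N → s i * s (i + 1) * s i = s (i + 1) * s i * s (i + 1)
  comm : ∀ i j, i + 2 ≤ j → j < N → s i * s j = s j * s i

/-- The product `s_i s_{i+1} ⋯ s_{j-1}`. -/
def dprod {G : Type*} [Group G] (s : ℕ → G) (i : ℕ) : ℕ → G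
  | 0 => 1
  | j + 1 => if i ≤ j then dprod s i j * s j else 1

namespace IsBraid

variable {G : Type*} [Group G] {s : ℕ → G}

lemma dprod_of_le {i j : ℕ} (h : j ≤ i) : dprod s i j = 1 := by
  cases j with
  | zero => rfl
  | succ j => simp [dprod]; omega

@[simp] lemma dprod_self (i : ℕ) : dprod s i i = 1 := dprod_of_le le_rfl

lemma dprod_succ {i j : ℕ} (h : i ≤ j) : dprod s i (j + 1) = dprod s i j * s j := by
  simp [dprod, h]

lemma dprod_mul_dprod {i j k : ℕ} (h : i ≤ j) (h' : j ≤ k) :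
    dprod s i j * dprod s j k = dprod s i k := by
  induction k, h' using Nat.le_induction with
  | base => simp
  | succ k hk ih => rw [dprod_succ hk, dprod_succ (h.trans hk), ← ih, mul_assoc]

lemma dprod_eq_mul {i j : ℕ} (h : i < j) : dprod s i j = s i * dprod s (i + 1) j := by
  rw [← dprod_mul_dprod (Nat.le_succ i) h, dprod_succ le_rfl, dprod_self, one_mul]

lemma map_dprod {H : Type*} [Group H] (f : G →* H) {t : ℕ → H} {i j : ℕ}
    (h : ∀ k, i ≤ k → k < j → f (s k) = t k) : f (dprod s i j) = dprod t i j := by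
  induction j with
  | zero => simp [dprod]
  | succ j ih =>
    by_cases hj : i ≤ j
    · rw [dprod_succ hj, dprod_succ hj, map_mul, ih (fun k hk hk' => h k hk (by omega)),
        h j hj (by omega)]
    · rw [dprod_of_le (by omega), dprod_of_le (by omega), map_one]

lemma commute_dprod {g : G} {i j : ℕ} (h : ∀ k, i ≤ k → k < j → Commute g (s k)) :
    Commute g (dprod s i j) := by
  induction j with
  | zero => simp [dprod]
  | succ j ih =>
    by_cases hj : i ≤ j
    · rw [dprod_succ hj]
      exact (ih fun k hk hk' => h k hk (by omega)).mul_right (h j hj (by omega))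
    · rw [dprod_of_le (by omega)]; exact Commute.one_right _

variable {N : ℕ}

lemma commute (hs : IsBraid N s) {i j : ℕ} (hi : i < N) (hj : j < N) (h : i + 2 ≤ j ∨ j + 2 ≤ i) :
    Commute (s i) (s j) := by
  rcases h with h | h
  · exact hs.comm i j h hj
  · exact (hs.comm j i h hi).symm

lemma dprod_mul_gen (hs : IsBraid N s) {i j m : ℕ} (hj : j ≤ N) (h1 : i ≤ m) (h2 : m + 1 < j) :
    dprod s i j * s m = s (m + 1) * dprod s i j := by
  have e : dprod s i j = dprod s i m * (s m * s (m + 1)) * dprod s (m + 2) j := by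
    rw [← dprod_mul_dprod (s := s) (show i ≤ m + 2 by omega) (show m + 2 ≤ j by omega),
      dprod_succ (by omega), dprod_succ h1, mul_assoc (dprod s i m)]
  have c1 : Commute (s m) (dprod s (m + 2) j) :=
    commute_dprod fun k hk hk' => hs.commute (by omega) (by omega) (by omega)
  have c2 : Commute (s (m + 1)) (dprod s i m) :=
    commute_dprod fun k hk hk' => hs.commute (by omega) (by omega) (by omega)
  rw [e]
  calc _ = dprod s i m * (s m * s (m + 1)) * (dprod s (m + 2) j * s m) := by group
    _ = dprod s i m * (s m * s (m + 1) * s m) * dprod s (m + 2) j := by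
      rw [← c1.eq]; simp only [mul_assoc]
    _ = (dprod s i m * s (m + 1)) * (s m * s (m + 1)) * dprod s (m + 2) j := by
      rw [hs.braid m (by omega)]; simp only [mul_assoc]
    _ = _ := by rw [← c2.eq]; simp only [mul_assoc]

lemma dprod_mul_dprod_shift (hs : IsBraid N s) {i j k l : ℕ} (hj : j ≤ N) (h1 : i ≤ k) (h2 : l + 1 ≤ j) :
    dprod s i j * dprod s k l = dprod s (k + 1) (l + 1) * dprod s i j := by
  induction l with
  | zero => rw [dprod_of_le (Nat.zero_le _), dprod_of_le (i := k + 1) (by omega)]; simp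
  | succ l ih =>
    by_cases hl : k ≤ l
    · rw [dprod_succ hl, dprod_succ (by omega), ← mul_assoc, ih (by omega), mul_assoc,
        hs.dprod_mul_gen hj (by omega) (by omega), mul_assoc]
    · rw [dprod_of_le (i := k) (by omega), dprod_of_le (i := k + 1) (by omega)]; simp

end IsBraid

/-- The Birman–Ko–Lee band generators. -/
def band {G : Type*} [Group G] (s : ℕ → G) (i j : ℕ) : G := dprod s i j * (dprod s i (j - 1))⁻¹

namespace IsBraid

variable {G : Type*} [Group G] {s : ℕ → G}

lemma band_succ (i : ℕ) : band s i (i + 1) = s i := by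
  simp [band, dprod_succ]

lemma band_eq_conj {i j : ℕ} (h : i < j) :
    band s i j = dprod s i (j - 1) * s (j - 1) * (dprod s i (j - 1))⁻¹ := by
  obtain ⟨j, rfl⟩ : ∃ l, j = l + 1 := ⟨j - 1, by omega⟩
  rw [band, dprod_succ (by omega)]; simp

lemma commute_band {g : G} {i j : ℕ} (h : ∀ k, i ≤ k → k < j → Commute g (s k)) :
    Commute g (band s i j) :=
  (commute_dprod h).mul_right (commute_dprod fun k hk hk' => h k hk (by omega)).inv_right

variable {N : ℕ}

lemma band_eq_conj' (hs : IsBraid N s) {i j : ℕ} (h : i < j) (hj : j ≤ N) :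
    band s i j = (dprod s (i + 1) j)⁻¹ * s i * dprod s (i + 1) j := by
  have := hs.dprod_mul_dprod_shift (i := i) (k := i) (l := j - 1) hj le_rfl (by omega)
  rw [Nat.sub_add_cancel (by omega)] at this
  rw [band, mul_inv_eq_iff_eq_mul, mul_assoc, mul_assoc, eq_inv_mul_iff_mul_eq, ← this,
    ← mul_assoc, ← dprod_eq_mul h]

lemma band_trans (hs : IsBraid N s) {x y z : ℕ} (h1 : x < y) (h2 : y < z) (hz : z ≤ N) :
    band s x y * band s y z = band s x z * band s x y := by
  obtain ⟨y, rfl⟩ : ∃ l, y = l + 1 := ⟨y - 1, by omega⟩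
  have e : band s x z = dprod s x (y + 1) * band s (y + 1) z * (dprod s x (y + 1))⁻¹ := by
    rw [band, band, ← dprod_mul_dprod h1.le h2.le,
      ← dprod_mul_dprod (k := z - 1) h1.le (by omega)]
    group
  have c : Commute (band s (y + 1) z) (dprod s x y) := by
    refine commute_dprod fun k hk hk' => (commute_band fun l hl hl' => ?_).symm
    exact hs.commute (by omega) (by omega) (by omega)
  rw [e, band_eq_conj h1, Nat.add_sub_cancel, dprod_succ (by omega)]
  have c' := c.inv_right.eq
  calc _ = dprod s x y * s y * ((dprod s x y)⁻¹ * band s (y + 1) z) := by simp only [mul_assoc]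
    _ = _ := by rw [← c']; group

lemma band_braid (hs : IsBraid N s) {x y z : ℕ} (h1 : x < y) (h2 : y < z) (hz : z ≤ N) :
    band s x y * band s y z * band s x y = band s y z * band s x y * band s y z := by
  obtain ⟨y, rfl⟩ : ∃ l, y = l + 1 := ⟨y - 1, by omega⟩
  set P := dprod s x y
  set Q := dprod s (y + 2) z
  have cPQ : Commute P Q :=
    commute_dprod fun k hk hk' => (commute_dprod fun l hl hl' =>
      hs.commute (by omega) (by omega) (by omega)).symm
  have cP : Commute P (s (y + 1)) := (commute_dprod fun l hl hl' =>
      hs.commute (by omega) (by omega) (by omega)).symm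
  have cQ : Commute Q (s y) := (commute_dprod fun l hl hl' =>
      hs.commute (by omega) (by omega) (by omega)).symm
  have e1 : band s x (y + 1) = (Q⁻¹ * P) * s y * (Q⁻¹ * P)⁻¹ := by
    rw [band_eq_conj h1, Nat.add_sub_cancel]
    have : Commute Q⁻¹ (P * s y * P⁻¹) :=
      (((cPQ.symm.mul_right cQ).mul_right cPQ.symm.inv_right)).inv_left
    rw [mul_inv_rev, inv_inv]
    calc _ = Q⁻¹ * Q * (P * s y * P⁻¹) := by simp; rfl
      _ = Q⁻¹ * (P * s y * P⁻¹) * Q := by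
        rw [mul_assoc Q⁻¹ Q, ((cPQ.symm.mul_right cQ).mul_right cPQ.symm.inv_right).eq,
          ← mul_assoc]
      _ = _ := by group
  have e2 : band s (y + 1) z = (Q⁻¹ * P) * s (y + 1) * (Q⁻¹ * P)⁻¹ := by
    rw [hs.band_eq_conj' h2 hz]
    rw [mul_inv_rev, inv_inv]
    calc _ = Q⁻¹ * (s (y + 1) * P) * P⁻¹ * Q := by simp [mul_assoc]; rfl
      _ = _ := by rw [← cP.eq]; group
  rw [e1, e2]
  have := hs.braid y (by omega)
  calc _ = (Q⁻¹ * P) * (s y * s (y + 1) * s y) * (Q⁻¹ * P)⁻¹ := by group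
    _ = _ := by rw [this]; group

lemma band_trans' (hs : IsBraid N s) {x y z : ℕ} (h1 : x < y) (h2 : y < z) (hz : z ≤ N) :
    band s x y * band s y z = band s y z * band s x z := by
  have a := hs.band_trans h1 h2 hz
  have b := hs.band_braid h1 h2 hz
  rw [a, mul_assoc] at b
  rw [mul_assoc, a] at b
  have : band s x z = band s x y * band s y z * (band s x y)⁻¹ := by rw [a]; simp
  rw [this, ← mul_assoc, ← mul_assoc, ← hs.band_braid h1 h2 hz]; simp

lemma band_comm_of_lt (hs : IsBraid N s) {x y z w : ℕ} (h2 : y < z) (hw : w ≤ N) :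
    Commute (band s x y) (band s z w) :=
  commute_band fun k hk hk' => (commute_band fun l hl hl' =>
    hs.commute (by omega) (by omega) (by omega)).symm

lemma band_comm_of_nested (hs : IsBraid N s) {x y z w : ℕ} (h1 : x < z) (h3 : w < y) (hy : y ≤ N) :
    Commute (band s x y) (band s z w) := by
  refine commute_band fun m hm hm' => ?_
  obtain ⟨m, rfl⟩ : ∃ l, m = l + 1 := ⟨m - 1, by omega⟩
  have e1 := hs.dprod_mul_gen (i := x) (j := y) (m := m) hy (by omega) (by omega)
  have e2 := hs.dprod_mul_gen (i := x) (j := y - 1) (m := m) (by omega) (by omega) (by omega)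
  have e3 : (dprod s x (y - 1))⁻¹ * s (m + 1) = s m * (dprod s x (y - 1))⁻¹ := by
    rw [inv_mul_eq_iff_eq_mul, ← mul_assoc, e2, mul_inv_cancel_right]
  show band s x y * s (m + 1) = s (m + 1) * band s x y
  rw [band, mul_assoc, e3, ← mul_assoc, e1, mul_assoc]

end IsBraid

section BraidGroup

/-- The generators of the braid group on `N + 1` strands, extended by `1`. -/
def sg (N : ℕ) (i : ℕ) : BraidGroup (N + 1) :=
  if h : i < N then braidσ (N + 1) ⟨i, h⟩ else 1

variable {N : ℕ}

lemma sg_val (i : Fin N) : sg N i = PresentedGroup.of (rels := braidRels N) i := by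
  simp [sg, i.2, braidσ]

lemma braid_rel_eq {a b : FreeGroup (Fin N)} (h : a * b⁻¹ ∈ braidRels N) :
    PresentedGroup.mk (braidRels N) a = PresentedGroup.mk (braidRels N) b :=
  PresentedGroup.mk_eq_mk_of_mul_inv_mem h

lemma isBraid_sg (N : ℕ) : IsBraid N (sg N) where
  braid i hi := by
    simp only [sg, hi, show i < N by omega, dif_pos]
    exact braid_rel_eq (N := N) ⟨⟨i, by omega⟩, ⟨i + 1, hi⟩, Or.inl ⟨rfl, rfl⟩⟩
  comm i j h hj := by
    simp only [sg, hj, show i < N by omega, dif_pos]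
    exact braid_rel_eq (N := N) ⟨⟨i, by omega⟩, ⟨j, hj⟩, Or.inr ⟨h, rfl⟩⟩

/-- The homomorphism from the braid group determined by a braid sequence. -/
def braidLift {G : Type*} [Group G] {s : ℕ → G} (hs : IsBraid N s) : BraidGroup (N + 1) →* G :=
  PresentedGroup.toGroup (f := fun i : Fin N => s i) (by
    rintro r ⟨i, j, ⟨h, rfl⟩ | ⟨h, rfl⟩⟩
    · simp only [map_mul, map_inv, FreeGroup.lift_apply_of, ← h]
      rw [mul_inv_eq_one]
      exact hs.braid i (by omega)
    · simp only [map_mul, map_inv, FreeGroup.lift_apply_of]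
      rw [mul_inv_eq_one]
      exact hs.comm i j h (by omega))

lemma braidLift_sg {G : Type*} [Group G] {s : ℕ → G} (hs : IsBraid N s) {i : ℕ} (hi : i < N) :
    braidLift hs (sg N i) = s i := by
  simp only [sg, hi, dif_pos]
  exact PresentedGroup.toGroup.of _

lemma braid_hom_ext {G : Type*} [Group G] {f g : BraidGroup (N + 1) →* G}
    (h : ∀ i < N, f (sg N i) = g (sg N i)) : f = g := by
  refine PresentedGroup.ext fun i => ?_
  have := h i i.2
  rwa [sg_val] at this

lemma braid_induction {p : BraidGroup (N + 1) → Prop} (x : BraidGroup (N + 1)) (h1 : p 1)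
    (hm : ∀ i < N, ∀ x, p x → p (sg N i * x)) (hi : ∀ i < N, ∀ x, p x → p ((sg N i)⁻¹ * x)) :
    p x := by
  have hx : x ∈ Subgroup.closure (Set.range (PresentedGroup.of (rels := braidRels N))) := by
    rw [PresentedGroup.closure_range_of]; trivial
  induction hx using Subgroup.closure_induction_left with
  | one => exact h1
  | mul_left x hx y hy ih =>
    obtain ⟨i, rfl⟩ := hx
    simpa only [sg_val] using hm i i.2 y ih
  | inv_mul_cancel x hx y hy ih =>
    obtain ⟨i, rfl⟩ := hx
    simpa only [sg_val] using hi i i.2 y ih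

lemma braidδ_eq (N : ℕ) : braidδ (N + 1) = dprod (sg N) 0 N := by
  have : ∀ k ≤ N, dprod (sg N) 0 k = ((List.range k).map (sg N)).prod := by
    intro k hk
    induction k with
    | zero => rfl
    | succ k ih =>
      rw [IsBraid.dprod_succ (by omega), ih (by omega), List.range_succ]; simp
  rw [this N le_rfl, braidδ]
  congr 1
  apply List.ext_getElem
  · simp
  · intro i h1 h2
    have hi : i < N := by simpa using h2
    simp [sg, hi]

end BraidGroup

namespace BraidDual

open Equiv Equiv.Perm PermLength IsBraid

variable {N : ℕ}

/-- The adjacent transpositions. -/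
def sw (N i : ℕ) : Perm (Fin (N + 1)) :=
  if h : i < N then swap ⟨i, by omega⟩ ⟨i + 1, by omega⟩ else 1

lemma sw_apply {i : ℕ} (hi : i < N) (x : Fin (N + 1)) :
    ((sw N i x : Fin (N + 1)) : ℕ) =
      if (x : ℕ) = i then i + 1 else if (x : ℕ) = i + 1 then i else x := by
  simp only [sw, hi, dif_pos, swap_apply_def, Fin.ext_iff]
  split_ifs <;> rfl

lemma isBraid_sw (N : ℕ) : IsBraid N (sw N) where
  braid i hi := by
    ext x
    simp only [Perm.mul_apply]
    repeat rw [sw_apply (by omega)]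
    split_ifs <;> omega
  comm i j h hj := by
    ext x
    simp only [Perm.mul_apply]
    repeat rw [sw_apply (by omega)]
    split_ifs <;> omega

/-- The cycle `x ↦ x + 1`. -/
def cx (N : ℕ) : Perm (Fin (N + 1)) := dprod (sw N) 0 N

lemma dprod_sw_apply {k : ℕ} (hk : k ≤ N) (x : Fin (N + 1)) :
    ((dprod (sw N) k N x : Fin (N + 1)) : ℕ) =
      if (x : ℕ) < k then (x : ℕ) else if (x : ℕ) = N then k else x + 1 := by
  induction hd : N - k generalizing k with
  | zero =>
    obtain rfl : k = N := by omega
    have := x.2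
    rw [dprod_self]
    simp only [Perm.one_apply]
    split_ifs <;> omega
  | succ d ih =>
    have := x.2
    rw [dprod_eq_mul (by omega), Perm.mul_apply, sw_apply (by omega), ih (by omega) (by omega)]
    split_ifs <;> omega

lemma cx_apply (x : Fin (N + 1)) :
    ((cx N x : Fin (N + 1)) : ℕ) = if (x : ℕ) = N then 0 else (x : ℕ) + 1 := by
  simpa [cx] using dprod_sw_apply (Nat.zero_le N) x

lemma cx_sameCycle (x y : Fin (N + 1)) : (cx N).SameCycle x y := by
  have : ∀ x, (cx N).SameCycle 0 x := by
    intro x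
    obtain ⟨x, hx⟩ := x
    induction x with
    | zero => exact SameCycle.refl _ _
    | succ x ih =>
      refine (ih (by omega)).trans ⟨1, ?_⟩
      ext
      rw [zpow_one, cx_apply, if_neg (by simp; omega)]
  exact (this x).symm.trans (this y)

lemma mem_of_sameCycle {i j k l : Fin (N + 1)} (hij : i < j)
    (h : (swap i j * cx N).SameCycle k l) : (i ≤ k ∧ k < j) ↔ (i ≤ l ∧ l < j) := by
  revert h
  refine SameCycle.of_equivalence (r := fun k l => (i ≤ k ∧ k < j) ↔ (i ≤ l ∧ l < j))
    ⟨fun _ => Iff.rfl, fun h => h.symm, fun h h' => h.trans h'⟩ fun x => ?_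
  rw [Perm.mul_apply, swap_apply_def]
  have := cx_apply x
  have := x.2
  have := j.2
  split_ifs with h1 h2 <;> simp only [Fin.ext_iff, Fin.lt_def, Fin.le_def] at * <;>
    split_ifs at * <;> omega

lemma sameCycle_of_mem {i j k l : Fin (N + 1)} (hij : i < j)
    (h : (i ≤ k ∧ k < j) ↔ (i ≤ l ∧ l < j)) : (swap i j * cx N).SameCycle k l := by
  have key : ∀ x, (i ≤ x ∧ x < j ∧ (swap i j * cx N).SameCycle x i) ∨
      (¬ (i ≤ x ∧ x < j) ∧ (swap i j * cx N).SameCycle x j) := by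
    intro x
    have h1 : (swap i j * cx N).SameCycle x i → i ≤ x ∧ x < j := fun hx =>
      (mem_of_sameCycle hij hx).2 ⟨le_rfl, hij⟩
    have h2 : (swap i j * cx N).SameCycle x j → ¬ (i ≤ x ∧ x < j) := fun hx hx' =>
      absurd ((mem_of_sameCycle hij hx).1 hx').2 (lt_irrefl _)
    rcases (sameCycle_iff_of_sameCycle hij.ne (cx_sameCycle i j) x i).1 (cx_sameCycle _ _) with
      hx | ⟨hx, _⟩ | ⟨hx, _⟩
    · exact Or.inl ⟨(h1 hx).1, (h1 hx).2, hx⟩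
    · exact Or.inl ⟨(h1 hx).1, (h1 hx).2, hx⟩
    · exact Or.inr ⟨h2 hx, hx⟩
  rcases key k with ⟨a, b, c⟩ | ⟨a, b⟩ <;> rcases key l with ⟨a', b', c'⟩ | ⟨a', b'⟩
  · exact c.trans c'.symm
  · exact absurd (h.1 ⟨a, b⟩) a'
  · exact absurd (h.2 ⟨a', b'⟩) a
  · exact b.trans b'.symm

lemma pre_swap_mul {w c : Perm (Fin (N + 1))} {a b : Fin (N + 1)} (hab : a ≠ b) (h : Pre w c)
    (hs : w.SameCycle a b) : Pre (swap a b * w) c := by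
  have h1 : Pre (swap a b) w := (pre_swap_iff hab).2 hs
  have := (DualGarside.Simple.ldiv (D := dual c) ⟨swap a b, h1.trans h⟩ ⟨w, h⟩ h1).2
  exact this

/-- The band generator of an unordered pair. -/
def bd (N : ℕ) (i j : Fin (N + 1)) : BraidGroup (N + 1) :=
  if i < j then band (sg N) i j else band (sg N) j i

lemma bd_of_lt {i j : Fin (N + 1)} (h : i < j) : bd N i j = band (sg N) i j := if_pos h

lemma bd_comm (i j : Fin (N + 1)) : bd N i j = bd N j i := by
  rcases lt_trichotomy i j with h | rfl | h
  · rw [bd, bd, if_pos h, if_neg h.not_gt]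
  · rfl
  · rw [bd, bd, if_pos h, if_neg h.not_gt]

lemma hurwitz {i j k l : Fin (N + 1)} (hij : i < j) (hkl : k < l) (hne : ¬ (i = k ∧ j = l))
    (h : (i ≤ k ∧ k < j) ↔ (i ≤ l ∧ l < j)) :
    bd N i j * bd N k l = bd N k l * bd N (swap k l i) (swap k l j) := by
  have hs := isBraid_sg N
  have hcomm : i ≠ k → i ≠ l → j ≠ k → j ≠ l →
      Commute (band (sg N) i j) (band (sg N) k l) →
      bd N i j * bd N k l = bd N k l * bd N (swap k l i) (swap k l j) := by
    intro h1 h2 h3 h4 hc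
    rw [swap_apply_of_ne_of_ne h1 h2, swap_apply_of_ne_of_ne h3 h4, bd_of_lt hij, bd_of_lt hkl]
    exact hc
  have := i.2
  have := j.2
  have := k.2
  have := l.2
  by_cases hk : i ≤ k ∧ k < j
  · have hl := h.1 hk
    rcases hk.1.eq_or_lt with rfl | hik
    · rw [swap_apply_left, swap_apply_of_ne_of_ne hij.ne' hl.2.ne', bd_of_lt hij, bd_of_lt hkl,
        bd_of_lt hl.2]
      exact (hs.band_trans hkl hl.2 (by omega)).symm
    · exact hcomm hik.ne (hik.trans hkl).ne hk.2.ne' hl.2.ne'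
        (hs.band_comm_of_nested hik hl.2 (by omega))
  · have hl := fun x => hk (h.2 x)
    rcases lt_or_ge k i with hki | hik
    · rcases lt_or_ge l i with hli | hil
      · exact hcomm hki.ne' hli.ne' (hki.trans hij).ne' (hli.trans hij).ne'
          (hs.band_comm_of_lt hli (by omega)).symm
      · have hjl : j ≤ l := not_lt.1 fun x => hl ⟨hil, x⟩
        rcases hjl.eq_or_lt with rfl | hjl
        · rw [swap_apply_right, swap_apply_of_ne_of_ne hki.ne' hij.ne, bd_of_lt hij, bd_of_lt hkl,
            bd_comm, bd_of_lt hki]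
          exact (hs.band_trans' hki hij (by omega)).symm.trans (hs.band_trans hki hij (by omega))
        · exact hcomm hki.ne' (hij.trans hjl).ne (hki.trans hij).ne' hjl.ne
            (hs.band_comm_of_nested hki hjl (by omega)).symm
    · have hjk : j ≤ k := not_lt.1 fun x => hk ⟨hik, x⟩
      rcases hjk.eq_or_lt with rfl | hjk
      · rw [swap_apply_left, swap_apply_of_ne_of_ne hij.ne (hij.trans hkl).ne, bd_of_lt hij,
          bd_of_lt hkl, bd_of_lt (hij.trans hkl)]
        exact hs.band_trans' hij hkl (by omega)
      · exact hcomm (hij.trans hjk).ne ((hij.trans hjk).trans hkl).ne hjk.ne (hjk.trans hkl).ne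
          (hs.band_comm_of_lt hjk (by omega))

/-- The value in the braid group of a reduced factorization into transpositions. -/
inductive Val : Perm (Fin (N + 1)) → BraidGroup (N + 1) → Prop
  | one : Val 1 1
  | cons {i j : Fin (N + 1)} {w : Perm (Fin (N + 1))} {g : BraidGroup (N + 1)} (hij : i < j)
      (h : w.SameCycle i j) (hg : Val (swap i j * w) g) : Val w (bd N i j * g)

lemma Val.cons_of_ne {i j : Fin (N + 1)} {w : Perm (Fin (N + 1))} {g : BraidGroup (N + 1)}
    (hij : i ≠ j) (h : w.SameCycle i j) (hg : Val (swap i j * w) g) : Val w (bd N i j * g) := by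
  rcases lt_or_gt_of_ne hij with h' | h'
  · exact Val.cons h' h hg
  · rw [bd_comm]
    rw [swap_comm] at hg
    exact Val.cons h' h.symm hg

lemma exists_val (w : Perm (Fin (N + 1))) : ∃ g, Val w g := by
  induction w using len_induction with
  | h1 => exact ⟨1, Val.one⟩
  | h w a b hab hs ih =>
    obtain ⟨g, hg⟩ := ih
    exact ⟨_, Val.cons_of_ne hab hs hg⟩

lemma val_step {w : Perm (Fin (N + 1))} (hw : Pre w (cx N))
    (ih : ∀ w', len w' < len w → Pre w' (cx N) → ∀ g g', Val w' g → Val w' g' → g = g')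
    {i j k l : Fin (N + 1)} (hij : i < j) (hkl : k < l) (h1 : w.SameCycle i j)
    (h2 : w.SameCycle k l) (h3 : (i ≤ k ∧ k < j) ↔ (i ≤ l ∧ l < j))
    {g g' : BraidGroup (N + 1)} (hg : Val (swap i j * w) g) (hg' : Val (swap k l * w) g') :
    bd N i j * g = bd N k l * g' := by
  have hs3 := sameCycle_of_mem hij h3
  have hne : ¬ (i = k ∧ j = l) := by
    rintro ⟨rfl, rfl⟩
    exact not_sameCycle_swap_mul hij.ne (cx_sameCycle i j) hs3
  have h4 := sameCycle_swap_mul_of_pre hij.ne h1 hw h2 hs3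
  obtain ⟨g3, hg3⟩ := exists_val (swap k l * (swap i j * w))
  have l1 := len_swap_mul_of_sameCycle hij.ne h1
  have l2 := len_swap_mul_of_sameCycle hkl.ne h2
  have l3 := len_swap_mul_of_sameCycle hkl.ne h4
  have e1 := ih _ (by omega) (pre_swap_mul hij.ne hw h1) _ _ hg (Val.cons hkl h4 hg3)
  have hne' : swap k l i ≠ swap k l j := fun e => hij.ne ((swap k l).injective e)
  have ew : swap (swap k l i) (swap k l j) * (swap k l * w) = swap k l * (swap i j * w) := by
    rw [swap_apply_apply (swap k l), swap_inv]
    simp only [mul_assoc, swap_mul_self_mul]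
  have h5 : (swap k l * w).SameCycle (swap k l i) (swap k l j) := by
    by_contra hc
    have := len_swap_mul hc
    rw [ew] at this
    omega
  have e2 := ih _ (by omega) (pre_swap_mul hkl.ne hw h2) _ _ hg'
    (Val.cons_of_ne hne' h5 (by rwa [ew]))
  rw [e1, e2, ← mul_assoc, ← mul_assoc, hurwitz hij hkl hne h3]

lemma Val.unique {w : Perm (Fin (N + 1))} (hw : Pre w (cx N)) {g g' : BraidGroup (N + 1)}
    (h : Val w g) (h' : Val w g') : g = g' := by
  induction hk : len w using Nat.strong_induction_on generalizing w g g' with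
  | _ k ih =>
  subst hk
  have ih' : ∀ w', len w' < len w → Pre w' (cx N) → ∀ g g', Val w' g → Val w' g' → g = g' :=
    fun w' hl hp g g' hg hg' => ih (len w') hl hp hg hg' rfl
  cases h with
  | one =>
    cases h' with
    | one => rfl
    | cons hij h1 hg => exact absurd (by simpa using h1) hij.ne
  | @cons i j _ g hij h1 hg =>
    cases h' with
    | one => exact absurd (by simpa using h1) hij.ne
    | @cons k l _ g' hkl h2 hg' =>
      by_cases hne : i = k ∧ j = l
      · obtain ⟨rfl, rfl⟩ := hne
        have := len_swap_mul_of_sameCycle hij.ne h1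
        rw [ih' _ (by omega) (pre_swap_mul hij.ne hw h1) _ _ hg hg']
      by_cases c1 : (i ≤ k ∧ k < j) ↔ (i ≤ l ∧ l < j)
      · exact val_step hw ih' hij hkl h1 h2 c1 hg hg'
      by_cases c2 : (k ≤ i ∧ i < l) ↔ (k ≤ j ∧ j < l)
      · exact (val_step hw ih' hkl hij h2 h1 c2 hg' hg).symm
      have hik : w.SameCycle i k := by
        by_contra hn
        apply c1
        apply mem_of_sameCycle hij
        refine (hw.swap_mul hij.ne h1).sameCycle ?_
        rcases (sameCycle_iff_of_sameCycle hij.ne h1 k l).1 h2 with h | ⟨h, -⟩ | ⟨h, -⟩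
        · exact h
        · exact absurd ((sameCycle_iff_of_sameCycle hij.ne h1 k i).2 (Or.inl h)).symm hn
        · exact absurd (h1.trans ((sameCycle_iff_of_sameCycle hij.ne h1 k j).2 (Or.inl h)).symm) hn
      have hcross : (i < k ∧ k < j ∧ j < l) ∨ (k < i ∧ i < l ∧ l < j) := by
        simp only [Fin.lt_def, Fin.le_def, Fin.ext_iff] at *; omega
      rcases hcross with ⟨a, b, c⟩ | ⟨a, b, c⟩
      · obtain ⟨g3, hg3⟩ := exists_val (swap i k * w)
        have e1 := val_step hw ih' hij a h1 hik
          (by simp only [Fin.lt_def, Fin.le_def] at *; omega) hg hg3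
        have e2 := val_step hw ih' a hkl hik h2
          (by simp only [Fin.lt_def, Fin.le_def] at *; omega) hg3 hg'
        exact e1.trans e2
      · obtain ⟨g3, hg3⟩ := exists_val (swap k i * w)
        have e1 := val_step hw ih' hkl a h2 hik.symm
          (by simp only [Fin.lt_def, Fin.le_def] at *; omega) hg' hg3
        have e2 := val_step hw ih' a hij hik.symm h1
          (by simp only [Fin.lt_def, Fin.le_def] at *; omega) hg3 hg
        exact (e1.trans e2).symm

lemma Val.mul {u v : Perm (Fin (N + 1))} {g h : BraidGroup (N + 1)} (hu : Val u g)
    (hv : Val v h) (hp : Pre u (u * v)) : Val (u * v) (g * h) := by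
  induction hu with
  | one => simpa using hv
  | @cons i j u g hij hs _ ih =>
    rw [mul_assoc]
    refine Val.cons hij (hp.sameCycle hs) ?_
    rw [← mul_assoc]
    apply ih
    rw [mul_assoc]
    exact hp.swap_mul hij.ne hs

lemma Val.swap {i j : Fin (N + 1)} (hij : i < j) : Val (swap i j) (bd N i j) := by
  have := Val.cons (N := N) (w := Equiv.swap i j) (g := 1) hij
    (⟨1, by simp⟩) (by rw [swap_mul_self]; exact Val.one)
  simpa using this

/-- The value of a simple element in the braid group. -/
noncomputable def evS (s : (dual (cx N)).Simple) : BraidGroup (N + 1) := (exists_val s.1).choose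

lemma evS_eq {s : (dual (cx N)).Simple} {g : BraidGroup (N + 1)} (h : Val s.1 g) : evS s = g :=
  Val.unique s.2 (exists_val s.1).choose_spec h

/-- The evaluation homomorphism from the dual monoid to the braid group. -/
noncomputable def ev (N : ℕ) : (dual (cx N)).Mon →* BraidGroup (N + 1) :=
  DualGarside.monLift evS (evS_eq Val.one) (by
    intro s t r h e
    refine (evS_eq ?_).symm
    rw [← e] at h ⊢
    exact Val.mul (exists_val s.1).choose_spec (exists_val t.1).choose_spec h)

lemma pre_cx_of_swap {i j : Fin (N + 1)} (hij : i ≠ j) : Pre (swap i j) (cx N) :=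
  (pre_swap_iff hij).2 (cx_sameCycle _ _)

/-- The simple element of a transposition. -/
def sSwap {i j : Fin (N + 1)} (hij : i ≠ j) : (dual (cx N)).Simple :=
  ⟨swap i j, pre_cx_of_swap hij⟩

lemma pre_swap_mul_swap {i j k l : Fin (N + 1)} (hij : i < j) (hkl : k < l)
    (h : (i ≤ k ∧ k < j) ↔ (i ≤ l ∧ l < j)) :
    Pre (swap i j * swap k l) (cx N) ∧ len (swap i j * swap k l) = 2 := by
  have h1 := len_swap_mul_of_sameCycle hij.ne (cx_sameCycle i j)
  have h2 := len_swap_mul_of_sameCycle hkl.ne (sameCycle_of_mem hij h)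
  have h3 := len_mul_le (swap i j) (swap k l)
  have h4 := len_mul_le (swap i j * swap k l) ((swap i j * swap k l)⁻¹ * cx N)
  rw [len_swap hij.ne, len_swap hkl.ne] at h3
  unfold Pre
  simp only [mul_inv_rev, swap_inv, mul_assoc, swap_mul_self_mul] at *
  omega

lemma gen_swap_mul {i j k l : Fin (N + 1)} (hij : i ≠ j) (hkl : k ≠ l)
    (r : (dual (cx N)).Simple) (hr : len r.1 = 2) (e : swap i j * swap k l = r.1) :
    DualGarside.gen (sSwap hij) * DualGarside.gen (sSwap hkl) = DualGarside.gen r := by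
  refine DualGarside.gen_mul_gen ?_ e
  show len _ + len _ = len _
  rw [hr, ← e]
  simp only [sSwap, swap_inv, swap_mul_self_mul, len_swap hij, len_swap hkl]

/-- The adjacent transposition as an element of the dual monoid. -/
noncomputable def gsw (N i : ℕ) : (dual (cx N)).Mon :=
  if h : i < N then DualGarside.gen (sSwap (i := ⟨i, by omega⟩) (j := ⟨i + 1, by omega⟩)
    (by simp)) else 1

lemma isBraid_gsw (N : ℕ) : IsBraid N (fun i => DualGarside.iota (dual (cx N)) (gsw N i)) where
  braid i hi := by
    have h : i < N := by omega
    simp only [← map_mul]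
    congr 1
    simp only [gsw, hi, h, dif_pos]
    let a : Fin (N + 1) := ⟨i, by omega⟩
    let b : Fin (N + 1) := ⟨i + 1, by omega⟩
    let c : Fin (N + 1) := ⟨i + 2, by omega⟩
    have hab : a < b := by simp [a, b, Fin.lt_def]
    have hbc : b < c := by simp [c, b, Fin.lt_def]
    have hac := hab.trans hbc
    obtain ⟨h1, h2⟩ := pre_swap_mul_swap hab hbc (by simp [a, b, c, Fin.le_def, Fin.lt_def])
    have e1 := gen_swap_mul hab.ne hbc.ne ⟨_, h1⟩ h2 rfl
    have e2 := gen_swap_mul hbc.ne hac.ne ⟨_, h1⟩ h2 (by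
      show swap b c * swap a c = swap a b * swap b c
      rw [mul_swap_eq_swap_mul, swap_apply_right, swap_apply_of_ne_of_ne hab.ne hac.ne])
    have e3 := gen_swap_mul hac.ne hab.ne ⟨_, h1⟩ h2 (by
      show swap a c * swap a b = swap a b * swap b c
      rw [mul_swap_eq_swap_mul (swap a b), swap_apply_right,
        swap_apply_of_ne_of_ne hac.ne' hbc.ne'])
    change DualGarside.gen (sSwap hab.ne) * DualGarside.gen (sSwap hbc.ne) *
      DualGarside.gen (sSwap hab.ne) = DualGarside.gen (sSwap hbc.ne) *
      DualGarside.gen (sSwap hab.ne) * DualGarside.gen (sSwap hbc.ne)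
    rw [e1, ← e2, mul_assoc, e3, mul_assoc, e1]
  comm i j hij hj := by
    have h : i < N := by omega
    simp only [← map_mul]
    congr 1
    simp only [gsw, hj, h, dif_pos]
    obtain ⟨h1, h2⟩ := pre_swap_mul_swap (N := N) (i := ⟨i, by omega⟩) (j := ⟨i + 1, by omega⟩)
      (k := ⟨j, by omega⟩) (l := ⟨j + 1, by omega⟩) (by simp [Fin.lt_def]) (by simp [Fin.lt_def])
      (by simp [Fin.le_def, Fin.lt_def]; omega)
    rw [gen_swap_mul _ _ ⟨_, h1⟩ h2 rfl, gen_swap_mul _ _ ⟨_, h1⟩ h2 ?_]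
    rw [mul_swap_eq_swap_mul, swap_apply_of_ne_of_ne, swap_apply_of_ne_of_ne] <;>
      simp [Fin.ext_iff] <;> omega

lemma len_dprod_sw {k : ℕ} (hk : k ≤ N) : len (dprod (sw N) k N) = N - k := by
  induction hd : N - k generalizing k with
  | zero =>
    obtain rfl : k = N := by omega
    simp
  | succ d ih =>
    have hk' : k < N := by omega
    have hs : (dprod (sw N) k N).SameCycle ⟨k, by omega⟩ ⟨k + 1, by omega⟩ := by
      refine ⟨1, ?_⟩
      ext
      rw [zpow_one, dprod_sw_apply hk]
      simp; omega
    have := len_swap_mul_of_sameCycle (by simp) hs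
    have e : swap ⟨k, by omega⟩ ⟨k + 1, by omega⟩ = sw N k := by simp [sw, hk']
    rw [e] at this
    have e2 : sw N k * dprod (sw N) k N = dprod (sw N) (k + 1) N := by
      rw [dprod_eq_mul hk', ← mul_assoc]
      simp [sw, hk']
    rw [e2, ih (by omega) (by omega)] at this
    exact this.symm

lemma len_dprod_sw_left {k : ℕ} (hk : k ≤ N) :
    len (dprod (sw N) 0 k) = k ∧ Pre (dprod (sw N) 0 k) (cx N) := by
  have h1 := len_dprod_sw hk
  have h0 := len_dprod_sw (N := N) (Nat.zero_le N)
  have e : (dprod (sw N) 0 k)⁻¹ * cx N = dprod (sw N) k N := by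
    rw [cx, ← dprod_mul_dprod (Nat.zero_le k) hk]; simp
  have h2 := len_mul_le (dprod (sw N) 0 k) (dprod (sw N) k N)
  rw [dprod_mul_dprod (Nat.zero_le k) hk, h0] at h2
  have h3 : len (dprod (sw N) 0 k) ≤ k := by
    clear h1 e h2
    induction k with
    | zero => simp [dprod]
    | succ k ih =>
      rw [dprod_succ (Nat.zero_le k)]
      have := len_mul_le (dprod (sw N) 0 k) (sw N k)
      have h4 : len (sw N k) = 1 := by
        rw [sw, dif_pos (by omega), len_swap (by simp)]
      have := ih (by omega)
      omega
  have h4 : len (dprod (sw N) 0 k) = k := by omega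
  refine ⟨h4, ?_⟩
  unfold Pre
  rw [e, h1, h4, cx, h0]
  omega

lemma dprod_gsw {k : ℕ} (hk : k ≤ N) :
    dprod (fun i => DualGarside.iota (dual (cx N)) (gsw N i)) 0 k =
      DualGarside.iota (dual (cx N)) (DualGarside.gen ⟨dprod (sw N) 0 k, (len_dprod_sw_left hk).2⟩) := by
  induction k with
  | zero =>
    rw [dprod_self, DualGarside.gen_eq_one (by simp), map_one]
  | succ k ih =>
    have hk' : k < N := hk
    rw [dprod_succ (Nat.zero_le k), ih (by omega), ← map_mul]
    congr 1
    simp only [gsw, hk', dif_pos]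
    have e : sw N k = swap ⟨k, by omega⟩ ⟨k + 1, by omega⟩ := by simp [sw, hk']
    have e2 : dprod (sw N) 0 k * swap ⟨k, by omega⟩ ⟨k + 1, by omega⟩ = dprod (sw N) 0 (k + 1) := by
      rw [dprod_succ (Nat.zero_le k), e]
    refine DualGarside.gen_mul_gen ?_ e2
    show len (dprod (sw N) 0 k) + len ((dprod (sw N) 0 k)⁻¹ * dprod (sw N) 0 (k + 1)) =
      len (dprod (sw N) 0 (k + 1))
    rw [(len_dprod_sw_left hk).1, ← e2, inv_mul_cancel_left, (len_dprod_sw_left (by omega)).1,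
      len_swap (by simp)]

/-- Roots of powers of `δ` in the braid group are conjugate to powers of `δ`. -/
theorem conj_delta_of_pow_eq (N : ℕ) (x : BraidGroup (N + 1)) (m : ℤ) (d : ℕ) (hd : 0 < d)
    (hx : x ^ d = (braidδ (N + 1) ^ m) ^ d) : IsConj x (braidδ (N + 1) ^ m) := by
  let f := braidLift (isBraid_gsw N)
  let e := DualGarside.gamLift (ev N)
  have hef : e.comp f = MonoidHom.id _ := by
    refine braid_hom_ext fun i hi => ?_
    show e (f (sg N i)) = sg N i
    rw [braidLift_sg _ hi, DualGarside.gamLift_iota, gsw, dif_pos hi]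
    refine evS_eq ?_
    have := Val.swap (N := N) (i := ⟨i, by omega⟩) (j := ⟨i + 1, by omega⟩) (by simp [Fin.lt_def])
    rw [bd_of_lt (by simp [Fin.lt_def])] at this
    simp only [band_succ] at this
    exact this
  have hδ : f (braidδ (N + 1)) = DualGarside.iota _ (DualGarside.dl (dual (cx N))) := by
    rw [braidδ_eq, map_dprod f (fun k _ hk => braidLift_sg _ hk), dprod_gsw le_rfl]
    rfl
  have he : ∀ y, e (f y) = y := fun y => DFunLike.congr_fun hef y
  obtain ⟨g, hg⟩ := DualGarside.root_conj (f x) m d hd (by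
    rw [← hδ, ← map_zpow, ← map_pow, ← map_pow, hx])
  have := congrArg e hg
  rw [← hδ, ← map_zpow, map_mul, map_mul, he, he] at this
  refine isConj_iff.2 ⟨(e g)⁻¹, ?_⟩
  rw [inv_inv, mul_assoc, this, inv_mul_cancel_left]

end BraidDual

/-- Monomial transformations: permutations of `X` with labels in `A`. -/
@[ext] structure Mono (X A : Type*) where
  /-- The underlying permutation. -/
  perm : Equiv.Perm X
  /-- The labels. -/
  lab : X → A

namespace Mono

variable {X A : Type*} [Group A]

instance : Mul (Mono X A) := ⟨fun f g => ⟨f.perm * g.perm, fun x => f.lab (g.perm x) * g.lab x⟩⟩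
instance : One (Mono X A) := ⟨⟨1, 1⟩⟩
instance : Inv (Mono X A) := ⟨fun f => ⟨f.perm⁻¹, fun x => (f.lab (f.perm⁻¹ x))⁻¹⟩⟩

lemma perm_mul (f g : Mono X A) : (f * g).perm = f.perm * g.perm := rfl
lemma lab_mul (f g : Mono X A) (x : X) : (f * g).lab x = f.lab (g.perm x) * g.lab x := rfl
lemma perm_one : (1 : Mono X A).perm = 1 := rfl
lemma lab_one (x : X) : (1 : Mono X A).lab x = 1 := rfl

instance : Group (Mono X A) := Group.ofLeftAxioms
  (fun f g h => by
    ext x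
    · simp [perm_mul]
    · simp [perm_mul, lab_mul, mul_assoc])
  (fun f => by
    ext x
    · simp [perm_mul, perm_one]
    · simp [lab_mul, lab_one])
  (fun f => by
    ext x
    · show (f.perm⁻¹ * f.perm) x = x
      simp
    · show (f.lab (f.perm⁻¹ (f.perm x)))⁻¹ * f.lab x = 1
      simp)

/-- The underlying permutation as a homomorphism. -/
def permHom : Mono X A →* Equiv.Perm X where
  toFun := perm
  map_one' := rfl
  map_mul' _ _ := rfl

lemma perm_pow (f : Mono X A) (k : ℕ) : (f ^ k).perm = f.perm ^ k := map_pow permHom f k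

lemma lab_pow {f : Mono X A} {x : X} (h : f.perm x = x) (k : ℕ) :
    (f ^ k).lab x = f.lab x ^ k := by
  induction k with
  | zero => simp [lab_one]
  | succ k ih => rw [pow_succ, lab_mul, h, ih, pow_succ]

lemma lab_inv {f : Mono X A} {x : X} (h : f.perm x = x) : (f⁻¹).lab x = (f.lab x)⁻¹ := by
  show (f.lab (f.perm⁻¹ x))⁻¹ = _
  rw [Equiv.Perm.inv_eq_iff_eq.2 h.symm]

lemma lab_zpow {f : Mono X A} {x : X} (h : f.perm x = x) (k : ℤ) :
    (f ^ k).lab x = f.lab x ^ k := by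
  obtain ⟨k, rfl | rfl⟩ := k.eq_nat_or_neg
  · simpa using lab_pow h k
  · rw [zpow_neg, zpow_neg, zpow_natCast, zpow_natCast, lab_inv, lab_pow h]
    rw [perm_pow]
    exact Function.IsFixedPt.perm_pow h k

end Mono

namespace BraidDual

open Equiv Equiv.Perm IsBraid

variable {N : ℕ}

/-- The exponent sum. -/
def expSum (N : ℕ) : BraidGroup (N + 1) →* Multiplicative ℤ :=
  braidLift (s := fun _ => Multiplicative.ofAdd 1)
    ⟨fun _ _ => rfl, fun _ _ _ _ => rfl⟩

lemma expSum_delta : expSum N (braidδ (N + 1)) = Multiplicative.ofAdd (N : ℤ) := by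
  rw [braidδ_eq, map_dprod (expSum N) (fun k _ hk => braidLift_sg _ hk)]
  have : ∀ k : ℕ, dprod (fun _ => Multiplicative.ofAdd (1 : ℤ)) 0 k =
      Multiplicative.ofAdd (k : ℤ) := by
    intro k
    induction k with
    | zero => rfl
    | succ k ih => rw [dprod_succ (Nat.zero_le k), ih, ← ofAdd_add]; simp
  exact this N

/-- The permutation of a braid. -/
def braidPerm (N : ℕ) : BraidGroup (N + 1) →* Perm (Fin (N + 1)) := braidLift (isBraid_sw N)

lemma braidPerm_delta : braidPerm N (braidδ (N + 1)) = cx N := by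
  rw [braidδ_eq, map_dprod (braidPerm N) (fun k _ hk => braidLift_sg _ hk)]; rfl

lemma cx_pow_apply {a : ℕ} (ha : a ≤ N + 1) (x : Fin (N + 1)) :
    (((cx N ^ a) x : Fin (N + 1)) : ℕ) = if (x : ℕ) + a < N + 1 then x + a else x + a - (N + 1) := by
  induction a with
  | zero => have := x.2; rw [pow_zero, Perm.one_apply, if_pos (by omega), add_zero]
  | succ a ih =>
    rw [pow_succ', Perm.mul_apply, cx_apply, ih (by omega)]
    have := x.2
    split_ifs <;> omega

lemma cx_pow_succ : cx N ^ (N + 1) = 1 := by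
  ext x
  rw [cx_pow_apply le_rfl, if_neg (by omega), Nat.add_sub_cancel, Perm.one_apply]

lemma dvd_of_cx_zpow {m : ℤ} {x : Fin (N + 1)} (h : (cx N ^ m) x = x) : ((N + 1 : ℕ) : ℤ) ∣ m := by
  have h1 := Int.emod_nonneg m (b := ((N + 1 : ℕ) : ℤ)) (by omega)
  have h2 := Int.emod_lt_of_pos m (b := ((N + 1 : ℕ) : ℤ)) (by omega)
  obtain ⟨a, ha⟩ := Int.eq_ofNat_of_zero_le h1
  rw [← Int.emod_add_mul_ediv m ((N + 1 : ℕ) : ℤ), zpow_add, zpow_mul, zpow_natCast _ (N + 1),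
    cx_pow_succ, one_zpow, mul_one, ha, zpow_natCast] at h
  have h3 := cx_pow_apply (a := a) (by omega) x
  rw [h] at h3
  have := x.2
  refine Int.dvd_of_emod_eq_zero ?_
  rw [ha]
  split_ifs at h3 <;> omega

/-- The linking transformation of a generator on ordered pairs of strands. -/
def lkGen (N p : ℕ) : Mono (Fin (N + 1) × Fin (N + 1)) (Multiplicative ℤ) where
  perm := (sw N p).prodCongr (sw N p)
  lab x := Multiplicative.ofAdd (if (x.1 : ℕ) = p ∧ (x.2 : ℕ) = p + 1 then 1 else 0)

lemma isBraid_lkGen (N : ℕ) : IsBraid N (lkGen N) where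
  braid i hi := by
    have h := fun x : Fin (N + 1) => DFunLike.congr_fun ((isBraid_sw N).braid i hi) x
    refine Mono.ext (Equiv.ext fun x => Prod.ext (h x.1) (h x.2)) (funext fun x => ?_)
    obtain ⟨x, y⟩ := x
    simp only [Mono.lab_mul, lkGen, Equiv.prodCongr_apply,
      Prod.map, ← ofAdd_add, EmbeddingLike.apply_eq_iff_eq]
    repeat rw [sw_apply (by omega)]
    generalize (x : ℕ) = a
    generalize (y : ℕ) = b
    clear h
    grind (splits := 40)
  comm i j hij hj := by
    have h := fun x : Fin (N + 1) => DFunLike.congr_fun ((isBraid_sw N).comm i j hij hj) x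
    refine Mono.ext (Equiv.ext fun x => Prod.ext (h x.1) (h x.2)) (funext fun x => ?_)
    obtain ⟨x, y⟩ := x
    simp only [Mono.lab_mul, lkGen, Equiv.prodCongr_apply,
      Prod.map, ← ofAdd_add, EmbeddingLike.apply_eq_iff_eq]
    repeat rw [sw_apply (by omega)]
    generalize (x : ℕ) = a
    generalize (y : ℕ) = b
    clear h
    grind (splits := 40)

/-- The linking action on ordered pairs of strands. -/
def lk (N : ℕ) : BraidGroup (N + 1) →* Mono (Fin (N + 1) × Fin (N + 1)) (Multiplicative ℤ) :=
  braidLift (isBraid_lkGen N)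

lemma lk_perm (g : BraidGroup (N + 1)) (x : Fin (N + 1) × Fin (N + 1)) :
    (lk N g).perm x = (braidPerm N g x.1, braidPerm N g x.2) := by
  induction g using braid_induction generalizing x with
  | h1 => simp [Mono.perm_one]
  | hm i hi g ih =>
    rw [map_mul, Mono.perm_mul, Perm.mul_apply, ih, map_mul, lk, braidLift_sg _ hi, braidPerm,
      braidLift_sg _ hi]
    rfl
  | hi i hi g ih =>
    rw [map_mul, Mono.perm_mul, Perm.mul_apply, ih, map_mul, map_inv, map_inv, lk,
      braidLift_sg _ hi, braidPerm, braidLift_sg _ hi]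
    rfl

lemma lab_dprod_lkGen {k : ℕ} (hk : k ≤ N) (x y : Fin (N + 1)) :
    (dprod (lkGen N) k N).perm (x, y) = (dprod (sw N) k N x, dprod (sw N) k N y) ∧
    (dprod (lkGen N) k N).lab (x, y) =
      Multiplicative.ofAdd (if (y : ℕ) = N ∧ k ≤ (x : ℕ) ∧ (x : ℕ) < N then 1 else 0) := by
  induction hd : N - k generalizing k with
  | zero =>
    obtain rfl : k = N := by omega
    have := x.2
    rw [dprod_self, dprod_self, if_neg (by omega)]
    exact ⟨rfl, rfl⟩
  | succ d ih =>
    obtain ⟨h1, h2⟩ := ih (k := k + 1) (by omega) (by omega)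
    rw [dprod_eq_mul (by omega), dprod_eq_mul (s := sw N) (by omega), Mono.perm_mul,
      Perm.mul_apply, h1, Mono.lab_mul, h2, h1]
    refine ⟨rfl, ?_⟩
    simp only [lkGen, ← ofAdd_add]
    congr 1
    rw [dprod_sw_apply (by omega), dprod_sw_apply (by omega)]
    have := x.2
    have := y.2
    grind

lemma lk_delta_pow {a : ℕ} (ha : a ≤ N + 1) {x y : Fin (N + 1)} (h : x ≠ y) :
    (lk N (braidδ (N + 1) ^ a)).lab (x, y) =
      Multiplicative.ofAdd (if N < (y : ℕ) + a then 1 else 0) := by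
  have hxy : (x : ℕ) ≠ y := fun e => h (Fin.ext e)
  have := x.2
  have := y.2
  induction a with
  | zero =>
    rw [if_neg (by omega)]
    simp [Mono.lab_one]
  | succ a ih =>
    rw [pow_succ', map_mul, Mono.lab_mul, ih (by omega), lk_perm, map_pow, braidPerm_delta]
    have e : lk N (braidδ (N + 1)) = dprod (lkGen N) 0 N := by
      rw [braidδ_eq, map_dprod (lk N) (fun k _ hk => braidLift_sg _ hk)]
    rw [e, (lab_dprod_lkGen (Nat.zero_le N) _ _).2, ← ofAdd_add]
    congr 1
    rw [cx_pow_apply (by omega), cx_pow_apply (by omega)]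
    grind

lemma lk_delta_zpow {x y : Fin (N + 1)} (h : x ≠ y) (m : ℤ) :
    (lk N ((braidδ (N + 1) ^ (N + 1)) ^ m)).lab (x, y) = Multiplicative.ofAdd m := by
  have h1 := lk_delta_pow (N := N) le_rfl h
  rw [if_pos (by omega)] at h1
  rw [map_zpow, Mono.lab_zpow, h1]
  · rw [← ofAdd_zsmul]; simp
  · rw [lk_perm, map_pow, braidPerm_delta, cx_pow_succ]; rfl

theorem exists_fixed_of_pow_eq (x : BraidGroup (N + 1)) {k : ℕ} (hk : 2 ≤ k) {m : ℤ}
    (hkm : IsCoprime (k : ℤ) m) (hx : x ^ k = braidδ (N + 1) ^ m) :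
    k ∣ N ∧ ((N + 1 : ℕ) : ℤ) ∣ m ∧ ∃ i, braidPerm N x i = i := by
  have hkN : k ∣ N := by
    have h := congrArg (fun y => Multiplicative.toAdd (expSum N y)) hx
    simp only [map_pow, map_zpow, expSum_delta, toAdd_pow, toAdd_zpow, toAdd_ofAdd] at h
    have : (k : ℤ) ∣ m * N := ⟨_, by simpa using h.symm⟩
    exact_mod_cast hkm.dvd_of_dvd_mul_left this
  obtain ⟨p, hp, hpk⟩ := Nat.exists_prime_and_dvd (show k ≠ 1 by omega)
  have := Fact.mk hp
  set b := braidPerm N x with hb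
  obtain ⟨a, r, hr, hor⟩ := Nat.exists_eq_pow_mul_and_not_dvd (orderOf_pos b).ne' p hp.ne_one
  have hfix : ∃ i, (b ^ r) i = i := by
    by_contra! hc
    have h1 : (b ^ r) ^ p ^ a = 1 := by
      rw [← pow_mul, mul_comm, ← hor, pow_orderOf_eq_one]
    have h2 := Perm.card_fixedPoints_modEq (p := p) (n := a) (f := ⇑(b ^ r))
      (((hom_coe_pow (fun g : Function.End (Fin (N + 1)) => g) rfl (fun g h => rfl) _ _).trans
        (Perm.coe_pow _ _).symm).trans (congrArg _ h1))
    have h3 : Fintype.card (Function.fixedPoints ⇑(b ^ r)) = 0 := by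
      rw [Fintype.card_eq_zero_iff]
      exact ⟨fun i => hc i.1 i.2⟩
    rw [h3, Fintype.card_fin] at h2
    have h4 : p ∣ N + 1 := (Nat.modEq_zero_iff_dvd.1 h2)
    have h5 : p ∣ 1 := (Nat.dvd_add_right (hpk.trans hkN)).1 h4
    exact hp.one_lt.ne' (Nat.dvd_one.1 h5)
  obtain ⟨i, hi⟩ := hfix
  have hxi : b i = i := by
    by_contra hne
    have h1 : (lk N (x ^ r)).perm (i, b i) = (i, b i) := by
      rw [lk_perm, map_pow, ← hb, hi]
      show (i, (b ^ r * b) i) = _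
      rw [← pow_succ, pow_succ', Perm.mul_apply, hi]
    have h2 : (x ^ r) ^ (k * (N + 1)) = (braidδ (N + 1) ^ (N + 1)) ^ (m * r) := by
      rw [← pow_mul, ← zpow_natCast x, ← zpow_natCast _ (N + 1), ← zpow_mul]
      have : ((r * (k * (N + 1)) : ℕ) : ℤ) = k * (r * (N + 1) : ℕ) := by push_cast; ring
      rw [this, zpow_mul, zpow_natCast x k, hx, ← zpow_mul]
      congr 1
      push_cast; ring
    have h3 := lk_delta_zpow (Ne.symm hne) (m * r)
    rw [← h2, map_pow, Mono.lab_pow h1] at h3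
    have h4 := congrArg Multiplicative.toAdd h3
    simp only [toAdd_pow, toAdd_ofAdd, nsmul_eq_mul] at h4
    have h5 : (p : ℤ) ∣ m * r := by
      rw [← h4]
      push_cast
      exact Dvd.dvd.mul_right (Dvd.dvd.mul_right (Int.natCast_dvd_natCast.2 hpk) _) _
    rcases (Nat.prime_iff_prime_int.1 hp).dvd_or_dvd h5 with h | h
    · have := hkm.isUnit_of_dvd' (Int.natCast_dvd_natCast.2 hpk) h
      exact (Nat.prime_iff_prime_int.1 hp).not_isUnit this
    · exact hr (Int.natCast_dvd_natCast.1 h)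
  refine ⟨hkN, ?_, i, hxi⟩
  apply dvd_of_cx_zpow (x := i)
  rw [← braidPerm_delta, ← map_zpow, ← hx, map_pow]
  exact Function.IsFixedPt.perm_pow hxi k

end BraidDual

namespace FreeGroup

variable {ι : Type*}

/-- The product `f · τ(f) · τ²(f) ⋯ τ^{k-1}(f)`. -/
def twistPow (τ : ι → ι) (f : FreeGroup ι) : ℕ → FreeGroup ι
  | 0 => 1
  | k + 1 => f * FreeGroup.map τ (twistPow τ f k)

lemma twistPow_conj (τ : Equiv.Perm ι) (a f : FreeGroup ι) (k : ℕ) :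
    twistPow τ (a * f * (FreeGroup.map τ a)⁻¹) k =
      a * twistPow τ f k * (FreeGroup.map (τ ^ k) a)⁻¹ := by
  induction k with
  | zero =>
    have : FreeGroup.map (⇑(τ ^ 0)) a = a := FreeGroup.map.id a
    rw [this]
    simp [twistPow]
  | succ k ih =>
    have : FreeGroup.map ⇑(τ ^ (k + 1)) a = FreeGroup.map τ (FreeGroup.map ⇑(τ ^ k) a) := by
      rw [FreeGroup.map.comp, pow_succ']; rfl
    rw [twistPow, ih, twistPow, this]
    simp only [_root_.map_mul, _root_.map_inv, mul_assoc, inv_mul_cancel_left]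

/-- The word `w · τ(w) ⋯ τ^{k-1}(w)`. -/
def twistWord (τ : ι → ι) (w : List (ι × Bool)) : ℕ → List (ι × Bool)
  | 0 => []
  | k + 1 => w ++ (twistWord τ w k).map fun x => (τ x.1, x.2)

lemma mk_twistWord (τ : ι → ι) (w : List (ι × Bool)) (k : ℕ) :
    FreeGroup.mk (twistWord τ w k) = twistPow τ (FreeGroup.mk w) k := by
  induction k with
  | zero => rfl
  | succ k ih => rw [twistWord, twistPow, ← ih, FreeGroup.map.mk, FreeGroup.mul_mk]

lemma isReduced_twistWord (τ : Equiv.Perm ι) {w : List (ι × Bool)} (hw : IsReduced w)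
    (h : ∀ x ∈ w.getLast?, ∀ y ∈ w.head?, x.1 = τ y.1 → x.2 = y.2) (hne : w ≠ []) (k : ℕ) :
    IsReduced (twistWord τ w k) := by
  induction k with
  | zero => exact List.isChain_nil
  | succ k ih =>
    refine List.isChain_append.2 ⟨hw, ?_, ?_⟩
    · refine (List.isChain_map _).2 (List.IsChain.imp ?_ ih)
      intro a b hab e
      exact hab (τ.injective e)
    · intro x hx y hy
      cases k with
      | zero => simp [twistWord] at hy
      | succ k =>
        rw [List.head?_map, twistWord, List.head?_append_of_ne_nil _ hne] at hy
        obtain ⟨z, hz, rfl⟩ := Option.mem_map.1 hy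
        exact h x hx z hz

/-- A Hilbert 90 statement for a permutation of the basis of a free group. -/
theorem exists_eq_mul_inv_of_twistPow (τ : Equiv.Perm ι) {k : ℕ} (hk : 0 < k) (hτ : τ ^ k = 1)
    (f : FreeGroup ι) (hf : twistPow τ f k = 1) : ∃ h, f = h * (FreeGroup.map τ h)⁻¹ := by
  classical
  induction hl : f.norm using Nat.strong_induction_on generalizing f with
  | _ n ih =>
  subst hl
  by_cases hne : f.toWord = []
  · exact ⟨1, by simpa [FreeGroup.toWord_eq_nil_iff] using hne⟩
  by_cases hj : ∀ x ∈ f.toWord.getLast?, ∀ y ∈ f.toWord.head?, x.1 = τ y.1 → x.2 = y.2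
  · exfalso
    have h1 := isReduced_twistWord τ FreeGroup.isReduced_toWord hj hne k
    have h2 := mk_twistWord τ f.toWord k
    rw [FreeGroup.mk_toWord, hf] at h2
    have h3 := congrArg FreeGroup.toWord h2
    rw [FreeGroup.toWord_mk, h1.reduce_eq, FreeGroup.toWord_one] at h3
    obtain ⟨k, rfl⟩ : ∃ l, k = l + 1 := ⟨k - 1, by omega⟩
    rw [twistWord, List.append_eq_nil_iff] at h3
    exact hne h3.1
  · push Not at hj
    obtain ⟨⟨l, e⟩, hx, ⟨c, d⟩, hy, h1, h2⟩ := hj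
    simp only at h1 h2
    subst h1
    obtain ⟨w1, hw1⟩ : ∃ w1, f.toWord = (c, d) :: w1 := by
      cases hw : f.toWord with
      | nil => exact absurd hw hne
      | cons a w1 =>
        rw [hw] at hy
        simp only [List.head?_cons, Option.mem_def, Option.some.injEq] at hy
        exact ⟨w1, by rw [hy]⟩
    rw [hw1] at hx
    have hw1n : w1 ≠ [] := by
      rintro rfl
      simp only [List.getLast?_singleton, Option.mem_def, Option.some.injEq, Prod.mk.injEq] at hx
      exact h2 hx.2.symm
    obtain ⟨w2, b, rfl⟩ : ∃ w2 b, w1 = w2 ++ [b] :=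
      ⟨_, _, (List.dropLast_append_getLast hw1n).symm⟩
    have hb : b = (τ c, e) := by
      rw [← List.cons_append, List.getLast?_concat] at hx
      simpa using hx
    subst hb
    have he : e = !d := by
      cases e <;> cases d <;> simp_all
    subst he
    set a : FreeGroup ι := FreeGroup.mk [(c, d)] with ha
    have hfa : f = a * FreeGroup.mk w2 * (FreeGroup.map τ a)⁻¹ := by
      rw [← FreeGroup.mk_toWord (x := f), hw1, ha, FreeGroup.map.mk, FreeGroup.inv_mk,
        FreeGroup.mul_mk, FreeGroup.mul_mk]
      rfl
    have hn : (FreeGroup.mk w2).norm < f.norm := by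
      refine lt_of_le_of_lt FreeGroup.norm_mk_le ?_
      rw [FreeGroup.norm, hw1]
      simp
    obtain ⟨h, hh⟩ := ih _ hn (FreeGroup.mk w2) (by
      rw [hfa, twistPow_conj, hτ] at hf
      have : FreeGroup.map (⇑(1 : Equiv.Perm ι)) a = a := FreeGroup.map.id a
      rw [this] at hf
      simpa [conj_eq_one_iff] using hf) rfl
    refine ⟨a * h, ?_⟩
    rw [hfa, hh, _root_.map_mul]
    group

/-- An element of a free group commuting with two distinct basis elements is trivial. -/
theorem eq_one_of_commute {a b : ι} (hab : a ≠ b) {f : FreeGroup ι}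
    (ha : Commute f (FreeGroup.of a)) (hb : Commute f (FreeGroup.of b)) : f = 1 := by
  classical
  by_contra hf
  have key : ∀ c, Commute f (FreeGroup.of c) → ∀ x ∈ f.toWord.head?, x.1 = c := by
    intro c hc x hx
    by_contra hxc
    cases hw : f.toWord with
    | nil => simp [hw] at hx
    | cons y w =>
      rw [hw] at hx
      obtain rfl : y = x := by simpa using hx
      have hcons : ∀ d, IsReduced ((c, d) :: y :: w) := by
        intro d
        refine List.isChain_cons_cons.2 ⟨fun e => absurd e.symm hxc, ?_⟩
        have := FreeGroup.isReduced_toWord (x := f)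
        rwa [hw] at this
      -- the word of `of c * f * (of c)⁻¹`, compared with that of `f`
      have e1 : ∀ d, (FreeGroup.mk [(c, d)] * f).toWord = (c, d) :: y :: w := by
        intro d
        conv_lhs => rw [← FreeGroup.mk_toWord (x := f), hw, FreeGroup.mul_mk, FreeGroup.toWord_mk]
        exact (hcons d).reduce_eq
      have e2 : ∀ d, FreeGroup.mk [(c, d)] * f = f * FreeGroup.mk [(c, d)] := by
        intro d
        cases d
        · exact hc.inv_right.eq.symm
        · exact hc.eq.symm
      have e3 : ∀ d, IsReduced ((y :: w) ++ [(c, d)]) → False := by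
        intro d hd
        have := e1 d
        rw [e2, ← FreeGroup.mk_toWord (x := f), hw, FreeGroup.mul_mk, FreeGroup.toWord_mk,
          hd.reduce_eq] at this
        simp only [List.cons_append, List.cons.injEq] at this
        exact hxc (congrArg Prod.fst this.1)
      have hyw : IsReduced (y :: w) := by
        have := FreeGroup.isReduced_toWord (x := f)
        rwa [hw] at this
      refine e3 ((y :: w).getLast (by simp)).2 (List.isChain_append.2 ⟨hyw, by simp, ?_⟩)
      intro p hp q hq _
      simp only [List.head?_cons, Option.mem_def, Option.some.injEq] at hq
      rw [List.getLast?_eq_some_getLast (by simp)] at hp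
      simp only [Option.mem_def, Option.some.injEq] at hp
      rw [← hq, ← hp]
  cases hw : f.toWord with
  | nil => exact hf (FreeGroup.toWord_eq_nil_iff.1 hw)
  | cons y w =>
    have h1 := key a ha y (by rw [hw]; simp)
    have h2 := key b hb y (by rw [hw]; simp)
    exact hab (h1.symm.trans h2)

end FreeGroup

namespace BraidDual

open Equiv Equiv.Perm IsBraid

variable {M : ℕ}

/-- The generators of the free group of rank `M + 1`, extended by `1`. -/
def xg (M q : ℕ) : FreeGroup (Fin (M + 1)) :=
  if h : q < M + 1 then FreeGroup.of ⟨q, h⟩ else 1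

lemma xg_val (q : Fin (M + 1)) : xg M q = FreeGroup.of q := by simp [xg, q.2]

lemma lift_xg {G : Type*} [Group G] (g : ℕ → G) {q : ℕ} (hq : q < M + 1) :
    FreeGroup.lift (fun q : Fin (M + 1) => g q) (xg M q) = g q := by
  simp [xg, hq]

lemma hom_ext_xg {G : Type*} [Group G] {a b : FreeGroup (Fin (M + 1)) →* G}
    (h : ∀ q < M + 1, a (xg M q) = b (xg M q)) : a = b :=
  FreeGroup.ext_hom _ _ fun q => by simpa only [xg_val] using h q q.2

/-- The action of a generator of the braid group on a free group. -/
def artFun (M i : ℕ) : FreeGroup (Fin (M + 1)) →* FreeGroup (Fin (M + 1)) :=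
  FreeGroup.lift fun q : Fin (M + 1) => (fun q => if q = i then (xg M i)⁻¹ * xg M (i + 1) * xg M i
    else if q = i + 1 then xg M i else xg M q) (q : ℕ)

/-- The action of the inverse of a generator of the braid group on a free group. -/
def artInv (M i : ℕ) : FreeGroup (Fin (M + 1)) →* FreeGroup (Fin (M + 1)) :=
  FreeGroup.lift fun q : Fin (M + 1) => (fun q => if q = i then xg M (i + 1) else if q = i + 1 then
    xg M (i + 1) * xg M i * (xg M (i + 1))⁻¹ else xg M q) (q : ℕ)

lemma xg_of_not_lt {q : ℕ} (hq : ¬q < M + 1) : xg M q = 1 := by rw [xg, dif_neg hq]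

lemma artFun_xg {i q : ℕ} (hq : q < M + 1) : artFun M i (xg M q) =
    if q = i then (xg M i)⁻¹ * xg M (i + 1) * xg M i
    else if q = i + 1 then xg M i else xg M q :=
  lift_xg (fun q => if q = i then (xg M i)⁻¹ * xg M (i + 1) * xg M i
    else if q = i + 1 then xg M i else xg M q) hq

lemma artInv_xg {i q : ℕ} (hq : q < M + 1) : artInv M i (xg M q) =
    if q = i then xg M (i + 1) else if q = i + 1 then
    xg M (i + 1) * xg M i * (xg M (i + 1))⁻¹ else xg M q :=
  lift_xg (fun q => if q = i then xg M (i + 1) else if q = i + 1 then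
    xg M (i + 1) * xg M i * (xg M (i + 1))⁻¹ else xg M q) hq

/-- The Artin automorphisms of a free group. -/
def art (M i : ℕ) : MulAut (FreeGroup (Fin (M + 1))) :=
  if hi : i < M then MonoidHom.toMulEquiv (artFun M i) (artInv M i)
    (by
      refine hom_ext_xg fun q hq => ?_
      rw [MonoidHom.comp_apply, artFun_xg hq, MonoidHom.id_apply]
      split_ifs with h1 h2
      · subst h1
        rw [map_mul, map_mul, map_inv, artInv_xg hq, artInv_xg (by omega)]
        simp; group
      · subst h2
        rw [artInv_xg (by omega)]; simp
      · rw [artInv_xg hq, if_neg h1, if_neg h2])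
    (by
      refine hom_ext_xg fun q hq => ?_
      rw [MonoidHom.comp_apply, artInv_xg hq, MonoidHom.id_apply]
      split_ifs with h1 h2
      · subst h1
        rw [artFun_xg (by omega)]; simp
      · subst h2
        rw [map_mul, map_mul, map_inv, artFun_xg (by omega), artFun_xg (by omega)]
        simp; group
      · rw [artFun_xg hq, if_neg h1, if_neg h2])
  else 1

lemma art_of {i : ℕ} (hi : i < M) (q : ℕ) : art M i (xg M q) =
    if q = i then (xg M i)⁻¹ * xg M (i + 1) * xg M i
    else if q = i + 1 then xg M i else xg M q := by
  rw [art, dif_pos hi]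
  by_cases hq : q < M + 1
  · exact artFun_xg hq
  · rw [if_neg (by omega), if_neg (by omega), xg_of_not_lt hq, map_one]

lemma art_left {i : ℕ} (hi : i < M) : art M i (xg M i) =
    (xg M i)⁻¹ * xg M (i + 1) * xg M i := by simp [art_of hi]

lemma art_right {i : ℕ} (hi : i < M) : art M i (xg M (i + 1)) = xg M i := by simp [art_of hi]

lemma art_of_ne {i q : ℕ} (hi : i < M) (h : q ≠ i) (h' : q ≠ i + 1) :
    art M i (xg M q) = xg M q := by simp [art_of hi, h, h']

lemma mulAut_ext {a b : MulAut (FreeGroup (Fin (M + 1)))}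
    (h : ∀ q, a (xg M q) = b (xg M q)) : a = b := by
  have : (a : FreeGroup (Fin (M + 1)) →* FreeGroup (Fin (M + 1))) = b :=
    hom_ext_xg fun q _ => h q
  ext x
  exact DFunLike.congr_fun this x

lemma isBraid_art (M : ℕ) : IsBraid M (art M) where
  braid i hi := by
    refine mulAut_ext fun q => ?_
    have hi' : i < M := by omega
    simp only [MulAut.mul_apply]
    by_cases h1 : q = i
    · subst h1
      simp only [art_left hi, art_left hi', art_right hi', map_mul, map_inv,
        art_of_ne hi (q := q) (by omega) (by omega),
        art_of_ne hi' (q := q + 1 + 1) (by omega) (by omega)]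
      group
    by_cases h2 : q = i + 1
    · subst h2
      simp only [art_left hi, art_right hi', art_right hi, map_mul, map_inv,
        art_of_ne hi (q := i) (by omega) (by omega),
        art_of_ne hi' (q := i + 1 + 1) (by omega) (by omega)]
      rw [art_left hi']
    by_cases h3 : q = i + 1 + 1
    · subst h3
      simp only [art_right hi, art_right hi', art_of_ne hi (q := i) (by omega) (by omega),
        art_of_ne hi' (q := i + 1 + 1) (by omega) (by omega)]
    rw [art_of_ne hi' h1 h2, art_of_ne hi h2 h3, art_of_ne hi' h1 h2, art_of_ne hi h2 h3]
  comm i j h hj := by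
    refine mulAut_ext fun q => ?_
    have hi : i < M := by omega
    simp only [MulAut.mul_apply]
    rw [art_of hi, art_of hj]
    split_ifs <;> first
      | omega
      | (try simp only [map_mul, map_inv]
         repeat first | rw [art_of hi] | rw [art_of hj]
         split_ifs <;> first | omega | rfl)

/-- The Artin action of the braid group. -/
def artHom (M : ℕ) : BraidGroup (M + 1) →* MulAut (FreeGroup (Fin (M + 1))) := braidLift (isBraid_art M)

lemma artHom_sg {i : ℕ} (hi : i < M) : artHom M (sg M i) = art M i := braidLift_sg _ hi

lemma dprod_art_of {k : ℕ} (hk : k ≤ M) (q : ℕ) : dprod (art M) k M (xg M q) =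
    if k ≤ q ∧ q < M then (xg M k)⁻¹ * xg M (q + 1) * xg M k
    else if q = M then xg M k else xg M q := by
  induction hd : M - k generalizing k with
  | zero =>
    obtain rfl : k = M := by omega
    rw [dprod_self, if_neg (by omega)]
    split_ifs with h
    · rw [h]; rfl
    · rfl
  | succ d ih =>
    rw [dprod_eq_mul (by omega), MulAut.mul_apply, ih (by omega) (by omega)]
    by_cases h1 : q < k
    · rw [if_neg (by omega), if_neg (by omega), if_neg (by omega), if_neg (by omega),
        art_of_ne (by omega) (by omega) (by omega)]
    by_cases h2 : q = k
    · subst h2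
      rw [if_neg (by omega), if_neg (by omega), if_pos (by omega), art_left (by omega)]
    by_cases h3 : q < M
    · rw [if_pos (by omega), if_pos (by omega), map_mul, map_mul, map_inv, art_right (by omega),
        art_of_ne (by omega) (by omega) (by omega)]
    by_cases h4 : q = M
    · rw [if_neg (by omega), if_pos h4, if_neg (by omega), if_pos h4, art_right (by omega)]
    · rw [if_neg (by omega), if_neg h4, if_neg (by omega), if_neg h4,
        art_of_ne (by omega) (by omega) (by omega)]

/-- The semidirect product of a free group by the braid group. -/
abbrev FreeBraid (M : ℕ) := FreeGroup (Fin (M + 1)) ⋊[artHom M] BraidGroup (M + 1)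

/-- The free generators of `FreeBraid M`. -/
abbrev fx (M p : ℕ) : FreeBraid M := SemidirectProduct.inl (xg M p)

/-- The braid generators of `FreeBraid M`. -/
abbrev fs (M i : ℕ) : FreeBraid M := SemidirectProduct.inr (sg M i)

lemma inr_mul_inl (b : BraidGroup (M + 1)) (f : FreeGroup (Fin (M + 1))) :
    (SemidirectProduct.inr b * SemidirectProduct.inl f : FreeBraid M) =
      SemidirectProduct.inl (artHom M b f) * SemidirectProduct.inr b := by
  rw [SemidirectProduct.inl_aut]; simp [mul_assoc]

lemma isBraid_fs (M : ℕ) : IsBraid M (fs M) where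
  braid i hi := by simp only [fs, ← map_mul, (isBraid_sg M).braid i hi]
  comm i j h hj := by simp only [fs, ← map_mul, (isBraid_sg M).comm i j h hj]

lemma fs_mul_fx_succ {i : ℕ} (hi : i < M) : fs M i * fx M (i + 1) = fx M i * fs M i := by
  rw [fs, inr_mul_inl, artHom_sg hi, art_right (by omega)]

lemma fx_succ_mul_fx {i : ℕ} (hi : i < M) :
    fs M i * (fx M (i + 1) * fx M i) = fx M (i + 1) * fx M i * fs M i := by
  rw [fs, ← map_mul, inr_mul_inl, artHom_sg hi, map_mul, art_right hi, art_left hi]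
  simp [mul_assoc]

lemma fs_mul_fx {i p : ℕ} (hi : i < M) (h : p ≠ i) (h' : p ≠ i + 1) :
    fs M i * fx M p = fx M p * fs M i := by
  rw [fs, inr_mul_inl, artHom_sg hi, art_of_ne hi h h']

/-- The cyclic element of `FreeBraid M`. -/
def cyc (M : ℕ) : FreeBraid M := fx M 0 * SemidirectProduct.inr (braidδ (M + 1))

/-- `E` acts on the free part by the permutation `t` of the basis. -/
def ActsBy (E : FreeBraid M) (t : Perm (Fin (M + 1))) : Prop :=
  ∀ f, E * SemidirectProduct.inl f = SemidirectProduct.inl (FreeGroup.map t f) * E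

lemma ActsBy.mul {E E' : FreeBraid M} {t t' : Perm (Fin (M + 1))} (h : ActsBy E t) (h' : ActsBy E' t') :
    ActsBy (E * E') (t * t') := fun f => by
  rw [mul_assoc, h', ← mul_assoc, h, mul_assoc, FreeGroup.map.comp]; rfl

lemma ActsBy.one : ActsBy (1 : FreeBraid M) 1 := fun f => by
  have : FreeGroup.map (⇑(1 : Equiv.Perm (Fin (M + 1)))) f = f := FreeGroup.map.id f
  rw [this]; simp

lemma ActsBy.inv {E : FreeBraid M} {t : Perm (Fin (M + 1))} (h : ActsBy E t) : ActsBy E⁻¹ t⁻¹ := fun f => by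
  have h1 := h (FreeGroup.map (⇑t⁻¹) f)
  have : FreeGroup.map t (FreeGroup.map (⇑t⁻¹) f) = f := by
    rw [FreeGroup.map.comp]
    have : ⇑t ∘ ⇑t⁻¹ = id := by ext x; simp
    rw [this, FreeGroup.map.id]
  rw [this] at h1
  rw [inv_mul_eq_iff_eq_mul, ← mul_assoc, h1, mul_inv_cancel_right]

lemma ActsBy.pow {E : FreeBraid M} {t : Perm (Fin (M + 1))} (h : ActsBy E t) (k : ℕ) :
    ActsBy (E ^ k) (t ^ k) := by
  induction k with
  | zero => simpa using ActsBy.one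
  | succ k ih => rw [pow_succ, pow_succ]; exact ih.mul h

lemma ActsBy.zpow {E : FreeBraid M} {t : Perm (Fin (M + 1))} (h : ActsBy E t) (k : ℤ) :
    ActsBy (E ^ k) (t ^ k) := by
  obtain ⟨k, rfl | rfl⟩ := k.eq_nat_or_neg
  · simpa using h.pow k
  · simpa using (h.pow k).inv

lemma actsBy_cyc : ActsBy (cyc M) (cx M) := by
  have : (MulAut.conj (xg M 0) * artHom M (braidδ (M + 1)) : MulAut (FreeGroup (Fin (M + 1)))) =
      FreeGroup.freeGroupCongr (cx M) := by
    refine mulAut_ext fun q => ?_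
    by_cases hq : q < M + 1
    · rw [braidδ_eq, map_dprod (artHom M) (fun k _ hk => artHom_sg hk), MulAut.mul_apply,
        dprod_art_of (Nat.zero_le M)]
      have : FreeGroup.freeGroupCongr (cx M) (xg M q) = xg M (if q = M then 0 else q + 1) := by
        have h := cx_apply (N := M) ⟨q, hq⟩
        have h1 : xg M q = FreeGroup.of ⟨q, hq⟩ := xg_val ⟨q, hq⟩
        rw [h1, FreeGroup.freeGroupCongr_apply, FreeGroup.map.of, ← xg_val, h]
      rw [this]
      split_ifs <;> first | omega | skip
      · simp; group
      · simp
    · rw [xg_of_not_lt hq, map_one, map_one]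
  intro f
  have := DFunLike.congr_fun this f
  rw [MulAut.mul_apply, MulAut.conj_apply, FreeGroup.freeGroupCongr_apply] at this
  rw [← this, cyc, mul_assoc, inr_mul_inl]
  simp [mul_assoc]

end BraidDual

namespace BraidDual

open Equiv Equiv.Perm IsBraid

variable {M : ℕ}

/-- The label of the strand starting at `p` under the generator `σ_j`. -/
def lbl (M j p : ℕ) : FreeBraid M :=
  if j + 1 < p then fs M j else if j + 1 = p then 1 else if j = p then fx M p else fs M (j - 1)

/-- The monomial transformation of a generator. -/
def mmGen (M j : ℕ) : Mono (Fin (M + 2)) (FreeBraid M) where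
  perm := sw (M + 1) j
  lab p := lbl M j p

lemma isBraid_mmGen (M : ℕ) : IsBraid (M + 1) (mmGen M) where
  braid i hi := by
    refine Mono.ext ((isBraid_sw (M + 1)).braid i hi) (funext fun x => ?_)
    simp only [Mono.lab_mul, mmGen]
    repeat rw [sw_apply (by omega)]
    have hx := x.2
    generalize (x : ℕ) = p at hx
    simp only [lbl]
    rcases lt_trichotomy p i with h | rfl | h
    · simp (disch := omega) only [if_pos, if_neg]
      obtain ⟨i, rfl⟩ : ∃ l, i = l + 1 := ⟨i - 1, by omega⟩
      exact (isBraid_fs M).braid i (by omega)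
    · simp (disch := omega) only [if_true, if_pos, if_neg]
      have := fx_succ_mul_fx (M := M) (i := p) (by omega)
      simpa only [mul_assoc, Nat.add_sub_cancel] using this
    rcases lt_trichotomy p (i + 1) with h | rfl | h
    · omega
    · simp (disch := omega) only [if_true, if_pos, if_neg]
      have := fs_mul_fx_succ (M := M) (i := i) (by omega)
      simpa only [mul_one, one_mul, Nat.add_sub_cancel] using this.symm
    rcases lt_trichotomy p (i + 2) with h | rfl | h
    · omega
    · simp (disch := omega) only [if_true, if_pos, if_neg]
      simp only [mul_one, one_mul, Nat.add_sub_cancel]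
    · simp (disch := omega) only [if_pos, if_neg]
      exact (isBraid_fs M).braid i (by omega)
  comm i j hij hj := by
    refine Mono.ext ((isBraid_sw (M + 1)).comm i j hij hj) (funext fun x => ?_)
    simp only [Mono.lab_mul, mmGen]
    repeat rw [sw_apply (by omega)]
    have hx := x.2
    generalize (x : ℕ) = p at hx
    simp only [lbl]
    have hc : ∀ k l, k + 2 ≤ l → l < M → fs M k * fs M l = fs M l * fs M k :=
      fun k l h h' => (isBraid_fs M).comm k l h h'
    rcases lt_trichotomy p i with h | rfl | h
    · simp (disch := omega) only [if_pos, if_neg]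
      exact hc _ _ (by omega) (by omega)
    · simp (disch := omega) only [if_true, if_pos, if_neg]
      exact (fs_mul_fx (by omega) (by omega) (by omega)).symm
    rcases lt_trichotomy p (i + 1) with h | rfl | h
    · omega
    · simp (disch := omega) only [if_true, if_pos, if_neg]
      rw [mul_one, one_mul]
    rcases lt_trichotomy p j with h | rfl | h
    · simp (disch := omega) only [if_pos, if_neg]
      exact hc _ _ (by omega) (by omega)
    · simp (disch := omega) only [if_true, if_pos, if_neg]
      exact fs_mul_fx (by omega) (by omega) (by omega)
    rcases lt_trichotomy p (j + 1) with h | rfl | h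
    · omega
    · simp (disch := omega) only [if_true, if_pos, if_neg]
      rw [mul_one, one_mul]
    · simp (disch := omega) only [if_pos, if_neg]
      exact hc _ _ (by omega) (by omega)

/-- The monomial representation of the braid group. -/
def mm (M : ℕ) : BraidGroup (M + 2) →* Mono (Fin (M + 2)) (FreeBraid M) :=
  braidLift (isBraid_mmGen M)

lemma mm_sg {j : ℕ} (hj : j < M + 1) : mm M (sg (M + 1) j) = mmGen M j := braidLift_sg _ hj

lemma mm_perm (g : BraidGroup (M + 2)) : (mm M g).perm = braidPerm (M + 1) g := by
  have : Mono.permHom.comp (mm M) = braidPerm (M + 1) := braid_hom_ext fun i hi => by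
    rw [MonoidHom.comp_apply, mm_sg hi]
    exact (braidLift_sg (isBraid_sw (M + 1)) hi).symm
  exact DFunLike.congr_fun this g

/-- The braid moving the last strand to position `p`. -/
def rr (M p : ℕ) : BraidGroup (M + 2) := dprod (sg (M + 1)) p (M + 1)

/-- The pure braid generators. -/
def yy (M p : ℕ) : BraidGroup (M + 2) := (rr M (p + 1))⁻¹ * sg (M + 1) p ^ 2 * rr M (p + 1)

/-- The inclusion of the braid group on the first strands. -/
def inc (M : ℕ) : BraidGroup (M + 1) →* BraidGroup (M + 2) :=
  braidLift (s := sg (M + 1)) ⟨fun i hi => (isBraid_sg (M + 1)).braid i (by omega),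
    fun i j h hj => (isBraid_sg (M + 1)).comm i j h (by omega)⟩

lemma inc_sg {i : ℕ} (hi : i < M) : inc M (sg M i) = sg (M + 1) i := braidLift_sg _ hi

lemma rr_eq_mul {p : ℕ} (hp : p < M + 1) : rr M p = sg (M + 1) p * rr M (p + 1) :=
  dprod_eq_mul hp

lemma sg_mul_rr_of_lt {j p : ℕ} (h : j + 1 < p) : sg (M + 1) j * rr M p = rr M p * sg (M + 1) j :=
  (commute_dprod fun k hk hk' =>
    (isBraid_sg (M + 1)).commute (by omega) (by omega) (Or.inl (by omega))).eq

lemma sg_mul_rr_of_gt {j p : ℕ} (h : p < j) (hj : j < M + 1) :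
    sg (M + 1) j * rr M p = rr M p * sg (M + 1) (j - 1) := by
  obtain ⟨j, rfl⟩ : ∃ l, j = l + 1 := ⟨j - 1, by omega⟩
  exact ((isBraid_sg (M + 1)).dprod_mul_gen le_rfl (by omega) (by omega)).symm

lemma mul_sq_of_braid {G : Type*} [Group G] {a b : G} (h : a * b * a = b * a * b) :
    a * b ^ 2 = b⁻¹ * a ^ 2 * b * a := by
  have : b * (a * b ^ 2) = a ^ 2 * b * a := by
    calc _ = (b * a * b) * b := by simp only [pow_two, mul_assoc]
      _ = (a * b * a) * b := by rw [h]
      _ = a * (b * a * b) := by simp only [mul_assoc]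
      _ = a * (a * b * a) := by rw [h]
      _ = _ := by simp only [pow_two, mul_assoc]
  rw [mul_assoc, mul_assoc, eq_inv_mul_iff_mul_eq, this, mul_assoc]

lemma mul_of_braid {G : Type*} [Group G] {a b : G} (h : a * b * a = b * a * b) :
    a * (b * a ^ 2 * b) = b * a ^ 2 * b * a := by
  calc _ = (a * b * a) * (a * b) := by simp only [pow_two, mul_assoc]
    _ = b * a * (b * a * b) := by rw [h]; simp only [mul_assoc]
    _ = b * a * (a * b * a) := by rw [h]
    _ = _ := by simp only [pow_two, mul_assoc]

lemma sg_mul_yy {p : ℕ} (hp : p < M) :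
    sg (M + 1) p * yy M (p + 1) = yy M p * sg (M + 1) p := by
  have h1 : rr M (p + 1) = sg (M + 1) (p + 1) * rr M (p + 2) := rr_eq_mul (by omega)
  have h2 : Commute (sg (M + 1) p) (rr M (p + 2)) := sg_mul_rr_of_lt (by omega)
  have h3 := (isBraid_sg (M + 1)).braid p (by omega)
  have h4 := h2.inv_right.eq
  rw [yy, yy, h1]
  generalize rr M (p + 2) = r at *
  generalize sg (M + 1) p = a at *
  generalize sg (M + 1) (p + 1) = b at *
  have h5 := mul_sq_of_braid h3
  calc a * (r⁻¹ * b ^ 2 * r) = (a * r⁻¹) * b ^ 2 * r := by group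
    _ = r⁻¹ * (a * b ^ 2) * r := by rw [h4]; group
    _ = r⁻¹ * b⁻¹ * a ^ 2 * b * (a * r) := by rw [h5]; group
    _ = _ := by rw [h2.eq]; group

lemma commute_sg_yy_mul_yy {p : ℕ} (hp : p < M) :
    Commute (sg (M + 1) p) (yy M (p + 1) * yy M p) := by
  have h1 : rr M (p + 1) = sg (M + 1) (p + 1) * rr M (p + 2) := rr_eq_mul (by omega)
  have h2 : Commute (sg (M + 1) p) (rr M (p + 2)) := sg_mul_rr_of_lt (by omega)
  have h3 := (isBraid_sg (M + 1)).braid p (by omega)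
  rw [yy, yy, h1]
  generalize rr M (p + 2) = r at *
  generalize sg (M + 1) p = a at *
  generalize sg (M + 1) (p + 1) = b at *
  have h5 := mul_of_braid h3
  have h6 : r⁻¹ * b ^ 2 * r * ((b * r)⁻¹ * a ^ 2 * (b * r)) = r⁻¹ * (b * a ^ 2 * b) * r := by group
  rw [h6]
  exact (h2.inv_right.mul_right h5).mul_right h2

lemma commute_sg_yy {i p : ℕ} (hi : i < M) (h : p ≠ i) (h' : p ≠ i + 1) (hp : p < M + 1) :
    Commute (sg (M + 1) i) (yy M p) := by
  rcases lt_or_ge p i with h | h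
  · have h1 : rr M (p + 1) * sg (M + 1) i = sg (M + 1) (i + 1) * rr M (p + 1) :=
      (isBraid_sg (M + 1)).dprod_mul_gen le_rfl (by omega) (by omega)
    have h2 := ((isBraid_sg (M + 1)).commute (i := i + 1) (j := p) (by omega) (by omega)
      (by omega)).pow_right 2
    have h3 : sg (M + 1) i = (rr M (p + 1))⁻¹ * sg (M + 1) (i + 1) * rr M (p + 1) := by
      rw [mul_assoc, ← h1, inv_mul_cancel_left]
    rw [h3, yy]
    have := Commute.conj_iff (rr M (p + 1))⁻¹ |>.2 h2
    simpa only [inv_inv] using this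
  · have h2 : Commute (sg (M + 1) i) (rr M (p + 1)) := sg_mul_rr_of_lt (by omega)
    exact (h2.inv_right.mul_right (((isBraid_sg (M + 1)).commute (by omega) (by omega)
      (by omega)).pow_right 2)).mul_right h2

/-- The evaluation of the free group. -/
def evF (M : ℕ) : FreeGroup (Fin (M + 1)) →* BraidGroup (M + 2) :=
  FreeGroup.lift fun q : Fin (M + 1) => yy M q

lemma evF_xg {q : ℕ} (hq : q < M + 1) : evF M (xg M q) = yy M q := lift_xg (yy M) hq

lemma evF_art {i : ℕ} (hi : i < M) (f : FreeGroup (Fin (M + 1))) :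
    evF M (art M i f) = sg (M + 1) i * evF M f * (sg (M + 1) i)⁻¹ := by
  have : (evF M).comp (art M i).toMonoidHom =
      (MulAut.conj (sg (M + 1) i)).toMonoidHom.comp (evF M) := by
    refine hom_ext_xg fun q hq => ?_
    show evF M (art M i (xg M q)) = sg (M + 1) i * evF M (xg M q) * (sg (M + 1) i)⁻¹
    rw [art_of hi, evF_xg hq]
    split_ifs with h1 h2
    · subst h1
      have h1 := (commute_sg_yy_mul_yy hi).eq
      rw [← mul_assoc, sg_mul_yy hi] at h1
      rw [map_mul, map_mul, map_inv, evF_xg hq, evF_xg (by omega), eq_mul_inv_iff_mul_eq,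
        mul_assoc, mul_assoc, inv_mul_eq_iff_eq_mul, ← mul_assoc, ← h1, mul_assoc]
    · subst h2
      rw [sg_mul_yy hi, evF_xg (by omega), mul_inv_cancel_right]
    · rw [(commute_sg_yy hi h1 h2 hq).eq, evF_xg hq, mul_inv_cancel_right]
  exact DFunLike.congr_fun this f

lemma evF_artHom (b : BraidGroup (M + 1)) : ∀ f : FreeGroup (Fin (M + 1)),
    evF M (artHom M b f) = inc M b * evF M f * (inc M b)⁻¹ := by
  induction b using braid_induction with
  | h1 => simp
  | hm i hi x ih =>
    intro f
    rw [map_mul, MulAut.mul_apply, artHom_sg hi, evF_art hi, ih, map_mul, inc_sg hi]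
    group
  | hi i hi x ih =>
    intro f
    have h := evF_art hi (artHom M ((sg M i)⁻¹ * x) f)
    rw [← artHom_sg hi, ← MulAut.mul_apply, ← map_mul, mul_inv_cancel_left, ih] at h
    rw [map_mul (inc M), map_inv (inc M), inc_sg hi]
    have h2 : evF M ((artHom M ((sg M i)⁻¹ * x)) f) = (sg (M + 1) i)⁻¹ *
      (inc M x * (evF M) f * ((inc M) x)⁻¹) * sg (M + 1) i := by rw [h]; group
    rw [h2]; group

/-- The evaluation of the semidirect product in the braid group. -/
def evb (M : ℕ) : FreeBraid M →* BraidGroup (M + 2) :=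
  SemidirectProduct.lift (evF M) (inc M) fun b => MonoidHom.ext fun f => evF_artHom b f

lemma evb_fx {q : ℕ} (hq : q < M + 1) : evb M (fx M q) = yy M q := by
  rw [evb, fx, SemidirectProduct.lift_inl, evF_xg hq]

lemma evb_inr (b : BraidGroup (M + 1)) : evb M (SemidirectProduct.inr b) = inc M b :=
  SemidirectProduct.lift_inr _ _ _ _

lemma sg_mul_rr {j : ℕ} (hj : j < M + 1) (p : Fin (M + 2)) :
    sg (M + 1) j * rr M p = rr M (sw (M + 1) j p) * evb M (lbl M j p) := by
  rw [sw_apply hj]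
  have hp := p.2
  generalize (p : ℕ) = p at hp
  rw [lbl]
  rcases lt_trichotomy p j with h | rfl | h
  · simp (disch := omega) only [if_neg]
    rw [evb_inr, inc_sg (by omega), sg_mul_rr_of_gt h hj]
  · simp (disch := omega) only [if_true, if_neg]
    rw [evb_fx hj, yy, rr_eq_mul hj, pow_two]
    group
  rcases lt_trichotomy p (j + 1) with h | rfl | h
  · omega
  · simp (disch := omega) only [if_true, if_neg]
    rw [map_one, mul_one, ← rr_eq_mul hj]
  · simp (disch := omega) only [if_pos, if_neg]
    rw [evb_inr, inc_sg (by omega), sg_mul_rr_of_lt h]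

lemma mul_rr (g : BraidGroup (M + 2)) : ∀ p : Fin (M + 2),
    g * rr M p = rr M (braidPerm (M + 1) g p) * evb M ((mm M g).lab p) := by
  have hb : ∀ j < M + 1, ∀ p : Fin (M + 2), sg (M + 1) j * rr M p =
      rr M (braidPerm (M + 1) (sg (M + 1) j) p) * evb M ((mm M (sg (M + 1) j)).lab p) := by
    intro j hj p
    rw [mm_sg hj, braidPerm, braidLift_sg _ hj]
    exact sg_mul_rr hj p
  induction g using braid_induction with
  | h1 => intro p; simp [Mono.lab_one]
  | hm i hi x ih =>
    intro p
    rw [mul_assoc, ih, ← mul_assoc, hb i hi, map_mul, map_mul, Mono.lab_mul, Perm.mul_apply,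
      map_mul, mul_assoc, mm_perm]
  | hi i hi x ih =>
    intro p
    have h := ih p
    obtain ⟨y, rfl⟩ : ∃ y, x = sg (M + 1) i * y := ⟨(sg (M + 1) i)⁻¹ * x, by group⟩
    rw [inv_mul_cancel_left]
    rw [map_mul, map_mul, Mono.lab_mul, Perm.mul_apply, map_mul, ← mul_assoc (rr M _), mm_perm,
      ← hb i hi, mul_assoc, mul_assoc] at h
    exact mul_left_cancel h

end BraidDual

namespace BraidDual

open Equiv Equiv.Perm IsBraid

section FullTwist

variable {N : ℕ}

/-- The second periodic braid `σ_0 δ`. -/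
def gam (N : ℕ) : BraidGroup (N + 1) := sg N 0 * braidδ (N + 1)

lemma delta_mul_sg {j : ℕ} (hj : j + 1 < N) :
    braidδ (N + 1) * sg N j = sg N (j + 1) * braidδ (N + 1) := by
  rw [braidδ_eq]
  exact (isBraid_sg N).dprod_mul_gen le_rfl (Nat.zero_le j) hj

lemma delta_pow_mul_sg {j : ℕ} (hj : j < N) :
    braidδ (N + 1) ^ j * sg N 0 = sg N j * braidδ (N + 1) ^ j := by
  induction j with
  | zero => simp
  | succ j ih =>
    rw [pow_succ', mul_assoc, ih (by omega), ← mul_assoc, delta_mul_sg hj, mul_assoc]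

lemma gam_pow {k : ℕ} (hk : k ≤ N) : gam N ^ k = dprod (sg N) 0 k * braidδ (N + 1) ^ k := by
  induction k with
  | zero => simp
  | succ k ih =>
    rw [pow_succ, ih (by omega), gam, mul_assoc, ← mul_assoc (_ ^ k), delta_pow_mul_sg hk,
      dprod_succ (Nat.zero_le k), pow_succ]
    simp only [mul_assoc]

lemma gam_pow_eq : gam N ^ N = braidδ (N + 1) ^ (N + 1) := by
  rw [gam_pow le_rfl, ← braidδ_eq, pow_succ']

lemma delta_pow_mem_center : braidδ (N + 1) ^ (N + 1) ∈ Subgroup.center (BraidGroup (N + 1)) := by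
  rw [Subgroup.mem_center_iff]
  have h1 : Commute (braidδ (N + 1)) (braidδ (N + 1) ^ (N + 1)) := Commute.self_pow _ _
  have h2 : Commute (sg N 0) (braidδ (N + 1) ^ (N + 1)) := by
    have h3 : Commute (gam N) (braidδ (N + 1) ^ (N + 1)) := by
      rw [← gam_pow_eq]; exact Commute.self_pow _ _
    have h4 : sg N 0 = gam N * (braidδ (N + 1))⁻¹ := by rw [gam, mul_inv_cancel_right]
    rw [h4]
    exact h3.mul_left h1.inv_left
  have h5 : ∀ i < N, Commute (sg N i) (braidδ (N + 1) ^ (N + 1)) := by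
    intro i hi
    have h6 : sg N i = braidδ (N + 1) ^ i * sg N 0 * (braidδ (N + 1) ^ i)⁻¹ := by
      rw [delta_pow_mul_sg hi, mul_inv_cancel_right]
    rw [h6]
    exact ((h1.pow_left i).mul_left h2).mul_left (h1.pow_left i).inv_left
  intro g
  show Commute g _
  induction g using braid_induction with
  | h1 => exact Commute.one_left _
  | hm i hi x ih => exact (h5 i hi).mul_left ih
  | hi i hi x ih => exact (h5 i hi).inv_left.mul_left ih

lemma braidPerm_delta_pow : braidPerm N (braidδ (N + 1) ^ (N + 1)) = 1 := by
  rw [map_pow, braidPerm_delta, cx_pow_succ]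

end FullTwist

variable {M : ℕ}

lemma braidPerm_sg {N i : ℕ} (hi : i < N) : braidPerm N (sg N i) = sw N i := braidLift_sg _ hi

lemma mm_mul_lab (g h : BraidGroup (M + 2)) (p : Fin (M + 2)) :
    (mm M (g * h)).lab p = (mm M g).lab (braidPerm (M + 1) h p) * (mm M h).lab p := by
  rw [map_mul, Mono.lab_mul, mm_perm]

lemma mm_sg_lab {j : ℕ} (hj : j < M + 1) (p : Fin (M + 2)) :
    (mm M (sg (M + 1) j)).lab p = lbl M j p := by rw [mm_sg hj]; rfl

lemma mm_inv_lab {g : BraidGroup (M + 2)} {p : Fin (M + 2)} (h : braidPerm (M + 1) g p = p) :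
    (mm M g⁻¹).lab p = ((mm M g).lab p)⁻¹ := by
  rw [map_inv, Mono.lab_inv (by rw [mm_perm, h])]

lemma mm_pow_lab {g : BraidGroup (M + 2)} {p : Fin (M + 2)} (h : braidPerm (M + 1) g p = p)
    (k : ℕ) : (mm M (g ^ k)).lab p = (mm M g).lab p ^ k := by
  rw [map_pow, Mono.lab_pow (by rw [mm_perm, h])]

lemma mm_zpow_lab {g : BraidGroup (M + 2)} {p : Fin (M + 2)} (h : braidPerm (M + 1) g p = p)
    (k : ℤ) : (mm M (g ^ k)).lab p = (mm M g).lab p ^ k := by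
  rw [map_zpow, Mono.lab_zpow (by rw [mm_perm, h])]

/-- The label of the last strand. -/
def labLast (g : BraidGroup (M + 2)) : FreeBraid M := (mm M g).lab (Fin.last (M + 1))

lemma mm_inc (b : BraidGroup (M + 1)) :
    braidPerm (M + 1) (inc M b) (Fin.last (M + 1)) = Fin.last (M + 1) ∧
      labLast (inc M b) = SemidirectProduct.inr b := by
  have hg : ∀ i < M, sw (M + 1) i (Fin.last (M + 1)) = Fin.last (M + 1) := by
    intro i hi
    ext
    rw [sw_apply (by omega), Fin.val_last, if_neg (by omega), if_neg (by omega)]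
  have hl : ∀ i < M, lbl M i (Fin.last (M + 1) : Fin (M + 2)) = fs M i := by
    intro i hi
    rw [lbl, Fin.val_last, if_pos (by omega)]
  induction b using braid_induction with
  | h1 => simp [labLast, Mono.lab_one]
  | hm i hi x ih =>
    constructor
    · rw [map_mul, map_mul, Perm.mul_apply, ih.1, inc_sg hi, braidPerm_sg (by omega), hg i hi]
    · rw [map_mul, labLast, mm_mul_lab, ih.1, ← labLast.eq_1 (inc M x), ih.2, inc_sg hi,
        mm_sg_lab (by omega), hl i hi, map_mul]
  | hi i hi x ih =>
    have h2 : braidPerm (M + 1) (sg (M + 1) i) (Fin.last (M + 1)) = Fin.last (M + 1) := by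
      rw [braidPerm_sg (by omega), hg i hi]
    constructor
    · rw [map_mul, map_mul, Perm.mul_apply, ih.1, map_inv, map_inv, inc_sg hi]
      exact Perm.inv_eq_iff_eq.2 h2.symm
    · rw [map_mul, labLast, mm_mul_lab, ih.1, ← labLast.eq_1 (inc M x), ih.2, map_inv, inc_sg hi,
        mm_inv_lab h2, mm_sg_lab (by omega), hl i hi, map_mul, map_inv]

lemma mm_rr {p : ℕ} (hp : p ≤ M + 1) :
    (braidPerm (M + 1) (rr M p) (Fin.last (M + 1)) : ℕ) = p ∧ labLast (rr M p) = 1 := by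
  induction hd : M + 1 - p generalizing p with
  | zero =>
    obtain rfl : p = M + 1 := by omega
    simp [rr, labLast, Mono.lab_one]
  | succ d ih =>
    obtain ⟨h1, h2⟩ := ih (p := p + 1) (by omega) (by omega)
    rw [rr_eq_mul (by omega)]
    constructor
    · rw [map_mul, Perm.mul_apply, braidPerm_sg (by omega), sw_apply (by omega), h1,
        if_neg (by omega), if_pos rfl]
    · rw [labLast, mm_mul_lab, ← labLast.eq_1 (rr M _), h2, mm_sg_lab (by omega), h1, lbl,
        if_neg (by omega), if_pos rfl, mul_one]

lemma dprod_one_zero {l : ℕ} (hl : l ≤ M) :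
    braidPerm (M + 1) (dprod (sg (M + 1)) 1 (l + 1)) 0 = 0 ∧
      (mm M (dprod (sg (M + 1)) 1 (l + 1))).lab 0 = dprod (fs M) 0 l := by
  induction l with
  | zero => simp [Mono.lab_one]
  | succ l ih =>
    obtain ⟨h1, h2⟩ := ih (by omega)
    have h3 : sw (M + 1) (l + 1) 0 = 0 := by
      ext
      rw [sw_apply (by omega), Fin.val_zero, if_neg (by omega), if_neg (by omega)]
    rw [dprod_succ (by omega)]
    constructor
    · rw [map_mul, Perm.mul_apply, braidPerm_sg (by omega), h3, h1]
    · rw [mm_mul_lab, braidPerm_sg (by omega), h3, h2, mm_sg_lab (by omega), lbl, Fin.val_zero,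
        if_neg (by omega), if_neg (by omega), if_neg (by omega),
        dprod_succ (Nat.zero_le l)]
      rfl

lemma gam_zero : braidPerm (M + 1) (gam (M + 1)) 0 = 0 ∧ (mm M (gam (M + 1))).lab 0 = cyc M := by
  obtain ⟨h1, h2⟩ := dprod_one_zero (M := M) le_rfl
  have e : gam (M + 1) = sg (M + 1) 0 * (sg (M + 1) 0 * dprod (sg (M + 1)) 1 (M + 1)) := by
    rw [gam, braidδ_eq, dprod_eq_mul (by omega)]
  have h3 : (sw (M + 1) 0 0 : ℕ) = 1 := by
    rw [sw_apply (by omega), Fin.val_zero, if_pos rfl]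
  rw [e]
  constructor
  · rw [map_mul, map_mul, Perm.mul_apply, Perm.mul_apply, h1, braidPerm_sg (by omega)]
    ext
    rw [sw_apply (by omega), h3, if_neg (by omega), if_pos rfl, Fin.val_zero]
  · rw [mm_mul_lab, map_mul, Perm.mul_apply, h1, mm_mul_lab, h1, h2, mm_sg_lab (by omega),
      mm_sg_lab (by omega), braidPerm_sg (by omega), h3, lbl, lbl, Fin.val_zero,
      if_neg (by omega), if_pos rfl, if_neg (by omega), if_neg (by omega), if_pos rfl, one_mul,
      cyc, braidδ_eq, map_dprod SemidirectProduct.inr (t := fs M) (fun _ _ _ => rfl)]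

lemma evb_cyc : IsConj (evb M (cyc M)) (gam (M + 1)) := by
  have h := mul_rr (gam (M + 1)) 0
  rw [gam_zero.1, gam_zero.2] at h
  rw [isConj_iff]
  exact ⟨rr M (0 : Fin (M + 2)), by rw [← h, mul_inv_cancel_right]⟩

lemma labLast_delta_pow : labLast (braidδ (M + 2) ^ (M + 2)) = cyc M ^ (M + 1) := by
  have h1 : (mm M (braidδ (M + 2) ^ (M + 2))).lab 0 = cyc M ^ (M + 1) := by
    rw [← gam_zero.2, ← mm_pow_lab gam_zero.1, gam_pow_eq]
  obtain ⟨h2, h3⟩ := mm_rr (M := M) (Nat.zero_le (M + 1))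
  have h4 := Subgroup.mem_center_iff.1 (delta_pow_mem_center (N := M + 1)) (rr M 0)
  have h5 := congrArg labLast h4
  rw [labLast, labLast, mm_mul_lab, mm_mul_lab, braidPerm_delta_pow, Perm.one_apply,
    ← labLast.eq_1 (rr M 0), h3, one_mul, mul_one, show braidPerm (M + 1) (rr M 0)
      (Fin.last (M + 1)) = 0 from Fin.ext h2, h1] at h5
  exact h5

lemma eq_evb_labLast {g : BraidGroup (M + 2)}
    (h : braidPerm (M + 1) g (Fin.last (M + 1)) = Fin.last (M + 1)) : g = evb M (labLast g) := by
  have h1 := mul_rr g (Fin.last (M + 1))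
  have h2 : rr M (Fin.last (M + 1) : Fin (M + 2)) = 1 := by rw [Fin.val_last, rr, dprod_self]
  rwa [h, h2, mul_one, one_mul] at h1

end BraidDual

lemma IsConj.zpow_zpow {G : Type*} [Group G] {a b : G} (h : IsConj a b) (k : ℤ) :
    IsConj (a ^ k) (b ^ k) := by
  obtain ⟨c, rfl⟩ := isConj_iff.1 h
  exact isConj_iff.2 ⟨c, (conj_zpow).symm⟩

namespace BraidDual

open Equiv Equiv.Perm IsBraid

variable {M : ℕ}

lemma ActsBy.inl_mul_pow {E : FreeBraid M} {t : Perm (Fin (M + 1))} (h : ActsBy E t)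
    (f : FreeGroup (Fin (M + 1))) (k : ℕ) : (SemidirectProduct.inl f * E) ^ k =
      SemidirectProduct.inl (FreeGroup.twistPow t f k) * E ^ k := by
  induction k with
  | zero => simp [FreeGroup.twistPow]
  | succ k ih =>
    rw [pow_succ', ih, FreeGroup.twistPow, map_mul, mul_assoc, ← mul_assoc E, h, pow_succ']
    simp only [mul_assoc]

lemma commute_cyc_pow (b : BraidGroup (M + 1)) :
    Commute (SemidirectProduct.inr b : FreeBraid M) (cyc M ^ (M + 1)) := by
  have h := Subgroup.mem_center_iff.1 (delta_pow_mem_center (N := M + 1)) (inc M b)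
  have h1 := congrArg labLast h
  obtain ⟨h2, h3⟩ := mm_inc b
  rw [labLast, labLast, mm_mul_lab, mm_mul_lab, braidPerm_delta_pow, Perm.one_apply,
    ← labLast.eq_1 (inc M b), h2, h3] at h1
  have h4 := labLast_delta_pow (M := M)
  rw [labLast] at h4
  rw [h4] at h1
  exact h1

lemma cyc_right : (cyc M).right = braidδ (M + 1) := by simp [cyc]

lemma conj_cyc {X : FreeBraid M} {k : ℕ} (hk : 0 < k) {c : ℤ} {j : ℤ}
    (hc : k * c = ((M + 1 : ℕ) : ℤ)) (hX : X ^ k = (cyc M ^ (M + 1)) ^ j) :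
    IsConj X (cyc M ^ (c * j)) := by
  have e : (cyc M ^ (M + 1)) ^ j = (cyc M ^ (c * j)) ^ k := by
    rw [← zpow_natCast, ← zpow_natCast, ← zpow_mul, ← zpow_mul, ← hc]
    congr 1; ring
  have hb : X.right ^ k = (braidδ (M + 1) ^ (c * j)) ^ k := by
    have := congrArg SemidirectProduct.rightHom (hX.trans e)
    rw [map_pow, map_pow, map_zpow, SemidirectProduct.rightHom_eq_right] at this
    rwa [cyc_right] at this
  obtain ⟨g, hg⟩ := isConj_iff.1 (conj_delta_of_pow_eq M _ _ k hk hb)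
  set E := cyc M ^ (c * j) with hE
  have hact : ActsBy E (cx M ^ (c * j)) := actsBy_cyc.zpow _
  set X1 : FreeBraid M := SemidirectProduct.inr g * X * (SemidirectProduct.inr g)⁻¹ with hX1
  have hX1k : X1 ^ k = E ^ k := by
    rw [hX1, conj_pow, hX, ← e, ((commute_cyc_pow g).zpow_right j).eq, mul_inv_cancel_right]
  have hr : SemidirectProduct.rightHom (X1 * E⁻¹) = 1 := by
    rw [map_mul, map_inv, hE, map_zpow, mul_inv_eq_one, SemidirectProduct.rightHom_eq_right]
    rw [cyc_right, ← hg, hX1]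
    simp
  obtain ⟨f, hf⟩ : ∃ f, SemidirectProduct.inl f = X1 * E⁻¹ := by
    have : X1 * E⁻¹ ∈ (SemidirectProduct.inl : _ →* FreeBraid M).range := by
      rw [SemidirectProduct.range_inl_eq_ker_rightHom]; exact hr
    exact this
  have hX1f : X1 = SemidirectProduct.inl f * E := by rw [hf, inv_mul_cancel_right]
  have htw : FreeGroup.twistPow (cx M ^ (c * j) : Perm (Fin (M + 1))) f k = 1 := by
    have := hact.inl_mul_pow f k
    rw [← hX1f, hX1k, eq_comm, mul_eq_right] at this
    exact SemidirectProduct.inl_injective (this.trans (map_one _).symm)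
  have hper : (cx M ^ (c * j)) ^ k = 1 := by
    rw [← zpow_natCast, ← zpow_mul, show c * j * k = ((M + 1 : ℕ) : ℤ) * j by rw [← hc]; ring,
      zpow_mul, zpow_natCast, cx_pow_succ, one_zpow]
  obtain ⟨h, hh⟩ := FreeGroup.exists_eq_mul_inv_of_twistPow _ hk hper f htw
  have h1 : X1 = SemidirectProduct.inl h * E * (SemidirectProduct.inl h)⁻¹ := by
    have h2 := hact h
    rw [hX1f, hh, map_mul, map_inv, mul_assoc, mul_assoc]
    congr 1
    rw [inv_mul_eq_iff_eq_mul, ← mul_assoc, ← h2, mul_inv_cancel_right]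
  have h3 : IsConj X X1 := isConj_iff.2 ⟨_, rfl⟩
  have h4 : IsConj E X1 := isConj_iff.2 ⟨_, h1.symm⟩
  exact h3.trans h4.symm

/-- A root of a central braid which fixes a strand is conjugate to a power of `σ_0 δ`. -/
theorem conj_gam_of_fixed {x : BraidGroup (M + 2)} {i : Fin (M + 2)}
    (hi : braidPerm (M + 1) x i = i) {k : ℕ} (hk : 0 < k) (hkM : k ∣ M + 1) {j : ℤ}
    (hx : x ^ k = (braidδ (M + 2) ^ (M + 2)) ^ j) : ∃ l : ℤ, IsConj x (gam (M + 1) ^ l) := by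
  obtain ⟨c, hc⟩ := hkM
  set r := rr M i with hr
  have hri : braidPerm (M + 1) r (Fin.last (M + 1)) = i :=
    Fin.ext (mm_rr (M := M) (p := i) (by omega)).1
  set y := r⁻¹ * x * r with hy
  have hxy : IsConj x y := isConj_iff.2 ⟨r⁻¹, by rw [hy, inv_inv]⟩
  have hyl : braidPerm (M + 1) y (Fin.last (M + 1)) = Fin.last (M + 1) := by
    rw [hy, map_mul, map_mul, Perm.mul_apply, Perm.mul_apply, hri, hi, map_inv]
    exact Perm.inv_eq_iff_eq.2 hri.symm
  have hyk : y ^ k = (braidδ (M + 2) ^ (M + 2)) ^ j := by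
    have h1 : y = r⁻¹ * x * (r⁻¹)⁻¹ := by rw [inv_inv]
    have h2 : Commute r⁻¹ (braidδ (M + 2) ^ (M + 2)) :=
      Subgroup.mem_center_iff.1 (delta_pow_mem_center (N := M + 1)) _
    rw [h1, conj_pow, hx, (h2.zpow_right j).eq, mul_inv_cancel_right]
  have hlab : labLast y ^ k = (cyc M ^ (M + 1)) ^ j := by
    rw [← labLast_delta_pow, labLast, ← mm_pow_lab hyl, hyk, mm_zpow_lab, labLast]
    rw [braidPerm_delta_pow, Perm.one_apply]
  have h := (evb M).map_isConj (conj_cyc hk (c := c) (by rw [hc]; push_cast; rfl) hlab)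
  rw [← eq_evb_labLast hyl, map_zpow] at h
  exact ⟨_, (hxy.trans h).trans (evb_cyc.zpow_zpow _)⟩

end BraidDual

namespace BraidDual

open Equiv Equiv.Perm IsBraid

variable {M N : ℕ}

lemma braidPerm_eq_one_of_mem_center (hN : 2 ≤ N) {g : BraidGroup (N + 1)}
    (hg : g ∈ Subgroup.center (BraidGroup (N + 1))) : braidPerm N g = 1 := by
  set p := braidPerm N g with hp
  have hc : ∀ i < N, ∀ x, p (sw N i x) = sw N i (p x) := by
    intro i hi x
    have h := congrArg (braidPerm N) (Subgroup.mem_center_iff.1 hg (sg N i))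
    rw [map_mul, map_mul, braidPerm_sg hi] at h
    exact (DFunLike.congr_fun h x).symm
  have hmem : ∀ i < N, ∀ x : Fin (N + 1), ((x : ℕ) = i ∨ (x : ℕ) = i + 1) →
      ((p x : ℕ) = i ∨ (p x : ℕ) = i + 1) := by
    intro i hi x hx
    by_contra! hne
    have h1 : sw N i (p x) = p x := by
      ext
      rw [sw_apply hi, if_neg hne.1, if_neg hne.2]
    rw [← hc i hi, p.injective.eq_iff] at h1
    have h2 := sw_apply hi x
    rw [h1] at h2
    split_ifs at h2 <;> omega
  have hmid : ∀ x : Fin (N + 1), 1 ≤ (x : ℕ) → (x : ℕ) < N → p x = x := by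
    intro x h1 h2
    have h3 := hmem x h2 x (Or.inl rfl)
    have h4 := hmem (x - 1) (by omega) x (by omega)
    ext
    omega
  ext x
  rw [Perm.one_apply]
  have hx := x.2
  rcases Nat.eq_zero_or_pos (x : ℕ) with h | h
  · have h1 := hmem 0 (by omega) x (by omega)
    have h2 := hmid ⟨1, by omega⟩ le_rfl (by simp; omega)
    have h3 : p x ≠ ⟨1, by omega⟩ := fun e => by
      have := p.injective (e.trans h2.symm)
      rw [this] at h
      simp at h
    have h4 : (p x : ℕ) ≠ 1 := fun e => h3 (Fin.ext e)
    omega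
  rcases lt_or_ge (x : ℕ) N with h' | h'
  · rw [hmid x h h']
  · have h1 := hmem (N - 1) (by omega) x (by omega)
    have h2 := hmid ⟨N - 1, by omega⟩ (by simp; omega) (by simp; omega)
    have h3 : p x ≠ ⟨N - 1, by omega⟩ := fun e => by
      have := p.injective (e.trans h2.symm)
      rw [this] at h'
      simp at h'
      omega
    have h4 : (p x : ℕ) ≠ N - 1 := fun e => h3 (Fin.ext e)
    omega

lemma braidPerm_evF (f : FreeGroup (Fin (M + 1))) : braidPerm (M + 1) (evF M f) = 1 := by
  have : (braidPerm (M + 1)).comp (evF M) = 1 := by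
    refine hom_ext_xg fun q hq => ?_
    have h : sw (M + 1) q ^ 2 = 1 := by
      ext x
      rw [pow_two, Perm.mul_apply, sw_apply hq, sw_apply hq, Perm.one_apply]
      split_ifs <;> omega
    rw [MonoidHom.comp_apply, evF_xg hq, yy, map_mul, map_mul, map_pow, braidPerm_sg hq, h,
      mul_one, map_inv, inv_mul_cancel, MonoidHom.one_apply]
  exact DFunLike.congr_fun this f

lemma braidPerm_inc (b : BraidGroup (M + 1)) : ∀ x : Fin (M + 1),
    braidPerm (M + 1) (inc M b) x.castSucc = (braidPerm M b x).castSucc := by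
  have hg : ∀ i < M, ∀ x : Fin (M + 1),
      braidPerm (M + 1) (inc M (sg M i)) x.castSucc = (braidPerm M (sg M i) x).castSucc := by
    intro i hi x
    rw [inc_sg hi, braidPerm_sg (by omega), braidPerm_sg hi]
    ext
    rw [sw_apply (by omega), Fin.val_castSucc, Fin.val_castSucc, sw_apply hi]
  induction b using braid_induction with
  | h1 => simp
  | hm i hi y ih =>
    intro x
    rw [map_mul, map_mul, map_mul, Perm.mul_apply, Perm.mul_apply, ih, hg i hi]
  | hi i hi y ih =>
    intro x
    rw [map_mul, map_mul, map_mul, Perm.mul_apply, Perm.mul_apply, ih, map_inv, map_inv, map_inv,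
      Perm.inv_eq_iff_eq, hg i hi, ← Perm.mul_apply, mul_inv_cancel, Perm.one_apply]

lemma labLast_sg_sq : braidPerm (M + 1) (sg (M + 1) M ^ 2) (Fin.last (M + 1)) = Fin.last (M + 1) ∧
    labLast (sg (M + 1) M ^ 2) = fx M M := by
  have h1 : (sw (M + 1) M (Fin.last (M + 1)) : ℕ) = M := by
    rw [sw_apply (by omega), Fin.val_last, if_neg (by omega), if_pos rfl]
  rw [pow_two]
  constructor
  · ext
    rw [map_mul, braidPerm_sg (by omega), Perm.mul_apply, sw_apply (by omega), h1, if_pos rfl,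
      Fin.val_last]
  · rw [labLast, mm_mul_lab, braidPerm_sg (by omega), mm_sg_lab (by omega), mm_sg_lab (by omega),
      h1, lbl, lbl, Fin.val_last, if_neg (by omega), if_neg (by omega), if_pos rfl,
      if_neg (by omega), if_pos rfl, mul_one]

lemma commute_labLast {g h : BraidGroup (M + 2)} (hg : g ∈ Subgroup.center (BraidGroup (M + 2)))
    (hgp : braidPerm (M + 1) g = 1)
    (hh : braidPerm (M + 1) h (Fin.last (M + 1)) = Fin.last (M + 1)) :
    Commute (labLast h) (labLast g) := by
  have h1 := congrArg labLast (Subgroup.mem_center_iff.1 hg h)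
  rwa [labLast, labLast, mm_mul_lab, mm_mul_lab, hgp, Perm.one_apply, hh] at h1

lemma exists_eq_cyc_zpow (hM : 1 ≤ M) {X : FreeBraid M}
    (h1 : Commute (fx M M) X) (h2 : Commute (fx M (M - 1)) X) {l : ℤ}
    (hb : X.right = (braidδ (M + 1) ^ (M + 1)) ^ l) : X = (cyc M ^ (M + 1)) ^ l := by
  have hact : ActsBy (cyc M ^ (M + 1)) 1 := by
    rw [← cx_pow_succ]; exact actsBy_cyc.pow _
  have hcom : ∀ f, Commute (SemidirectProduct.inl f : FreeBraid M) ((cyc M ^ (M + 1)) ^ l) := by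
    intro f
    refine Commute.zpow_right ?_ l
    have h := hact f
    have : FreeGroup.map (⇑(1 : Perm (Fin (M + 1)))) f = f := FreeGroup.map.id f
    rw [this] at h
    exact h.symm
  have hr : SemidirectProduct.rightHom (X * ((cyc M ^ (M + 1)) ^ l)⁻¹) = 1 := by
    rw [map_mul, map_inv, map_zpow, map_pow, mul_inv_eq_one, SemidirectProduct.rightHom_eq_right]
    rw [cyc_right, hb]
  obtain ⟨f, hf⟩ : ∃ f, SemidirectProduct.inl f = X * ((cyc M ^ (M + 1)) ^ l)⁻¹ := by
    have : X * ((cyc M ^ (M + 1)) ^ l)⁻¹ ∈ (SemidirectProduct.inl : _ →* FreeBraid M).range := by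
      rw [SemidirectProduct.range_inl_eq_ker_rightHom]; exact hr
    exact this
  have hq : ∀ q < M + 1, Commute (fx M q) X → Commute f (xg M q) := by
    intro q _ hX
    have h : Commute (fx M q) (SemidirectProduct.inl f) := by
      rw [hf]; exact hX.mul_right (hcom _).inv_right
    refine (SemidirectProduct.inl_injective (φ := artHom M) ?_ : f * xg M q = xg M q * f)
    rw [map_mul, map_mul]
    exact h.symm.eq
  have h3 := hq M (by omega) h1
  have h4 := hq (M - 1) (by omega) h2
  rw [xg, dif_pos (by omega)] at h3 h4
  have h5 : f = 1 := FreeGroup.eq_one_of_commute (fun e => by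
    have := congrArg Fin.val e
    simp at this
    omega) h3 h4
  rw [h5, map_one, eq_comm, mul_inv_eq_one] at hf
  exact hf

/-- Central pure braids are powers of the full twist. -/
theorem exists_eq_of_mem_center_of_perm (hN : 1 ≤ N) {g : BraidGroup (N + 1)}
    (hg : g ∈ Subgroup.center (BraidGroup (N + 1))) (hp : braidPerm N g = 1) :
    ∃ l : ℤ, g = (braidδ (N + 1) ^ (N + 1)) ^ l := by
  induction N, hN using Nat.le_induction with
  | base =>
    have h : ∃ l : ℤ, g = braidδ 2 ^ l := by
      have hd : braidδ 2 = sg 1 0 := by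
        rw [braidδ_eq 1, dprod_succ le_rfl, dprod_self, one_mul]
      rw [hd]
      clear hg hp
      induction g using braid_induction with
      | h1 => exact ⟨0, by simp⟩
      | hm i hi x ih =>
        obtain rfl : i = 0 := by omega
        obtain ⟨l, rfl⟩ := ih
        exact ⟨1 + l, by rw [zpow_one_add]⟩
      | hi i hi x ih =>
        obtain rfl : i = 0 := by omega
        obtain ⟨l, rfl⟩ := ih
        exact ⟨-1 + l, by rw [zpow_add, zpow_neg_one]⟩
    obtain ⟨l, rfl⟩ := h
    rw [map_zpow, braidPerm_delta (N := 1)] at hp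
    obtain ⟨c, rfl⟩ := dvd_of_cx_zpow (N := 1) (m := l) (x := 0) (by rw [hp]; rfl)
    exact ⟨c, by rw [zpow_mul, zpow_natCast]⟩
  | succ M hM ih =>
    set X := labLast g with hX
    have hgX : g = evb M X := eq_evb_labLast (by rw [hp, Perm.one_apply])
    have hinr : ∀ b, Commute (SemidirectProduct.inr b : FreeBraid M) X := by
      intro b
      obtain ⟨h1, h2⟩ := mm_inc b
      rw [← h2]
      exact commute_labLast hg hp h1
    have hM1 : Commute (fx M M) X := by
      rw [← labLast_sg_sq.2]
      exact commute_labLast hg hp labLast_sg_sq.1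
    have hM2 : Commute (fx M (M - 1)) X := by
      have h := fs_mul_fx_succ (M := M) (i := M - 1) (by omega)
      rw [Nat.sub_add_cancel hM] at h
      have : fx M (M - 1) = fs M (M - 1) * fx M M * (fs M (M - 1))⁻¹ := by
        rw [h, mul_inv_cancel_right]
      rw [this]
      exact ((hinr _).mul_left hM1).mul_left (hinr _).inv_left
    have hbc : X.right ∈ Subgroup.center (BraidGroup (M + 1)) := by
      rw [Subgroup.mem_center_iff]
      intro b
      have := congrArg SemidirectProduct.right (hinr b).eq
      simpa using this
    have hbp : braidPerm M X.right = 1 := by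
      have h1 : g = evF M X.left * inc M X.right := hgX
      rw [h1, map_mul, braidPerm_evF, one_mul] at hp
      ext x
      have h2 := braidPerm_inc X.right x
      rw [hp, Perm.one_apply] at h2
      rw [Perm.one_apply, ← Fin.castSucc_injective _ h2]
    obtain ⟨l, hl⟩ := ih hbc hbp
    refine ⟨l, ?_⟩
    have hz : braidδ (M + 2) ^ (M + 2) = evb M (cyc M ^ (M + 1)) := by
      rw [← labLast_delta_pow]
      exact eq_evb_labLast (by rw [braidPerm_delta_pow, Perm.one_apply])
    rw [hgX, exists_eq_cyc_zpow hM hM1 hM2 hl, map_zpow]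
    exact congrArg (· ^ l) hz.symm

/-- The center of the braid group on at least three strands is generated by the full twist. -/
theorem exists_eq_of_mem_center (hN : 2 ≤ N) {g : BraidGroup (N + 1)}
    (hg : g ∈ Subgroup.center (BraidGroup (N + 1))) :
    ∃ l : ℤ, g = (braidδ (N + 1) ^ (N + 1)) ^ l :=
  exists_eq_of_mem_center_of_perm (by omega) hg (braidPerm_eq_one_of_mem_center hN hg)

/-- Roots of central braids are conjugate to powers of `δ` or of `σ_0 δ`. -/
theorem conj_of_pow_mem_center (hN : 2 ≤ N) {x : BraidGroup (N + 1)} {K : ℕ} (hK : 0 < K)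
    (hx : x ^ K ∈ Subgroup.center (BraidGroup (N + 1))) :
    ∃ m : ℤ, IsConj x (braidδ (N + 1) ^ m) ∨ IsConj x (gam N ^ m) := by
  obtain ⟨J, hJ⟩ := exists_eq_of_mem_center hN hx
  rw [← zpow_natCast (braidδ (N + 1)), ← zpow_mul] at hJ
  set L : ℤ := ((N + 1 : ℕ) : ℤ) * J with hL
  obtain ⟨d, k, m, hd, hcop, hk, hm⟩ : ∃ (d k : ℕ) (m : ℤ), 0 < d ∧ IsCoprime (k : ℤ) m ∧
      K = k * d ∧ L = m * d := by
    have hpos : 0 < Int.gcd K L := Int.gcd_pos_of_ne_zero_left _ (by omega)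
    obtain ⟨k, hk⟩ : Int.gcd K L ∣ K := by exact_mod_cast Int.gcd_dvd_left (K : ℤ) L
    obtain ⟨m, hm⟩ := Int.gcd_dvd_right (K : ℤ) L
    refine ⟨Int.gcd K L, k, m, hpos, ?_, by rw [mul_comm]; exact hk, by rw [mul_comm]; exact hm⟩
    have h1 := Int.gcd_eq_gcd_ab (K : ℤ) L
    refine ⟨Int.gcdA K L, Int.gcdB K L, ?_⟩
    have h2 : ((Int.gcd K L : ℕ) : ℤ) ≠ 0 := by exact_mod_cast hpos.ne'
    have hk' : (K : ℤ) = (Int.gcd K L : ℕ) * k := by exact_mod_cast hk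
    refine mul_left_cancel₀ h2 ?_
    rw [mul_one]
    calc _ = ((Int.gcd K L : ℕ) * (k : ℤ)) * Int.gcdA K L + ((Int.gcd K L : ℕ) * m) *
        Int.gcdB K L := by ring
      _ = (K : ℤ) * Int.gcdA K L + L * Int.gcdB K L := by rw [← hk', ← hm]
      _ = _ := h1.symm
  have h1 : (x ^ k) ^ d = (braidδ (N + 1) ^ m) ^ d := by
    rw [← pow_mul, ← hk, hJ, hm, zpow_mul, zpow_natCast]
  obtain ⟨g, hg⟩ := isConj_iff.1 (conj_delta_of_pow_eq N _ m d hd h1)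
  rw [← conj_pow] at hg
  have hconj : IsConj x (g * x * g⁻¹) := isConj_iff.2 ⟨g, rfl⟩
  have hk0 : k ≠ 0 := by rintro rfl; omega
  by_cases hk1 : k = 1
  · rw [hk1, pow_one] at hg
    exact ⟨m, Or.inl (hg ▸ hconj)⟩
  · obtain ⟨hkN, ⟨j, hj⟩, i, hi⟩ := exists_fixed_of_pow_eq _ (by omega) hcop hg
    obtain ⟨M, rfl⟩ : ∃ M, N = M + 1 := ⟨N - 1, by omega⟩
    rw [hj, zpow_mul, zpow_natCast] at hg
    obtain ⟨l, hl⟩ := conj_gam_of_fixed hi (by omega) hkN hg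
    exact ⟨l, Or.inr (hconj.trans hl)⟩

end BraidDual

/-- For `n ≥ 4`, any root of a central element of `B_n` is conjugate to a
power of `δ = σ_1⋯σ_{n-1}` or to a power of `γ = σ_1 δ`. -/
theorem braidGroup_root_of_central (n : ℕ) (hn : 4 ≤ n)
    (x : BraidGroup n) (k : ℤ) (hk : k ≠ 0)
    (hx : x ^ k ∈ Subgroup.center (BraidGroup n)) :
    ∃ m : ℤ, IsConj x (braidδ n ^ m) ∨
      IsConj x ((braidσ n ⟨0, by omega⟩ * braidδ n) ^ m) := by
  obtain ⟨N, rfl⟩ : ∃ N, n = N + 1 := ⟨n - 1, by omega⟩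
  have hx' : x ^ k.natAbs ∈ Subgroup.center (BraidGroup (N + 1)) := by
    rcases Int.natAbs_eq k with h | h
    · rw [h, zpow_natCast] at hx; exact hx
    · rw [h, zpow_neg, zpow_natCast, Subgroup.inv_mem_iff] at hx; exact hx
  have h0 : sg N 0 = braidσ (N + 1) ⟨0, by omega⟩ := dif_pos (by omega)
  have h := BraidDual.conj_of_pow_mem_center (by omega) (Int.natAbs_pos.2 hk) hx'
  rwa [BraidDual.gam, h0] at h
end

section
/- Let ρ : Γ → Γ' be an injective group homomorphism. Suppose rk(Γ) = r is finite and rk(Γ') = r + R for some non-negative integer R. Let G ≤ Γ be an abelian subgroup with rk(G) = r, and let f ∈ G. Then rk(Z(C_{Γ'}(ρ(f)))) ≤ rk(Z(C_Γ(f))) + R, where C_Γ(f) denotes the centralizer of f in Γ and Z(−) denotes the center. -/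
/-- `H` contains a free abelian subgroup of rank `m`, i.e. there is an injective
homomorphism of `ℤ^m` into `H`. -/
def HasFreeAbelianOfRank (H : Type*) [Group H] (m : ℕ) : Prop :=
  ∃ f : Multiplicative (Fin m → ℤ) →* H, Function.Injective f

/-- The rank of `H` (the maximal rank of a free abelian subgroup) equals `r`. -/
def RankEq (H : Type*) [Group H] (r : ℕ) : Prop :=
  HasFreeAbelianOfRank H r ∧ ∀ m : ℕ, HasFreeAbelianOfRank H m → m ≤ r

/-- If the kernel of `g : M →* H` is contained in `K`, then `H` contains a free abelian subgroup
of the rank of `M ⧸ K`. -/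
theorem hasFreeAbelianOfRank_finrank_quotient {M H : Type*} [AddCommGroup M] [Group H]
    [Module.Finite ℤ M] (g : Multiplicative M →* H) (K : Submodule ℤ M)
    (hK : ∀ x : M, g (Multiplicative.ofAdd x) = 1 → x ∈ K) :
    HasFreeAbelianOfRank H (Module.finrank ℤ (M ⧸ K)) := by
  obtain ⟨w, hw⟩ := exists_linearIndependent_of_le_finrank (R := ℤ) (M := M ⧸ K) le_rfl
  choose v hv using fun i => K.mkQ_surjective (w i)
  refine ⟨g.comp (AddMonoidHom.toMultiplicative
    (Fintype.linearCombination ℤ v).toAddMonoidHom), ?_⟩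
  rw [injective_iff_map_eq_one]
  intro c hc
  have hmem := hK _ hc
  rw [← Submodule.Quotient.mk_eq_zero, ← Submodule.mkQ_apply] at hmem
  have hsum : ∑ i, c.toAdd i • w i = 0 := by
    rw [← hmem]
    change _ = K.mkQ (Fintype.linearCombination ℤ v c.toAdd)
    simp only [Fintype.linearCombination_apply, map_sum, map_zsmul, hv]
  have hzero := Fintype.linearIndependent_iff.mp hw c.toAdd hsum
  exact Multiplicative.toAdd.injective (funext hzero)

/-- A group containing an isomorphic copy of `M` contains a free abelian subgroup of the rank
of `M`. -/
theorem hasFreeAbelianOfRank_finrank {M H : Type*} [AddCommGroup M] [Group H]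
    [Module.Finite ℤ M] (g : Multiplicative M →* H) (hg : Function.Injective g) :
    HasFreeAbelianOfRank H (Module.finrank ℤ M) := by
  have h := hasFreeAbelianOfRank_finrank_quotient g ⊥ fun x hx =>
    (Submodule.mem_bot ℤ).2 (Multiplicative.ofAdd.injective (hg (hx.trans (map_one g).symm)))
  rwa [(Submodule.quotEquivOfEqBot (⊥ : Submodule ℤ M) rfl).finrank_eq] at h

/-- If `ρ : Γ → Γ'` is injective, `rk Γ = r`, `rk Γ' = r + R`, `G ≤ Γ` is
an abelian subgroup of maximal rank `r`, and `f ∈ G`, then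
`rk Z(C_{Γ'}(ρ f)) ≤ rk Z(C_Γ f) + R`. -/
theorem rank_center_centralizer_bound {Γ Γ' : Type*} [Group Γ] [Group Γ']
    (ρ : Γ →* Γ') (hρ : Function.Injective ρ)
    (r R : ℕ) (hΓ : RankEq Γ r) (hΓ' : RankEq Γ' (r + R))
    (G : Subgroup Γ) (hGab : ∀ x ∈ G, ∀ y ∈ G, x * y = y * x)
    (hG : RankEq G r) (f : Γ) (hf : f ∈ G)
    (s : ℕ)
    (hs : RankEq (Subgroup.center (Subgroup.centralizer ({f} : Set Γ))) s) :
    ∀ m : ℕ,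
      HasFreeAbelianOfRank
        (Subgroup.center (Subgroup.centralizer ({ρ f} : Set Γ'))) m →
      m ≤ s + R := by
  rintro m ⟨φ, hφ⟩
  obtain ⟨ψ, hψ⟩ := hG.1
  let C := Subgroup.centralizer ({f} : Set Γ)
  let C' := Subgroup.centralizer ({ρ f} : Set Γ')
  let α : Multiplicative (Fin m → ℤ) →* Γ' := (C'.subtype.comp (Subgroup.center C').subtype).comp φ
  let β : Multiplicative (Fin r → ℤ) →* Γ := G.subtype.comp ψ
  have hα : Function.Injective α :=
    (Subtype.val_injective.comp Subtype.val_injective).comp hφ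
  have hβ : Function.Injective β := Subtype.val_injective.comp hψ
  have hαcomm : ∀ a, ∀ y ∈ C', y * α a = α a * y := fun a y hy =>
    congrArg Subtype.val (Subgroup.mem_center_iff.1 (φ a).2 ⟨y, hy⟩)
  have hρC : ∀ x ∈ C, ρ x ∈ C' := fun x hx => by
    rw [Subgroup.mem_centralizer_singleton_iff] at hx ⊢
    rw [← map_mul, ← map_mul, hx]
  have hβC : ∀ b, β b ∈ C := fun b =>
    Subgroup.mem_centralizer_singleton_iff.2 (hGab _ (ψ b).2 _ hf)
  have hcomm : ∀ a b, Commute (α a) ((ρ.comp β) b) := fun a b =>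
    (hαcomm a _ (hρC _ (hβC b))).symm
  let Φ : Multiplicative ((Fin m → ℤ) × (Fin r → ℤ)) →* Γ' :=
    (MonoidHom.noncommCoprod α (ρ.comp β) hcomm).comp
      (MulEquiv.prodMultiplicative (Fin m → ℤ) (Fin r → ℤ)).toMonoidHom
  have hΦ : ∀ x : (Fin m → ℤ) × (Fin r → ℤ), Φ (Multiplicative.ofAdd x) =
      α (Multiplicative.ofAdd x.1) * ρ (β (Multiplicative.ofAdd x.2)) := fun _ => rfl
  let K : Submodule ℤ ((Fin m → ℤ) × (Fin r → ℤ)) :=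
    AddSubgroup.toIntSubmodule (MonoidHom.toAdditiveRight Φ).ker
  have hK : ∀ x, x ∈ K ↔ Φ (Multiplicative.ofAdd x) = 1 := fun _ => Iff.rfl
  have hquot := hΓ'.2 _ (hasFreeAbelianOfRank_finrank_quotient Φ K fun x hx => (hK x).2 hx)
  let γ : Multiplicative K →* Γ :=
    β.comp (AddMonoidHom.toMultiplicative
      ((LinearMap.snd ℤ (Fin m → ℤ) (Fin r → ℤ)).comp K.subtype).toAddMonoidHom)
  have hγΦ : ∀ k : Multiplicative K,
      α (Multiplicative.ofAdd k.toAdd.1.1) * ρ (γ k) = 1 := fun k => (hK _).1 k.toAdd.2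
  have hγ : Function.Injective γ := by
    rw [injective_iff_map_eq_one]
    intro k hk
    have h1 := hγΦ k
    rw [hk, map_one, mul_one] at h1
    have ha := hα (h1.trans (map_one α).symm)
    have hb := hβ ((show β (Multiplicative.ofAdd k.toAdd.1.2) = 1 from hk).trans (map_one β).symm)
    exact Multiplicative.toAdd.injective (Subtype.ext (Prod.ext ha hb))
  let γC : Multiplicative K →* C := γ.codRestrict C fun _ => hβC _
  have hγcenter : ∀ k, γC k ∈ Subgroup.center C := by
    refine fun k => Subgroup.mem_center_iff.2 fun y => Subtype.ext (hρ ?_)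
    change ρ (y * γ k) = ρ (γ k * y)
    rw [map_mul, map_mul, eq_inv_of_mul_eq_one_right (hγΦ k), ← map_inv]
    exact hαcomm _ _ (hρC y y.2)
  have hker := hs.2 _ (hasFreeAbelianOfRank_finrank (γC.codRestrict (Subgroup.center C) hγcenter)
    fun x y hxy => hγ (congrArg (fun z => (z.1 : Γ)) hxy))
  have hsum := K.finrank_quotient_add_finrank
  rw [Module.finrank_prod, Module.finrank_fin_fun, Module.finrank_fin_fun] at hsum
  omega
end
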